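/- Let G be a 2-vertex-connected finite simple graph on n vertices admitting a feasible Held-Karp solution. Then G contains a spanning closed walk of length at most (10/9)·OPT_LP(G) + n/3. -/

import Mathlib

open scoped Classical

/-- The total LP value of edges of `G` crossing the cut `(S, Sᶜ)`:
the sum of `x e` over edges `e` of `G` with exactly one endpoint in `S`. -/
noncomputable def cutValue {V : Type*} [Fintype V] (G : SimpleGraph V)
    (x : Sym2 V → ℝ) (S : Set V) : ℝ :=
  ∑ e ∈ Finset.univ.filter
      (fun e : Sym2 V => e ∈ G.edgeSet ∧ ∃ a b, e = s(a, b) ∧ a ∈ S ∧ b ∉ S), x e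

/-- The total value `∑_{e ∈ E} x_e` of a putative Held-Karp solution. -/
noncomputable def lpValue {V : Type*} [Fintype V] (G : SimpleGraph V)
    (x : Sym2 V → ℝ) : ℝ :=
  ∑ e ∈ Finset.univ.filter (fun e : Sym2 V => e ∈ G.edgeSet), x e

/-- `x` is a feasible Held-Karp solution for `G`. -/
def IsHeldKarp {V : Type*} [Fintype V] (G : SimpleGraph V) (x : Sym2 V → ℝ) : Prop :=
  (∀ e ∈ G.edgeSet, 0 ≤ x e) ∧
  ∀ S : Set V, S.Nonempty → S ≠ Set.univ → 2 ≤ cutValue G x S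

/-- The Held-Karp value `OPT_LP(G)`. -/
noncomputable def optLP {V : Type*} [Fintype V] (G : SimpleGraph V) : ℝ :=
  sInf {y | ∃ x, IsHeldKarp G x ∧ lpValue G x = y}

/-- `G` is 2-vertex-connected: it has at least 3 vertices and deleting any single
vertex leaves a connected (induced) graph. -/
def IsTwoVertexConnected {V : Type*} [Fintype V] (G : SimpleGraph V) : Prop :=
  3 ≤ Fintype.card V ∧ ∀ v : V, (G.induce ({v}ᶜ : Set V)).Connected

/-- The trade-off between the number `k` of back edges entering a vertex and their total
weight `y`, when each of them is at most the weight of the tree edge. -/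
lemma posPart_sub_one_le (k : ℕ) (y q : ℝ) (hk : y ≤ k) (hy : (k + 1) * y ≤ k * q) :
    max (y - 1) 0 ≤ k / 6 + 5 / 6 * max (q - 2) 0 := by
  have hk0 : (0 : ℝ) ≤ k := Nat.cast_nonneg k
  have hkk : (0 : ℝ) ≤ ((k : ℝ) - 2) * (k - 3) := by
    rcases Nat.lt_or_ge k 3 with h | h
    · interval_cases k <;> norm_num
    · have : (3 : ℝ) ≤ k := by exact_mod_cast h
      nlinarith
  have h0 : 0 ≤ max (q - 2) 0 := le_max_right _ _
  apply max_le _ (by positivity)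
  rcases le_total q 2 with hq | hq
  · rw [max_eq_right (by linarith)]
    have : (k + 1) * y ≤ k * 2 := hy.trans (by nlinarith)
    nlinarith
  · rw [max_eq_left (by linarith)]
    rcases le_total (k - 1 : ℝ) (q - 2) with he | he
    · nlinarith
    · rcases le_total (k : ℝ) 5 with h5 | h5
      · nlinarith [mul_nonneg (sub_nonneg.2 h5) (sub_nonneg.2 hq)]
      · nlinarith [mul_nonneg (sub_nonneg.2 h5) (sub_nonneg.2 he)]

/-- Moving along a direction until the first of finitely many nonnegative slacks vanishes. -/
lemma exists_ratio_step {ι : Type*} [Finite ι] (s d : ι → ℝ) (hs : ∀ i, 0 ≤ s i)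
    (hd : ∀ i, s i = 0 → d i = 0) (hneg : ∃ i, d i < 0) :
    ∃ t : ℝ, 0 < t ∧ (∀ i, 0 ≤ s i + t * d i) ∧ ∃ i, s i ≠ 0 ∧ s i + t * d i = 0 := by
  have := Fintype.ofFinite ι
  obtain ⟨i, hi, hmin⟩ := Finset.exists_min_image
    (Finset.univ.filter fun i => d i < 0) (fun i => s i / -d i)
    (by obtain ⟨i, hi⟩ := hneg; exact ⟨i, by simpa using hi⟩)
  simp only [Finset.mem_filter, Finset.mem_univ, true_and] at hi hmin
  have hsi : s i ≠ 0 := fun h => hi.ne (hd i h)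
  have hpos : 0 < s i := lt_of_le_of_ne (hs i) hsi.symm
  refine ⟨s i / -d i, div_pos hpos (by linarith), fun j => ?_, i, hsi, ?_⟩
  · rcases lt_or_ge (d j) 0 with hj | hj
    · have h1 := hmin j hj
      rw [le_div_iff₀ (by linarith)] at h1
      linarith
    · have : 0 < s i / -d i := div_pos hpos (by linarith)
      have := hs j
      positivity
  · have := hi.ne
    field_simp
    ring

/-- The weight of the cut `(S, Sᶜ)` for weights on all unordered pairs. -/
noncomputable def pairCut {V : Type*} [Fintype V] (x : Sym2 V → ℝ) (S : Finset V) : ℝ :=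
  ∑ a, ∑ b, if a ∈ S ∧ b ∉ S then x s(a, b) else 0

lemma pairCut_add_smul {V : Type*} [Fintype V] (x d : Sym2 V → ℝ) (t : ℝ) (S : Finset V) :
    pairCut (fun e => x e + t * d e) S = pairCut x S + t * pairCut d S := by
  simp only [pairCut, Finset.mul_sum, ← Finset.sum_add_distrib]
  refine Finset.sum_congr rfl fun a _ => Finset.sum_congr rfl fun b _ => ?_
  split_ifs <;> ring

lemma pairCut_compl {V : Type*} [Fintype V] (x : Sym2 V → ℝ) (S : Finset V) :
    pairCut x Sᶜ = pairCut x S := by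
  unfold pairCut
  rw [Finset.sum_comm]
  refine Finset.sum_congr rfl fun a _ => Finset.sum_congr rfl fun b _ => ?_
  rw [Sym2.eq_swap]
  congr 1
  simp only [Finset.mem_compl, not_not, eq_iff_iff]
  tauto

/-- The total weight between two vertex sets, over ordered pairs. -/
noncomputable def pairBetween {V : Type*} [Fintype V] (x : Sym2 V → ℝ) (S T : Finset V) : ℝ :=
  ∑ a, ∑ b, if a ∈ S ∧ b ∈ T then x s(a, b) else 0

lemma pairBetween_comm {V : Type*} [Fintype V] (x : Sym2 V → ℝ) (S T : Finset V) :
    pairBetween x S T = pairBetween x T S := by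
  unfold pairBetween
  rw [Finset.sum_comm]
  refine Finset.sum_congr rfl fun a _ => Finset.sum_congr rfl fun b _ => ?_
  rw [Sym2.eq_swap]
  congr 1
  rw [and_comm]

lemma pairCut_add_pairCut {V : Type*} [Fintype V] (x : Sym2 V → ℝ) (S T : Finset V) :
    pairCut x S + pairCut x T =
      pairCut x (S ∩ T) + pairCut x (S ∪ T) + 2 * pairBetween x (S \ T) (T \ S) := by
  rw [two_mul]
  nth_rw 2 [pairBetween_comm]
  simp only [pairCut, pairBetween, ← Finset.sum_add_distrib]
  refine Finset.sum_congr rfl fun a _ => Finset.sum_congr rfl fun b _ => ?_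
  by_cases h1 : a ∈ S <;> by_cases h2 : a ∈ T <;> by_cases h3 : b ∈ S <;> by_cases h4 : b ∈ T <;>
    simp [h1, h2, h3, h4]

/-- Two sets cross if they intersect and neither contains the other. -/
def Crosses {V : Type*} (S T : Finset V) : Prop :=
  (S ∩ T).Nonempty ∧ ¬ S ⊆ T ∧ ¬ T ⊆ S

lemma Crosses.of_inter {V : Type*} {S T M : Finset V} (hM : ¬ Crosses M T)
    (h : Crosses M (S ∩ T)) : Crosses M S := by
  obtain ⟨⟨a, ha⟩, h2, h3⟩ := h
  simp only [Finset.mem_inter] at ha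
  have hMT : M ⊆ T := by
    by_contra hc
    refine hM ⟨⟨a, by simp [ha]⟩, hc, fun hTM => h3 fun y hy => hTM (Finset.mem_inter.1 hy).2⟩
  exact ⟨⟨a, by simp [ha]⟩, fun h => h2 (Finset.subset_inter h hMT),
    fun h => h3 (Finset.inter_subset_left.trans h)⟩

lemma Crosses.of_union {V : Type*} {S T M : Finset V} (hST : Crosses S T) (hM : ¬ Crosses M T)
    (h : Crosses M (S ∪ T)) : Crosses M S := by
  obtain ⟨⟨a, ha⟩, h2, h3⟩ := h
  obtain ⟨⟨c, hc⟩, h4, h5⟩ := hST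
  simp only [Finset.mem_inter, Finset.mem_union] at ha hc
  have h6 : ¬ M ⊆ S := fun h => h2 (h.trans Finset.subset_union_left)
  have h7 : ¬ M ⊆ T := fun h => h2 (h.trans Finset.subset_union_right)
  by_cases hTM : T ⊆ M
  · exact ⟨⟨c, Finset.mem_inter.2 ⟨hTM hc.2, hc.1⟩⟩, h6,
      fun h => h3 (Finset.union_subset h hTM)⟩
  · have hdis : ∀ y ∈ M, y ∉ T := fun y hy hyT => hM ⟨⟨y, by simp [hy, hyT]⟩, h7, hTM⟩
    have haS : a ∈ S := ha.2.resolve_right (hdis a ha.1)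
    exact ⟨⟨a, by simp [ha.1, haS]⟩, h6, fun h => hdis c (h hc.1) hc.2⟩

/-- A laminar family of nonempty subsets of `X` has at most `2 * #X` members. -/
lemma card_laminar_le {V : Type*} (X : Finset V) (L : Finset (Finset V))
    (hX : ∀ S ∈ L, S ⊆ X ∧ S.Nonempty) (hL : ∀ S ∈ L, ∀ T ∈ L, ¬ Crosses S T) :
    L.card ≤ 2 * X.card := by
  induction X using Finset.induction_on generalizing L with
  | empty =>
    rw [Finset.card_eq_zero.2 (Finset.eq_empty_of_forall_notMem fun S hS => ?_)]
    · simp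
    · obtain ⟨h1, y, hy⟩ := hX S hS
      exact absurd (h1 hy) (by simp)
  | insert v X hv ih =>
    set f : Finset V → Finset V := fun S => S.erase v
    set L' := (L.erase {v}).image f
    have hL' : L'.card ≤ 2 * X.card := by
      apply ih
      · intro S hS
        obtain ⟨T, hT, rfl⟩ := Finset.mem_image.1 hS
        obtain ⟨hTv, hT⟩ := Finset.mem_erase.1 hT
        refine ⟨fun y hy => ?_, ?_⟩
        · obtain ⟨h1, h2⟩ := Finset.mem_erase.1 hy
          exact (Finset.mem_insert.1 ((hX T hT).1 h2)).resolve_left h1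
        · by_contra hc
          rw [Finset.not_nonempty_iff_eq_empty, Finset.erase_eq_empty_iff] at hc
          exact hc.elim (hX T hT).2.ne_empty hTv
      · intro S hS T hT hST
        obtain ⟨S, hS', rfl⟩ := Finset.mem_image.1 hS
        obtain ⟨T, hT', rfl⟩ := Finset.mem_image.1 hT
        apply hL S (Finset.mem_of_mem_erase hS') T (Finset.mem_of_mem_erase hT')
        obtain ⟨⟨y, hy⟩, h2, h3⟩ := hST
        simp only [f, Finset.mem_inter, Finset.mem_erase] at hy
        exact ⟨⟨y, by simp [hy]⟩, fun h => h2 (Finset.erase_subset_erase _ h),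
          fun h => h3 (Finset.erase_subset_erase _ h)⟩
    have hcol : ∃ S₀ : Finset V, ((L.erase {v}).erase S₀).card ≤ L'.card := by
      by_cases hex : ∃ S ∈ L, v ∈ S ∧ S.erase v ∈ L
      · obtain ⟨S₀, hS₀, hv₀, he₀⟩ := hex
        have key : ∀ S ∈ L, v ∈ S → S.erase v ∈ L → S ≠ {v} → S ⊆ S₀ := by
          intro S hS hvS heS hne
          by_contra hc
          have h1 := hL S₀ hS₀ S hS
          have hS₀S : S₀ ⊆ S := by
            by_contra hc'
            exact h1 ⟨⟨v, by simp [hv₀, hvS]⟩, hc', hc⟩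
          obtain ⟨y, hy⟩ := (hX _ he₀).2
          obtain ⟨z, hz, hz'⟩ := Finset.not_subset.1 hc
          refine hL S₀ hS₀ _ heS ⟨⟨y, ?_⟩, ?_, ?_⟩
          · have := Finset.mem_erase.1 hy
            simp [this.1, this.2, hS₀S this.2]
          · intro h
            simpa using h hv₀
          · intro h
            exact hz' (h (Finset.mem_erase.2 ⟨fun h => hz' (h ▸ hv₀), hz⟩))
        have key2 : ∀ S ∈ L, v ∈ S → S.erase v ∈ L → S ≠ {v} → S = S₀ := by
          intro S hS hvS heS hne
          refine (key S hS hvS heS hne).antisymm ?_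
          by_contra hc
          obtain ⟨z, hz, hz'⟩ := Finset.not_subset.1 hc
          obtain ⟨y, hy⟩ := (hX _ heS).2
          have hyS := Finset.mem_erase.1 hy
          refine hL S hS _ he₀ ⟨⟨y, ?_⟩, ?_, ?_⟩
          · simp [hyS.1, hyS.2, key S hS hvS heS hne hyS.2]
          · intro h
            simpa using h hvS
          · intro h
            exact hz' (h (Finset.mem_erase.2 ⟨fun h => hz' (h ▸ hvS), hz⟩))
        refine ⟨S₀, (Finset.card_le_card_of_injOn f (fun S hS => Finset.mem_image_of_mem f
          (Finset.mem_of_mem_erase hS)) ?_)⟩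
        intro S hS T hT hST
        simp only [Finset.coe_erase, Set.mem_sdiff, Finset.mem_coe, Set.mem_singleton_iff] at hS hT
        simp only [f] at hST
        by_cases h1 : v ∈ S <;> by_cases h2 : v ∈ T
        · rw [← Finset.insert_erase h1, ← Finset.insert_erase h2, hST]
        · rw [Finset.erase_eq_of_notMem h2] at hST
          exact absurd (key2 S hS.1.1 h1 (hST ▸ hT.1.1) hS.1.2) hS.2
        · rw [Finset.erase_eq_of_notMem h1] at hST
          exact absurd (key2 T hT.1.1 h2 (hST ▸ hS.1.1) hT.1.2) hT.2
        · rwa [Finset.erase_eq_of_notMem h1, Finset.erase_eq_of_notMem h2] at hST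
      · refine ⟨∅, (Finset.card_le_card (Finset.erase_subset _ _)).trans
          (Finset.card_le_card_of_injOn f (fun S hS => Finset.mem_image_of_mem f hS) ?_)⟩
        intro S hS T hT hST
        simp only [Finset.coe_erase, Set.mem_sdiff, Finset.mem_coe, Set.mem_singleton_iff] at hS hT
        simp only [f] at hST
        by_cases h1 : v ∈ S <;> by_cases h2 : v ∈ T
        · rw [← Finset.insert_erase h1, ← Finset.insert_erase h2, hST]
        · rw [Finset.erase_eq_of_notMem h2] at hST
          exact absurd ⟨S, hS.1, h1, hST ▸ hT.1⟩ hex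
        · rw [Finset.erase_eq_of_notMem h1] at hST
          exact absurd ⟨T, hT.1, h2, hST ▸ hS.1⟩ hex
        · rwa [Finset.erase_eq_of_notMem h1, Finset.erase_eq_of_notMem h2] at hST
    obtain ⟨S₀, hS₀⟩ := hcol
    have h1 := Finset.pred_card_le_card_erase (s := L) (a := {v})
    have h2 := Finset.pred_card_le_card_erase (s := L.erase {v}) (a := S₀)
    rw [Finset.card_insert_of_notMem hv]
    omega

/-- A direction supported on the support of `x` that annihilates the cuts of a maximal laminar
family of tight sets annihilates all tight cuts. -/
lemma exists_laminar_tight {V : Type*} [Fintype V] [Nonempty V] (x : Sym2 V → ℝ)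
    (h0 : ∀ e, 0 ≤ x e)
    (hcut : ∀ S : Finset V, S.Nonempty → S ≠ Finset.univ → 2 ≤ pairCut x S) :
    ∃ L : Finset (Finset V), L.card ≤ 2 * (Fintype.card V - 1) ∧
      ∀ d : Sym2 V → ℝ, (∀ e, x e = 0 → d e = 0) → (∀ S ∈ L, pairCut d S = 0) →
        ∀ S : Finset V, S.Nonempty → S ≠ Finset.univ → pairCut x S = 2 → pairCut d S = 0 := by
  obtain ⟨r⟩ := ‹Nonempty V›
  set Tt : Finset (Finset V) :=
    Finset.univ.filter fun S => S.Nonempty ∧ r ∉ S ∧ pairCut x S = 2 with hTt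
  set fam : Finset (Finset (Finset V)) :=
    Tt.powerset.filter fun L => ∀ S ∈ L, ∀ T ∈ L, ¬ Crosses S T with hfam
  obtain ⟨L, hLf, hmax⟩ := Finset.exists_max_image fam Finset.card
    ⟨∅, by simp [hfam]⟩
  simp only [hfam, Finset.mem_filter, Finset.mem_powerset] at hLf hmax
  obtain ⟨hLT, hLl⟩ := hLf
  refine ⟨L, ?_, ?_⟩
  · have := card_laminar_le (Finset.univ.erase r) L (fun S hS => ?_) hLl
    · simpa using this
    · have := hLT hS
      simp only [hTt, Finset.mem_filter, Finset.mem_univ, true_and] at this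
      exact ⟨fun y hy => by simpa using fun h : y = r => this.2.1 (h ▸ hy), this.1⟩
  · intro d hd hdL
    have symm : ∀ S T : Finset V, Crosses S T → Crosses T S := fun S T h =>
      ⟨by rw [Finset.inter_comm]; exact h.1, h.2.2, h.2.1⟩
    have main : ∀ n : ℕ, ∀ S ∈ Tt, (L.filter fun M => Crosses M S).card = n →
        pairCut d S = 0 := by
      intro n
      induction n using Nat.strong_induction_on with
      | _ n ih =>
        intro S hS hn
        have hS' := hS
        simp only [hTt, Finset.mem_filter, Finset.mem_univ, true_and] at hS'
        by_cases hex : ∃ T ∈ L, Crosses T S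
        · obtain ⟨T, hT, hTS⟩ := hex
          have hTt' := hLT hT
          simp only [hTt, Finset.mem_filter, Finset.mem_univ, true_and] at hTt'
          have hi : (S ∩ T).Nonempty := by rw [Finset.inter_comm]; exact hTS.1
          have ri : r ∉ S ∩ T := fun h => hS'.2.1 (Finset.mem_inter.1 h).1
          have ru : r ∉ S ∪ T := fun h => (Finset.mem_union.1 h).elim hS'.2.1 hTt'.2.1
          have hu : (S ∪ T).Nonempty := hS'.1.mono Finset.subset_union_left
          have c1 := hcut (S ∩ T) hi (fun h => ri (h ▸ Finset.mem_univ r))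
          have c2 := hcut (S ∪ T) hu (fun h => ru (h ▸ Finset.mem_univ r))
          have c3 := pairCut_add_pairCut x S T
          have c4 : 0 ≤ pairBetween x (S \ T) (T \ S) :=
            Finset.sum_nonneg fun a _ => Finset.sum_nonneg fun b _ => by
              split_ifs
              exacts [h0 _, le_rfl]
          have c5 : pairBetween x (S \ T) (T \ S) = 0 := by linarith [hS'.2.2, hTt'.2.2]
          have c6 : pairBetween d (S \ T) (T \ S) = 0 := by
            refine Finset.sum_eq_zero fun a _ => Finset.sum_eq_zero fun b _ => ?_
            have n2 : ∀ a ∈ Finset.univ, ∀ b ∈ Finset.univ,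
                0 ≤ if a ∈ S \ T ∧ b ∈ T \ S then x s(a, b) else 0 := fun a _ b _ => by
              split_ifs
              exacts [h0 _, le_rfl]
            have e1 := (Finset.sum_eq_zero_iff_of_nonneg
              (fun a ha => Finset.sum_nonneg (n2 a ha))).1 c5 a (Finset.mem_univ a)
            have e2 := (Finset.sum_eq_zero_iff_of_nonneg (n2 a (Finset.mem_univ a))).1 e1 b
              (Finset.mem_univ b)
            split_ifs at e2 ⊢
            exacts [hd _ e2, rfl]
          have t1 : S ∩ T ∈ Tt := by
            simp only [hTt, Finset.mem_filter, Finset.mem_univ, true_and]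
            exact ⟨hi, ri, by linarith [hS'.2.2, hTt'.2.2]⟩
          have t2 : S ∪ T ∈ Tt := by
            simp only [hTt, Finset.mem_filter, Finset.mem_univ, true_and]
            exact ⟨hu, ru, by linarith [hS'.2.2, hTt'.2.2]⟩
          have lt1 : (L.filter fun M => Crosses M (S ∩ T)).card < n := by
            rw [← hn]
            refine Finset.card_lt_card (Finset.ssubset_iff_of_subset ?_ |>.2 ⟨T, ?_, ?_⟩)
            · intro M hM
              rw [Finset.mem_filter] at hM ⊢
              exact ⟨hM.1, Crosses.of_inter (hLl M hM.1 T hT) hM.2⟩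
            · exact Finset.mem_filter.2 ⟨hT, hTS⟩
            · intro h
              exact (Finset.mem_filter.1 h).2.2.2 Finset.inter_subset_right
          have lt2 : (L.filter fun M => Crosses M (S ∪ T)).card < n := by
            rw [← hn]
            refine Finset.card_lt_card (Finset.ssubset_iff_of_subset ?_ |>.2 ⟨T, ?_, ?_⟩)
            · intro M hM
              rw [Finset.mem_filter] at hM ⊢
              exact ⟨hM.1, Crosses.of_union (symm _ _ hTS) (hLl M hM.1 T hT) hM.2⟩
            · exact Finset.mem_filter.2 ⟨hT, hTS⟩
            · intro h
              exact (Finset.mem_filter.1 h).2.2.1 Finset.subset_union_right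
          have d3 := pairCut_add_pairCut d S T
          rw [ih _ lt1 _ t1 rfl, ih _ lt2 _ t2 rfl, hdL T hT, c6] at d3
          linarith
        · push Not at hex
          apply hdL
          by_contra hSL
          have := hmax (insert S L) ⟨Finset.insert_subset hS hLT, ?_⟩
          · rw [Finset.card_insert_of_notMem hSL] at this
            omega
          · intro A hA B hB hAB
            rw [Finset.mem_insert] at hA hB
            rcases hA with rfl | hA <;> rcases hB with rfl | hB
            · exact hAB.2.1 (Finset.Subset.refl _)
            · exact hex B hB (symm _ _ hAB)
            · exact hex A hA hAB
            · exact hLl A hA B hB hAB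
    intro S hne huniv hS
    by_cases hr : r ∈ S
    · rw [← pairCut_compl]
      refine main _ Sᶜ ?_ rfl
      simp only [hTt, Finset.mem_filter, Finset.mem_univ, true_and]
      refine ⟨?_, by simpa using hr, by rw [pairCut_compl, hS]⟩
      rw [Finset.nonempty_iff_ne_empty, Ne, Finset.compl_eq_empty_iff]
      exact huniv
    · refine main _ S ?_ rfl
      simp only [hTt, Finset.mem_filter, Finset.mem_univ, true_and]
      exact ⟨hne, hr, hS⟩

/-- `pairCut` at a fixed vertex set, as a linear functional. -/
noncomputable def pairCutLinear {V : Type*} [Fintype V] (S : Finset V) :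
    (Sym2 V → ℝ) →ₗ[ℝ] ℝ where
  toFun d := pairCut d S
  map_add' d d' := by
    have := pairCut_add_smul d d' 1 S
    simp only [one_mul] at this
    exact this
  map_smul' t d := by
    have h0 : pairCut (0 : Sym2 V → ℝ) S = 0 := by simp [pairCut]
    have := pairCut_add_smul 0 d t S
    simp only [h0, Pi.zero_apply, zero_add] at this
    exact this

/-- A feasible weight can be made sparse without increasing its total value. -/
lemma exists_sparse {V : Type*} [Fintype V] [Nonempty V] (x : Sym2 V → ℝ)
    (h0 : ∀ e, 0 ≤ x e)
    (hcut : ∀ S : Finset V, S.Nonempty → S ≠ Finset.univ → 2 ≤ pairCut x S) :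
    ∃ y : Sym2 V → ℝ, (∀ e, 0 ≤ y e) ∧ (∀ e, x e = 0 → y e = 0) ∧
      (∀ S : Finset V, S.Nonempty → S ≠ Finset.univ → 2 ≤ pairCut y S) ∧
      ∑ e, y e ≤ ∑ e, x e ∧
      (Finset.univ.filter fun e => y e ≠ 0).card ≤ 2 * (Fintype.card V - 1) := by
  set ι := Sym2 V ⊕ {S : Finset V // S.Nonempty ∧ S ≠ Finset.univ}
  set slack : (Sym2 V → ℝ) → ι → ℝ := fun y =>
    Sum.elim (fun e => y e) (fun S => pairCut y S.1 - 2) with hslack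
  set μ : (Sym2 V → ℝ) → ℕ := fun y => (Finset.univ.filter fun i => slack y i ≠ 0).card with hμ
  induction hn : μ x using Nat.strong_induction_on generalizing x with
  | _ n ih =>
    by_cases hcard : (Finset.univ.filter fun e => x e ≠ 0).card ≤ 2 * (Fintype.card V - 1)
    · exact ⟨x, h0, fun _ h => h, hcut, le_rfl, hcard⟩
    obtain ⟨L, hL, hLd⟩ := exists_laminar_tight x h0 hcut
    obtain ⟨d, hd0, hdx, hdL⟩ : ∃ d : Sym2 V → ℝ, d ≠ 0 ∧ (∀ e, x e = 0 → d e = 0) ∧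
        ∀ S ∈ L, pairCut d S = 0 := by
      set f : (Sym2 V → ℝ) →ₗ[ℝ] (({e // x e = 0} → ℝ) × (L → ℝ)) :=
        (LinearMap.pi fun e : {e // x e = 0} => LinearMap.proj e.1).prod
          (LinearMap.pi fun S : L => pairCutLinear S.1) with hf
      have hker : LinearMap.ker f ≠ ⊥ := by
        apply LinearMap.ker_ne_bot_of_finrank_lt
        simp only [Module.finrank_prod, Module.finrank_fintype_fun_eq_card, Fintype.card_coe]
        have h1 : Fintype.card {e // x e = 0} = (Finset.univ.filter fun e => x e = 0).card := by
          rw [Fintype.card_subtype]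
        have h2 := Finset.card_filter_add_card_filter_not
          (s := (Finset.univ : Finset (Sym2 V))) (fun e => x e = 0)
        rw [Finset.card_univ] at h2
        simp only [ne_eq] at hcard
        omega
      obtain ⟨d, hd, hd0⟩ := (Submodule.ne_bot_iff _).1 hker
      rw [LinearMap.mem_ker, hf, LinearMap.prod_apply, Prod.mk_eq_zero] at hd
      exact ⟨d, hd0, fun e he => congrFun hd.1 ⟨e, he⟩, fun S hS => congrFun hd.2 ⟨S, hS⟩⟩
    obtain ⟨d, hd0, hdx, hdL, hsum⟩ : ∃ d : Sym2 V → ℝ, d ≠ 0 ∧ (∀ e, x e = 0 → d e = 0) ∧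
        (∀ S ∈ L, pairCut d S = 0) ∧ ∑ e, d e ≤ 0 := by
      rcases le_total (∑ e, d e) 0 with h | h
      · exact ⟨d, hd0, hdx, hdL, h⟩
      · refine ⟨-d, neg_ne_zero.2 hd0, fun e he => by simp [hdx e he], fun S hS => ?_, by simpa⟩
        rw [show pairCut (-d) S = -pairCut d S from map_neg (pairCutLinear S) d, hdL S hS, neg_zero]
    have htight := hLd d hdx hdL
    have hneg : ∃ e, d e < 0 := by
      by_contra! hc
      refine hd0 (funext fun e => ?_)
      exact (Finset.sum_eq_zero_iff_of_nonneg fun e _ => hc e).1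
        (le_antisymm hsum (Finset.sum_nonneg fun e _ => hc e)) e (Finset.mem_univ e)
    set δ : ι → ℝ := Sum.elim (fun e => d e) (fun S => pairCut d S.1) with hδ
    obtain ⟨t, ht, hge, i, hi, hi'⟩ := exists_ratio_step (slack x) δ
      (by
        rintro (e | ⟨S, hS⟩)
        · exact h0 e
        · exact sub_nonneg.2 (hcut S hS.1 hS.2))
      (by
        rintro (e | ⟨S, hS⟩) h
        · exact hdx e h
        · exact htight S hS.1 hS.2 (sub_eq_zero.1 h))
      (by
        obtain ⟨e, he⟩ := hneg
        exact ⟨Sum.inl e, he⟩)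
    set y : Sym2 V → ℝ := fun e => x e + t * d e with hy
    have hsl : ∀ i, slack y i = slack x i + t * δ i := by
      rintro (e | ⟨S, hS⟩)
      · rfl
      · simp only [hslack, hδ, Sum.elim_inr, hy, pairCut_add_smul]
        ring
    have hlt : μ y < n := by
      rw [← hn]
      refine Finset.card_lt_card (Finset.ssubset_iff_of_subset ?_ |>.2 ⟨i, ?_, ?_⟩)
      · intro j hj
        simp only [Finset.mem_filter, Finset.mem_univ, true_and] at hj ⊢
        intro h
        refine hj ?_
        rw [hsl, h]
        rcases j with e | ⟨S, hS⟩
        · simp [hδ, hdx e h]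
        · simp [hδ, htight S hS.1 hS.2 (sub_eq_zero.1 h)]
      · simpa using hi
      · simp [hsl, hi']
    obtain ⟨z, hz0, hzy, hzc, hzs, hzn⟩ := ih _ hlt y
      (fun e => by have := hge (Sum.inl e); exact this)
      (fun S h1 h2 => by
        have := hge (Sum.inr ⟨S, h1, h2⟩)
        rw [← hsl] at this
        exact sub_nonneg.1 this) rfl
    refine ⟨z, hz0, fun e he => hzy e (by simp [hy, he, hdx e he]), hzc, hzs.trans ?_, hzn⟩
    simp only [hy, Finset.sum_add_distrib, ← Finset.mul_sum]
    nlinarith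

/-- The edge `a` of the multigraph with end maps `src` and `tgt` is incident to `n`. -/
def Meets {N A : Type*} (src tgt : A → N) (a : A) (n : N) : Prop := src a = n ∨ tgt a = n

/-- A set of edges of which at most one is incident to each vertex. -/
def IsEdgeMatching {N A : Type*} (src tgt : A → N) (M : Finset A) : Prop :=
  ∀ a ∈ M, ∀ b ∈ M, ∀ n, Meets src tgt a n → Meets src tgt b n → a = b

lemma IsEdgeMatching.mono {N A : Type*} {src tgt : A → N} {M M' : Finset A}
    (h : IsEdgeMatching src tgt M) (hM : M' ⊆ M) : IsEdgeMatching src tgt M' :=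
  fun a ha b hb => h a (hM ha) b (hM hb)

/-- A matching without loops covers twice as many vertices of a closed set as it has edges
there. -/
lemma IsEdgeMatching.card_covered {N A : Type*} {src tgt : A → N} (hne : ∀ a, src a ≠ tgt a)
    {M : Finset A} (hM : IsEdgeMatching src tgt M) (C : Finset N)
    (hC : ∀ a ∈ M, (src a ∈ C ↔ tgt a ∈ C)) :
    (C.filter fun n => ∃ a ∈ M, Meets src tgt a n).card =
      2 * (M.filter fun a => src a ∈ C).card := by
  have h : (C.filter fun n => ∃ a ∈ M, Meets src tgt a n) =
      (M.filter fun a => src a ∈ C).image src ∪ (M.filter fun a => src a ∈ C).image tgt := by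
    ext n
    simp only [Finset.mem_filter, Finset.mem_union, Finset.mem_image]
    constructor
    · rintro ⟨hn, a, ha, rfl | rfl⟩
      · exact Or.inl ⟨a, ⟨ha, hn⟩, rfl⟩
      · exact Or.inr ⟨a, ⟨ha, (hC a ha).2 hn⟩, rfl⟩
    · rintro (⟨a, ⟨ha, hn⟩, rfl⟩ | ⟨a, ⟨ha, hn⟩, rfl⟩)
      · exact ⟨hn, a, ha, Or.inl rfl⟩
      · exact ⟨(hC a ha).1 hn, a, ha, Or.inr rfl⟩
  rw [h, Finset.card_union_of_disjoint, Finset.card_image_of_injOn, Finset.card_image_of_injOn,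
    two_mul]
  · intro a ha b hb hab
    simp only [Finset.coe_filter, Set.mem_ofPred_eq] at ha hb
    exact hM a ha.1 b hb.1 (tgt a) (Or.inr rfl) (Or.inr hab.symm)
  · intro a ha b hb hab
    simp only [Finset.coe_filter, Set.mem_ofPred_eq] at ha hb
    exact hM a ha.1 b hb.1 (src a) (Or.inl rfl) (Or.inl hab.symm)
  · rw [Finset.disjoint_left]
    intro n hn hn'
    obtain ⟨a, ha, rfl⟩ := Finset.mem_image.1 hn
    obtain ⟨b, hb, hab⟩ := Finset.mem_image.1 hn'
    have := hM a (Finset.mem_filter.1 ha).1 b (Finset.mem_filter.1 hb).1 (src a) (Or.inl rfl)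
      (Or.inr hab)
    subst this
    exact hne a hab.symm

/-- The simple graph spanned by a set of edges of a multigraph. -/
def edgeGraph {N A : Type*} (src tgt : A → N) (F : Set A) : SimpleGraph N where
  Adj m n := m ≠ n ∧ ∃ a ∈ F, Meets src tgt a m ∧ Meets src tgt a n
  symm := ⟨fun _ _ ⟨h, a, ha, h1, h2⟩ => ⟨h.symm, a, ha, h2, h1⟩⟩
  loopless := ⟨fun _ h => h.1 rfl⟩

lemma exists_adj_dist_succ {N : Type*} {K : SimpleGraph N} {t c : N} (h : K.Reachable t c)
    (hne : c ≠ t) : ∃ b, K.Adj b c ∧ K.Reachable t b ∧ K.dist t c = K.dist t b + 1 := by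
  obtain ⟨w, hw⟩ := h.symm.exists_walk_length_eq_dist
  cases w with
  | nil => exact absurd rfl hne
  | @cons _ b _ hcb p =>
    rw [SimpleGraph.Walk.length_cons] at hw
    have h1 : K.dist t b ≤ p.length := by
      rw [SimpleGraph.dist_comm]
      exact SimpleGraph.dist_le p
    have h2 : K.dist t c ≤ K.dist t b + 1 := by
      obtain ⟨q, hq⟩ := (p.reachable.symm).exists_walk_length_eq_dist
      rw [← hq]
      exact (SimpleGraph.dist_le (q.concat hcb.symm)).trans (by simp)
    rw [SimpleGraph.dist_comm] at hw
    exact ⟨b, hcb.symm, p.reachable.symm, by omega⟩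

/-- A connected component has at most one vertex more than it has edges. -/
lemma card_component_le {N A : Type*} [Fintype N] (src tgt : A → N) (F : Finset A) (t : N) :
    (Finset.univ.filter fun c => (edgeGraph src tgt (F : Set A)).Reachable t c).card ≤
      (F.filter fun a => (edgeGraph src tgt (F : Set A)).Reachable t (src a)).card + 1 := by
  set K := edgeGraph src tgt (F : Set A)
  have hex : ∀ c, K.Reachable t c ∧ c ≠ t → ∃ b a, a ∈ F ∧ b ≠ c ∧ Meets src tgt a b ∧
      Meets src tgt a c ∧ K.Reachable t b ∧ K.dist t c = K.dist t b + 1 := by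
    rintro c ⟨hc, hct⟩
    obtain ⟨b, ⟨hbc, a, ha, h1, h2⟩, hb, hd⟩ := exists_adj_dist_succ hc hct
    exact ⟨b, a, ha, hbc, h1, h2, hb, hd⟩
  rcases isEmpty_or_nonempty A with hA | hA
  · refine (Finset.card_le_card (t := {t}) fun c hc => ?_).trans (by simp)
    by_contra hct
    obtain ⟨-, a, -⟩ := hex c ⟨(Finset.mem_filter.1 hc).2, by simpa using hct⟩
    exact hA.elim a
  choose! p e he hpc hep hec hp hd using hex
  have hsub : ((Finset.univ.filter fun c => K.Reachable t c).erase t).card ≤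
      (F.filter fun a => K.Reachable t (src a)).card := by
    refine Finset.card_le_card_of_injOn e ?_ ?_
    · intro c hc
      have hc' : K.Reachable t c ∧ c ≠ t := by simpa [and_comm] using hc
      refine Finset.mem_coe.2 (Finset.mem_filter.2 ⟨he c hc', ?_⟩)
      rcases hec c hc' with h | h
      · rw [h]; exact hc'.1
      · rcases hep c hc' with h' | h'
        · rw [h']; exact hp c hc'
        · exact absurd (h'.symm.trans h) (hpc c hc')
    · intro c hc c' hc' hcc
      have h1 : K.Reachable t c ∧ c ≠ t := by simpa [and_comm] using hc
      have h2 : K.Reachable t c' ∧ c' ≠ t := by simpa [and_comm] using hc'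
      by_contra hne
      have a1 := hec c h1
      have a2 := hep c h1
      have a3 := hec c' h2
      have a4 := hep c' h2
      rw [← hcc] at a3 a4
      have d1 := hd c h1
      have d2 := hd c' h2
      have n1 := hpc c h1
      have n2 := hpc c' h2
      have e1 : p c' = c ∧ p c = c' := by
        unfold Meets at a1 a2 a3 a4
        grind
      rw [e1.2] at d1
      rw [e1.1] at d2
      omega
  have := Finset.pred_card_le_card_erase (s := Finset.univ.filter fun c => K.Reachable t c) (a := t)
  omega

/-- Exchanging the parts of two matchings inside a set closed under both gives a matching. -/
lemma IsEdgeMatching.swap {N A : Type*} {src tgt : A → N} {M M' : Finset A}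
    (hM : IsEdgeMatching src tgt M) (hM' : IsEdgeMatching src tgt M') (C : Finset N)
    (hC : ∀ a ∈ M, (src a ∈ C ↔ tgt a ∈ C)) (hC' : ∀ a ∈ M', (src a ∈ C ↔ tgt a ∈ C)) :
    IsEdgeMatching src tgt
      ((M.filter fun a => src a ∉ C) ∪ M'.filter fun a => src a ∈ C) := by
  intro a ha b hb n han hbn
  simp only [Finset.mem_union, Finset.mem_filter] at ha hb
  unfold Meets at han hbn
  rcases ha with ⟨ha, h1⟩ | ⟨ha, h1⟩ <;> rcases hb with ⟨hb, h2⟩ | ⟨hb, h2⟩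
  · exact hM a ha b hb n han hbn
  · have := hC a ha
    have := hC' b hb
    grind
  · have := hC' a ha
    have := hC b hb
    grind
  · exact hM' a ha b hb n han hbn

lemma sum_swap {N A : Type*} (src : A → N) (M M' : Finset A) (C : Finset N) (f : A → ℕ) :
    ∑ a ∈ (M.filter fun a => src a ∉ C) ∪ (M'.filter fun a => src a ∈ C), f a +
      ∑ a ∈ M.filter (fun a => src a ∈ C), f a =
    ∑ a ∈ M, f a + ∑ a ∈ M'.filter (fun a => src a ∈ C), f a := by
  rw [Finset.sum_union, ← Finset.sum_filter_add_sum_filter_not M (fun a => src a ∈ C) f]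
  · ring
  · rw [Finset.disjoint_left]
    intro a ha hb
    exact (Finset.mem_filter.1 ha).2 (Finset.mem_filter.1 hb).2

/-- `M` has maximum weight among the matchings contained in `F`. -/
def IsMaxMatching {N A : Type*} (src tgt : A → N) (F : Finset A) (f : A → ℕ)
    (M : Finset A) : Prop :=
  IsEdgeMatching src tgt M ∧ M ⊆ F ∧
    ∀ M', IsEdgeMatching src tgt M' → M' ⊆ F → ∑ a ∈ M', f a ≤ ∑ a ∈ M, f a

lemma exists_isMaxMatching {N A : Type*} (src tgt : A → N) (F : Finset A) (f : A → ℕ) :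
    ∃ M, IsMaxMatching src tgt F f M := by
  obtain ⟨M, hM, hmax⟩ := Finset.exists_max_image
    (F.powerset.filter fun M => IsEdgeMatching src tgt M) (fun M => ∑ a ∈ M, f a)
    ⟨∅, Finset.mem_filter.2 ⟨by simp, fun a ha => absurd ha (Finset.notMem_empty a)⟩⟩
  simp only [Finset.mem_filter, Finset.mem_powerset, and_imp] at hM hmax
  exact ⟨M, hM.2, hM.1, fun M' h h' => hmax M' h' h⟩

/-- If every vertex of a component is missed by some matching that is maximum for `f`, and `g`
is obtained from `f` by lowering the weights in the component by one, then a matching that is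
lexicographically maximum for `g` and cardinality does not miss two vertices of the component. -/
lemma not_missed_twice {N A : Type*} [Fintype N] [Fintype A] {src tgt : A → N}
    (hne : ∀ a, src a ≠ tgt a) {F : Finset A} {f g : A → ℕ} {r : N}
    (hfg : ∀ a ∈ F, (edgeGraph src tgt (F : Set A)).Reachable r (src a) → f a = g a + 1)
    (hmiss : ∀ v, (edgeGraph src tgt (F : Set A)).Reachable r v →
      ∃ M, IsMaxMatching src tgt F f M ∧ ∀ a ∈ M, ¬ Meets src tgt a v) (k : ℕ) :
    ∀ (M : Finset A) (u v : N),
      IsMaxMatching src tgt F (fun a => g a * (Fintype.card A + 1) + 1) M → u ≠ v →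
      (edgeGraph src tgt (F : Set A)).Reachable r u →
      (edgeGraph src tgt (F : Set A)).Reachable r v →
      (∀ a ∈ M, ¬ Meets src tgt a u) → (∀ a ∈ M, ¬ Meets src tgt a v) →
      (edgeGraph src tgt (F : Set A)).dist u v ≠ k := by
  set K := edgeGraph src tgt (F : Set A) with hK
  induction k using Nat.strong_induction_on with
  | _ k ih =>
  intro M u v hM huv hru hrv hu hv hk
  obtain ⟨b, hbv, hub, hdist⟩ := exists_adj_dist_succ (hru.symm.trans hrv) huv.symm
  have hrb : K.Reachable r b := hru.trans hub
  by_cases hb : ∀ a ∈ M, ¬ Meets src tgt a b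
  · obtain ⟨hbv', a, haF, hab, hav⟩ := hbv
    have haM : a ∉ M := fun h => hb a h hab
    have hmet : ∀ n, Meets src tgt a n → n = b ∨ n = v := by
      intro n hn
      unfold Meets at hn hab hav
      grind
    have h1 : IsEdgeMatching src tgt (insert a M) := by
      intro c hc d hd n hcn hdn
      rcases Finset.mem_insert.1 hc with rfl | hcM <;>
        rcases Finset.mem_insert.1 hd with rfl | hdM
      · rfl
      · rcases hmet n hcn with rfl | rfl
        · exact absurd hdn (hb d hdM)
        · exact absurd hdn (hv d hdM)
      · rcases hmet n hdn with rfl | rfl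
        · exact absurd hcn (hb c hcM)
        · exact absurd hcn (hv c hcM)
      · exact hM.1 c hcM d hdM n hcn hdn
    have h2 := hM.2.2 _ h1 (Finset.insert_subset haF hM.2.1)
    rw [Finset.sum_insert haM] at h2
    beta_reduce at h2
    omega
  have hbu : b ≠ u := by
    rintro rfl
    exact hb hu
  have hpos : 0 < K.dist u b := hub.pos_dist_of_ne hbu.symm
  have hbv1 : K.dist b v = 1 := SimpleGraph.dist_eq_one_iff_adj.2 hbv
  obtain ⟨L, hL, hLb⟩ := hmiss b hrb
  set C := Finset.univ.filter fun c => (edgeGraph src tgt ((M ∪ L : Finset A) : Set A)).Reachable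
    b c
    with hCdef
  have hclosed : ∀ a ∈ M ∪ L, (src a ∈ C ↔ tgt a ∈ C) := by
    intro a ha
    have hadj : (edgeGraph src tgt ((M ∪ L : Finset A) : Set A)).Adj (src a) (tgt a) :=
      ⟨hne a, a, ha, Or.inl rfl, Or.inr rfl⟩
    simp only [hCdef, Finset.mem_filter, Finset.mem_univ, true_and]
    exact ⟨fun h => h.trans hadj.reachable, fun h => h.trans hadj.symm.reachable⟩
  have hclM : ∀ a ∈ M, (src a ∈ C ↔ tgt a ∈ C) := fun a ha =>
    hclosed a (Finset.mem_union_left _ ha)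
  have hclL : ∀ a ∈ L, (src a ∈ C ↔ tgt a ∈ C) := fun a ha =>
    hclosed a (Finset.mem_union_right _ ha)
  have hbC : b ∈ C := by simp [hCdef]
  have hle : edgeGraph src tgt ((M ∪ L : Finset A) : Set A) ≤ K := by
    rintro m n ⟨hmn, a, ha, h1, h2⟩
    refine ⟨hmn, a, ?_, h1, h2⟩
    rcases Finset.mem_union.1 ha with h | h
    · exact hM.2.1 h
    · exact hL.2.1 h
  have hCr : ∀ c ∈ C, K.Reachable r c := fun c hc =>
    hrb.trans ((Finset.mem_filter.1 hc).2.mono hle)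
  have hcard : C.card ≤ (M.filter fun a => src a ∈ C).card +
      (L.filter fun a => src a ∈ C).card + 1 := by
    refine (card_component_le src tgt (M ∪ L) b).trans ?_
    have h1 : ((M ∪ L).filter fun a =>
        (edgeGraph src tgt ((M ∪ L : Finset A) : Set A)).Reachable b (src a)) =
        (M.filter fun a => src a ∈ C) ∪ (L.filter fun a => src a ∈ C) := by
      ext a
      simp [hCdef, or_and_right]
    rw [h1]
    have := Finset.card_union_le (M.filter fun a => src a ∈ C) (L.filter fun a => src a ∈ C)
    omega
  have hcovM := hM.1.card_covered hne C hclM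
  have hcovL := hL.1.card_covered hne C hclL
  have hsplitM := Finset.card_filter_add_card_filter_not (s := C)
    (fun n => ∃ a ∈ M, Meets src tgt a n)
  have hsplitL := Finset.card_filter_add_card_filter_not (s := C)
    (fun n => ∃ a ∈ L, Meets src tgt a n)
  have hL1 : 0 < (C.filter fun n => ¬ ∃ a ∈ L, Meets src tgt a n).card :=
    Finset.card_pos.2 ⟨b, Finset.mem_filter.2 ⟨hbC, by rintro ⟨a, ha, h⟩; exact hLb a ha h⟩⟩
  have hsize : (L.filter fun a => src a ∈ C).card ≤ (M.filter fun a => src a ∈ C).card := by omega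
  have hnotboth : ¬ (u ∈ C ∧ v ∈ C) := by
    rintro ⟨huC, hvC⟩
    have : 1 < (C.filter fun n => ¬ ∃ a ∈ M, Meets src tgt a n).card :=
      Finset.one_lt_card.2 ⟨u, Finset.mem_filter.2 ⟨huC, by rintro ⟨a, ha, h⟩; exact hu a ha h⟩,
        v, Finset.mem_filter.2 ⟨hvC, by rintro ⟨a, ha, h⟩; exact hv a ha h⟩, huv⟩
    omega
  set M' := (M.filter fun a => src a ∉ C) ∪ L.filter fun a => src a ∈ C with hM'
  set L' := (L.filter fun a => src a ∉ C) ∪ M.filter fun a => src a ∈ C with hL'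
  have hM'm : IsEdgeMatching src tgt M' := hM.1.swap hL.1 C hclM hclL
  have hL'm : IsEdgeMatching src tgt L' := hL.1.swap hM.1 C hclL hclM
  have hM'F : M' ⊆ F := Finset.union_subset ((Finset.filter_subset _ _).trans hM.2.1)
    ((Finset.filter_subset _ _).trans hL.2.1)
  have hL'F : L' ⊆ F := Finset.union_subset ((Finset.filter_subset _ _).trans hL.2.1)
    ((Finset.filter_subset _ _).trans hM.2.1)
  have hf : ∀ Q : Finset A, Q ⊆ F → ∑ a ∈ Q.filter (fun a => src a ∈ C), f a =
      ∑ a ∈ Q.filter (fun a => src a ∈ C), g a + (Q.filter fun a => src a ∈ C).card := by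
    intro Q hQ
    rw [Finset.card_eq_sum_ones, ← Finset.sum_add_distrib]
    refine Finset.sum_congr rfl fun a ha => ?_
    obtain ⟨h1, h2⟩ := Finset.mem_filter.1 ha
    exact hfg a (hQ h1) (hCr _ h2)
  have hφ : ∀ Q : Finset A, ∑ a ∈ Q, (g a * (Fintype.card A + 1) + 1) =
      (∑ a ∈ Q, g a) * (Fintype.card A + 1) + Q.card := by
    intro Q
    rw [Finset.sum_add_distrib, Finset.sum_mul, Finset.card_eq_sum_ones]
  have e1 := sum_swap src L M C f
  have e2 := sum_swap src M L C (fun a => g a * (Fintype.card A + 1) + 1)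
  rw [← hL', hf M hM.2.1, hf L hL.2.1] at e1
  rw [← hM', hφ (M.filter fun a => src a ∈ C), hφ (L.filter fun a => src a ∈ C)] at e2
  have i1 := hL.2.2 L' hL'm hL'F
  have i2 := hM.2.2 M' hM'm hM'F
  beta_reduce at i2 e2
  have hB : (M.filter fun a => src a ∈ C).card ≤ Fintype.card A := Finset.card_le_univ _
  generalize ∑ a ∈ M.filter (fun a => src a ∈ C), g a = gM at e1 e2
  generalize ∑ a ∈ L.filter (fun a => src a ∈ C), g a = gL at e1 e2
  have i3 : gL ≤ gM := by
    by_contra hlt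
    have : (gM + 1) * (Fintype.card A + 1) ≤ gL * (Fintype.card A + 1) :=
      Nat.mul_le_mul_right _ (by omega)
    rw [Nat.add_mul] at this
    omega
  have i4 : gL = gM := by omega
  have hM'max : IsMaxMatching src tgt F (fun a => g a * (Fintype.card A + 1) + 1) M' := by
    refine ⟨hM'm, hM'F, fun Q h1 h2 => (hM.2.2 Q h1 h2).trans ?_⟩
    rw [i4] at e2 e1
    beta_reduce
    omega
  have hmissM' : ∀ n, n ∉ C → (∀ a ∈ M, ¬ Meets src tgt a n) → ∀ a ∈ M', ¬ Meets src tgt a n := by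
    intro n hn hnM a ha han
    rcases Finset.mem_union.1 ha with h | h
    · exact hnM a (Finset.mem_filter.1 h).1 han
    · have h1 := (Finset.mem_filter.1 h).2
      have h2 := (hclL a (Finset.mem_filter.1 h).1).1 h1
      rcases han with h | h
      · exact hn (h ▸ h1)
      · exact hn (h ▸ h2)
  have hbM' : ∀ a ∈ M', ¬ Meets src tgt a b := by
    intro a ha hab
    rcases Finset.mem_union.1 ha with h | h
    · have h1 := (Finset.mem_filter.1 h).2
      have h2 := hclM a (Finset.mem_filter.1 h).1
      rcases hab with h | h
      · exact h1 (h ▸ hbC)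
      · exact h1 (h2.2 (h ▸ hbC))
    · exact hLb a (Finset.mem_filter.1 h).1 hab
  rcases not_and_or.1 hnotboth with h | h
  · exact ih _ (by omega) M' u b hM'max hbu.symm hru hrb (hmissM' u h hu) hbM' rfl
  · exact ih _ (by omega) M' b v hM'max hbv.ne hrb hrv hbM' (hmissM' v h hv) rfl

/-- **Fractional matchings are dominated by matchings** in a multigraph without loops, provided
the odd set constraints hold (Edmonds). -/
theorem exists_isEdgeMatching_ge {N A : Type*} [Fintype N] [Fintype A] {src tgt : A → N}
    (hne : ∀ a, src a ≠ tgt a) {x : A → ℝ} (h0 : ∀ a, 0 ≤ x a)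
    (hdeg : ∀ n, ∑ a ∈ Finset.univ.filter (fun a => Meets src tgt a n), x a ≤ 1)
    (hodd : ∀ U : Finset N, Odd U.card →
      ∑ a ∈ Finset.univ.filter (fun a => src a ∈ U ∧ tgt a ∈ U), x a ≤ ((U.card : ℝ) - 1) / 2)
    (w : A → ℕ) :
    ∃ M, IsEdgeMatching src tgt M ∧ ∑ a, (w a : ℝ) * x a ≤ ((∑ a ∈ M, w a : ℕ) : ℝ) := by
  have hinside : ∀ U : Finset N,
      ∑ a ∈ Finset.univ.filter (fun a => src a ∈ U ∧ tgt a ∈ U), x a ≤ ((U.card / 2 : ℕ) : ℝ) := by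
    intro U
    rcases Nat.even_or_odd' U.card with ⟨m, hm | hm⟩
    · have h1 : ∑ n ∈ U, ∑ a ∈ Finset.univ.filter (fun a => Meets src tgt a n), x a ≤ U.card := by
        simpa using Finset.sum_le_card_nsmul U _ 1 fun n _ => hdeg n
      have h2 : 2 * ∑ a ∈ Finset.univ.filter (fun a => src a ∈ U ∧ tgt a ∈ U), x a ≤
          ∑ n ∈ U, ∑ a ∈ Finset.univ.filter (fun a => Meets src tgt a n), x a := by
        simp_rw [Finset.sum_filter]
        rw [Finset.sum_comm, Finset.mul_sum]
        refine Finset.sum_le_sum fun a _ => ?_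
        split_ifs with ha
        · rw [← Finset.sum_filter, Finset.sum_const, nsmul_eq_mul]
          refine mul_le_mul_of_nonneg_right ?_ (h0 a)
          have : ({src a, tgt a} : Finset N) ⊆ U.filter fun n => Meets src tgt a n := by
            intro n hn
            rcases Finset.mem_insert.1 hn with rfl | hn
            · exact Finset.mem_filter.2 ⟨ha.1, Or.inl rfl⟩
            · rw [Finset.mem_singleton.1 hn]
              exact Finset.mem_filter.2 ⟨ha.2, Or.inr rfl⟩
          have := Finset.card_le_card this
          rw [Finset.card_pair (hne a)] at this
          exact_mod_cast this
        · rw [mul_zero]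
          exact Finset.sum_nonneg fun n _ => by split_ifs <;> simp [h0]
      have h3 : U.card / 2 = m := by omega
      have h4 : (U.card : ℝ) = 2 * m := by exact_mod_cast hm
      rw [h3]
      linarith
    · have h3 : U.card / 2 = m := by omega
      have h4 : (U.card : ℝ) = 2 * m + 1 := by exact_mod_cast hm
      have := hodd U ⟨m, hm⟩
      rw [h3]
      linarith
  obtain ⟨k, hk⟩ : ∃ k, ∑ a, w a = k := ⟨_, rfl⟩
  induction k using Nat.strong_induction_on generalizing w with
  | _ k ih =>
  set F := Finset.univ.filter fun a => 0 < w a with hF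
  have hrestrict : ∀ (M : Finset A) (w' : A → ℕ), (∀ a, w' a ≤ w a) →
      ∑ a ∈ M, w' a = ∑ a ∈ M.filter (· ∈ F), w' a := by
    intro M w' hw'
    rw [Finset.sum_filter]
    refine Finset.sum_congr rfl fun a _ => ?_
    split_ifs with h
    · rfl
    · have := hw' a
      simp only [hF, Finset.mem_filter, Finset.mem_univ, true_and] at h
      omega
  rcases F.eq_empty_or_nonempty with hF0 | ⟨a0, ha0⟩
  · refine ⟨∅, fun a ha => absurd ha (Finset.notMem_empty a), ?_⟩
    rw [Finset.sum_eq_zero fun a _ => ?_]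
    · simp
    · have : a ∉ F := hF0 ▸ Finset.notMem_empty a
      simp only [hF, Finset.mem_filter, Finset.mem_univ, true_and] at this
      simp [Nat.eq_zero_of_not_pos this]
  set r := src a0
  obtain ⟨L, hL⟩ := exists_isMaxMatching src tgt F w
  by_cases hcase : ∀ v, (edgeGraph src tgt (F : Set A)).Reachable r v →
      ∃ M, IsMaxMatching src tgt F w M ∧ ∀ a ∈ M, ¬ Meets src tgt a v
  · set U := Finset.univ.filter fun c => (edgeGraph src tgt (F : Set A)).Reachable r c with hU
    set g : A → ℕ := fun a => if src a ∈ U then w a - 1 else w a with hg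
    have hgw : ∀ a, g a ≤ w a := by
      intro a
      simp only [hg]
      split_ifs <;> omega
    have hgF : ∀ a ∈ F, w a = g a + if src a ∈ U then 1 else 0 := by
      intro a ha
      simp only [hF, Finset.mem_filter, Finset.mem_univ, true_and] at ha
      simp only [hg]
      split_ifs <;> omega
    have hlt : ∑ a, g a < ∑ a, w a := by
      refine Finset.sum_lt_sum (fun a _ => hgw a) ⟨a0, Finset.mem_univ _, ?_⟩
      have := hgF a0 ha0
      rw [if_pos (by simp [hU, r])] at this
      omega
    obtain ⟨M₁, hM₁, hle⟩ := ih _ (hk ▸ hlt) g rfl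
    obtain ⟨M, hM⟩ := exists_isMaxMatching src tgt F fun a => g a * (Fintype.card A + 1) + 1
    have hclosed : ∀ a ∈ F, (src a ∈ U ↔ tgt a ∈ U) := by
      intro a ha
      have hadj : (edgeGraph src tgt (F : Set A)).Adj (src a) (tgt a) :=
        ⟨hne a, a, ha, Or.inl rfl, Or.inr rfl⟩
      simp only [hU, Finset.mem_filter, Finset.mem_univ, true_and]
      exact ⟨fun h => h.trans hadj.reachable, fun h => h.trans hadj.symm.reachable⟩
    have hcov := hM.1.card_covered hne U fun a ha => hclosed a (hM.2.1 ha)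
    have hsplit := Finset.card_filter_add_card_filter_not (s := U)
      (fun n => ∃ a ∈ M, Meets src tgt a n)
    have hone : (U.filter fun n => ¬ ∃ a ∈ M, Meets src tgt a n).card ≤ 1 := by
      rw [Finset.card_le_one]
      intro u hu v hv
      by_contra huv
      rw [Finset.mem_filter] at hu hv
      refine not_missed_twice hne (f := w) (g := g) (r := r) (fun a ha h => ?_) hcase _ M u v hM huv
        (Finset.mem_filter.1 hu.1).2 (Finset.mem_filter.1 hv.1).2
        (fun a ha h => hu.2 ⟨a, ha, h⟩) (fun a ha h => hv.2 ⟨a, ha, h⟩) rfl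
      have := hgF a ha
      rwa [if_pos (by simp [hU, h])] at this
    have hMU : U.card / 2 ≤ (M.filter fun a => src a ∈ U).card := by omega
    have hgM : ∑ a ∈ M₁, g a ≤ ∑ a ∈ M, g a := by
      rw [hrestrict M₁ g hgw]
      have h1 := hM.2.2 (M₁.filter (· ∈ F)) (hM₁.mono (Finset.filter_subset _ _))
        (fun a ha => (Finset.mem_filter.1 ha).2)
      have hφ : ∀ Q : Finset A, ∑ a ∈ Q, (g a * (Fintype.card A + 1) + 1) =
          (∑ a ∈ Q, g a) * (Fintype.card A + 1) + Q.card := by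
        intro Q
        rw [Finset.sum_add_distrib, Finset.sum_mul, Finset.card_eq_sum_ones]
      rw [hφ, hφ] at h1
      have hB : M.card ≤ Fintype.card A := Finset.card_le_univ _
      by_contra hlt
      have : (∑ a ∈ M, g a + 1) * (Fintype.card A + 1) ≤
          (∑ a ∈ M₁.filter (· ∈ F), g a) * (Fintype.card A + 1) :=
        Nat.mul_le_mul_right _ (by omega)
      rw [Nat.add_mul] at this
      omega
    have hwM : ∑ a ∈ M, w a = ∑ a ∈ M, g a + (M.filter fun a => src a ∈ U).card := by
      rw [Finset.card_filter, ← Finset.sum_add_distrib]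
      exact Finset.sum_congr rfl fun a ha => hgF a (hM.2.1 ha)
    refine ⟨M, hM.1, ?_⟩
    have hx : ∑ a, (w a : ℝ) * x a ≤ ∑ a, (g a : ℝ) * x a +
        ∑ a ∈ Finset.univ.filter (fun a => src a ∈ U ∧ tgt a ∈ U), x a := by
      rw [Finset.sum_filter, ← Finset.sum_add_distrib]
      refine Finset.sum_le_sum fun a _ => ?_
      by_cases ha : a ∈ F
      · have h1 := hgF a ha
        have h2 := hclosed a ha
        by_cases h : src a ∈ U
        · rw [if_pos ⟨h, h2.1 h⟩, h1, if_pos h]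
          push_cast
          linarith
        · rw [if_neg (fun h' => h h'.1), h1, if_neg h]
          simp
      · simp only [hF, Finset.mem_filter, Finset.mem_univ, true_and, not_lt,
          Nat.le_zero] at ha
        rw [ha]
        have := h0 a
        split_ifs <;> simp <;> positivity
    have h5 := hinside U
    have h6 : ((U.card / 2 : ℕ) : ℝ) ≤ ((M.filter fun a => src a ∈ U).card : ℝ) := by
      exact_mod_cast hMU
    have h7 : ((∑ a ∈ M₁, g a : ℕ) : ℝ) ≤ ((∑ a ∈ M, g a : ℕ) : ℝ) := by exact_mod_cast hgM
    rw [hwM, Nat.cast_add]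
    linarith
  · push Not at hcase
    obtain ⟨v, -, hv⟩ := hcase
    set g : A → ℕ := fun a => if Meets src tgt a v then w a - 1 else w a with hg
    have hgw : ∀ a, g a ≤ w a := by
      intro a
      simp only [hg]
      split_ifs <;> omega
    have hdrop : ∀ a ∈ F, Meets src tgt a v → g a < w a := by
      intro a ha h
      simp only [hF, Finset.mem_filter, Finset.mem_univ, true_and] at ha
      simp only [hg, if_pos h]
      omega
    have hlt : ∑ a, g a < ∑ a, w a := by
      obtain ⟨a, ha, hav⟩ := hv L hL
      exact Finset.sum_lt_sum (fun a _ => hgw a) ⟨a, Finset.mem_univ _, hdrop a (hL.2.1 ha) hav⟩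
    obtain ⟨M₁, hM₁, hle⟩ := ih _ (hk ▸ hlt) g rfl
    refine ⟨L, hL.1, ?_⟩
    have hx : ∑ a, (w a : ℝ) * x a ≤ ∑ a, (g a : ℝ) * x a +
        ∑ a ∈ Finset.univ.filter (fun a => Meets src tgt a v), x a := by
      rw [Finset.sum_filter, ← Finset.sum_add_distrib]
      refine Finset.sum_le_sum fun a _ => ?_
      have h1 : w a ≤ g a + if Meets src tgt a v then 1 else 0 := by
        simp only [hg]
        split_ifs <;> omega
      have h2 : (w a : ℝ) ≤ g a + if Meets src tgt a v then 1 else 0 := by exact_mod_cast h1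
      have := mul_le_mul_of_nonneg_right h2 (h0 a)
      refine this.trans (le_of_eq ?_)
      split_ifs <;> ring
    have hkey : ∑ a ∈ M₁, g a + 1 ≤ ∑ a ∈ L, w a := by
      rw [hrestrict M₁ g hgw]
      set M₂ := M₁.filter (· ∈ F)
      have hm : IsEdgeMatching src tgt M₂ := hM₁.mono (Finset.filter_subset _ _)
      have hs : M₂ ⊆ F := fun a ha => (Finset.mem_filter.1 ha).2
      have h1 := hL.2.2 M₂ hm hs
      by_cases hmax : IsMaxMatching src tgt F w M₂
      · obtain ⟨a, ha, hav⟩ := hv M₂ hmax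
        have : ∑ a ∈ M₂, g a < ∑ a ∈ M₂, w a :=
          Finset.sum_lt_sum (fun a _ => hgw a) ⟨a, ha, hdrop a (hs ha) hav⟩
        omega
      · have h2 : ∑ a ∈ M₂, g a ≤ ∑ a ∈ M₂, w a := Finset.sum_le_sum fun a _ => hgw a
        have h3 : ∑ a ∈ M₂, w a ≠ ∑ a ∈ L, w a := fun h =>
          hmax ⟨hm, hs, fun Q h1 h2 => (hL.2.2 Q h1 h2).trans h.ge⟩
        omega
    have h4 := hdeg v
    have h5 : ((∑ a ∈ M₁, g a : ℕ) : ℝ) + 1 ≤ ((∑ a ∈ L, w a : ℕ) : ℝ) := by exact_mod_cast hkey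
    linarith

/-- A permutation whose orbits are the fibers of a given map. -/
lemma exists_perm_orbits {D N : Type*} [Fintype D] (e : D → N) :
    ∃ σ : Equiv.Perm D, (∀ d, e (σ d) = e d) ∧
      ∀ U : Set D, (∀ d ∈ U, σ d ∈ U) → ∀ d d', e d = e d' → d ∈ U → d' ∈ U := by
  have h := fun n : N => (Finset.univ.filter fun d => e d = n).exists_cycleOn
  choose f hf hfs using h
  have hmem : ∀ n d, e d = n → e (f n d) = n := by
    intro n d hd
    have : d ∈ ((Finset.univ.filter fun d => e d = n : Finset D) : Set D) := by simp [hd]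
    have := (hf n).1.mapsTo this
    simpa using this
  have hinj : Function.Injective fun d => f (e d) d := by
    intro d d' hdd
    have h1 : e d = e d' := by
      rw [← hmem _ d rfl, ← hmem _ d' rfl]
      exact congrArg e hdd
    simp only [h1] at hdd
    exact (f (e d')).injective hdd
  refine ⟨Equiv.ofBijective _ (Finite.injective_iff_bijective.1 hinj), fun d => hmem _ d rfl, ?_⟩
  intro U hU d d' hdd hd
  obtain ⟨k, -, rfl⟩ := (hf (e d)).exists_pow_eq (a := d) (b := d') (by simp) (by simp [hdd])
  have key : ∀ k : ℕ, e ((f (e d) ^ k) d) = e d ∧ (f (e d) ^ k) d ∈ U := by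
    intro k
    induction k with
    | zero => exact ⟨rfl, hd⟩
    | succ k ih =>
      rw [pow_succ', Equiv.Perm.mul_apply]
      refine ⟨hmem _ _ ih.1, ?_⟩
      have := hU _ ih.2
      simpa [Equiv.ofBijective_apply, ih.1] using this
  exact (key k).2

/-- The number of ends at `n` of the edge `a`. -/
noncomputable def inc {N A : Type*} (src tgt : A → N) (a : A) (n : N) : ℕ :=
  (if src a = n then 1 else 0) + if tgt a = n then 1 else 0

/-- The dart `(a, b)` is the end of the edge `a` at its source or at its target. -/
def dartEnd {N A : Type*} (src tgt : A → N) (d : A × Bool) : N := bif d.2 then tgt d.1 else src d.1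

lemma sum_darts {A : Type*} [Fintype A] (p : A × Bool → Prop)
    [DecidablePred p] :
    (Finset.univ.filter p).card =
      ∑ a, ((if p (a, false) then 1 else 0) + if p (a, true) then 1 else 0) := by
  rw [Finset.card_filter, Fintype.sum_prod_type]
  refine Finset.sum_congr rfl fun a _ => ?_
  rw [Fintype.sum_bool, add_comm]

lemma sum_inc {N A : Type*} [Fintype A] (src tgt : A → N) (J : Finset A) (n : N) :
    ∑ a ∈ J, inc src tgt a n =
      (Finset.univ.filter fun d => dartEnd src tgt d = n ∧ d.1 ∈ J).card := by
  rw [sum_darts, ← Finset.sum_filter_add_sum_filter_not Finset.univ (· ∈ J)]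
  simp only [Finset.filter_mem_eq_inter, Finset.univ_inter]
  rw [Finset.sum_eq_zero (s := Finset.univ.filter fun a => a ∉ J) (fun a ha => by
    simp [(Finset.mem_filter.1 ha).2])]
  rw [add_zero]
  refine Finset.sum_congr rfl fun a ha => ?_
  simp [inc, dartEnd, ha]

/-- In a finite multigraph without one-edge cuts there is, for every cost function on the edges,
an edge set of the same degree parities as the full edge set, of at most a third of its cost. -/
lemma exists_join_cost_le {N A : Type*} [Fintype A] (src tgt : A → N)
    (hcut : ∀ S : Set N, (Finset.univ.filter fun a => ¬ (src a ∈ S ↔ tgt a ∈ S)).card ≠ 1)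
    (c : A → ℤ) :
    ∃ J : Finset A, (∀ n, (∑ a ∈ J, inc src tgt a n) % 2 = (∑ a, inc src tgt a n) % 2) ∧
      3 * ∑ a ∈ J, c a ≤ ∑ a, c a := by
  set e := dartEnd src tgt with he
  obtain ⟨σ, hσe, hσ⟩ := exists_perm_orbits e
  set s : A ⊕ A × Bool → A × Bool := Sum.elim (fun a => (a, false)) id with hs
  set t : A ⊕ A × Bool → A × Bool := Sum.elim (fun a => (a, true)) σ with ht
  have hclosedCut : ∀ U : Set (A × Bool), (∀ d ∈ U, σ d ∈ U) →
      (Finset.univ.filter fun a => ¬ ((a, false) ∈ U ↔ (a, true) ∈ U)).card ≠ 1 := by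
    intro U hU h1
    apply hcut (e '' U)
    rw [← h1]
    have key : ∀ d, e d ∈ e '' U ↔ d ∈ U := fun d =>
      ⟨fun ⟨d', h, h'⟩ => hσ U hU d' d h' h, fun h => ⟨d, h, rfl⟩⟩
    congr 1
    ext a
    have h2 : src a ∈ e '' U ↔ (a, false) ∈ U := key (a, false)
    have h3 : tgt a ∈ e '' U ↔ (a, true) ∈ U := key (a, true)
    rw [Finset.mem_filter, Finset.mem_filter, h2, h3]
  have hσne : ∀ d, σ d ≠ d := by
    intro d hd
    apply hclosedCut {d} (by simp [hd])
    rw [Finset.card_eq_one]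
    refine ⟨d.1, ?_⟩
    ext a
    obtain ⟨a', b⟩ := d
    cases b <;> simp
  have hne : ∀ a, s a ≠ t a := by
    rintro (a | d)
    · simp [hs, ht]
    · exact fun h => hσne d h.symm
  have hmeets : ∀ d (g : A ⊕ A × Bool), Meets s t g d ↔
      g = Sum.inl d.1 ∨ g = Sum.inr d ∨ g = Sum.inr (σ.symm d) := by
    rintro ⟨a, b⟩ (a' | d')
    · cases b <;> simp [Meets, hs, ht, Prod.ext_iff]
    · simp [Meets, hs, ht, Equiv.eq_symm_apply]
  obtain ⟨K, hK⟩ : ∃ K : ℕ, (K : ℤ) = 1 + 2 * ∑ a, |c a| :=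
    ⟨(1 + 2 * ∑ a, |c a|).toNat, by
      rw [Int.toNat_of_nonneg]
      have : 0 ≤ ∑ a, |c a| := Finset.sum_nonneg fun a _ => abs_nonneg _
      omega⟩
  have habs : ∀ J : Finset A, |∑ a ∈ J, c a| ≤ ∑ a, |c a| := fun J =>
    (Finset.abs_sum_le_sum_abs _ _).trans
      (Finset.sum_le_sum_of_subset_of_nonneg (Finset.subset_univ J) fun a _ _ => abs_nonneg _)
  have hca : ∀ a, |c a| ≤ ∑ a, |c a| := fun a => by simpa using habs {a}
  set w : A ⊕ A × Bool → ℕ := Sum.elim (fun a => ((K : ℤ) - c a).toNat) fun _ => K with hw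
  have hwl : ∀ a, ((w (Sum.inl a) : ℕ) : ℤ) = K - c a := by
    intro a
    simp only [hw, Sum.elim_inl]
    rw [Int.toNat_of_nonneg]
    have := hca a
    have := le_abs_self (c a)
    have := abs_nonneg (c a)
    omega
  obtain ⟨M, hM, hMw⟩ := exists_isEdgeMatching_ge hne (x := fun _ => 1 / 3)
    (fun _ => by norm_num) (fun d => by
      have : (Finset.univ.filter fun g => Meets s t g d) ⊆
          {Sum.inl d.1, Sum.inr d, Sum.inr (σ.symm d)} := by
        intro g hg
        simpa using (hmeets d g).1 (Finset.mem_filter.1 hg).2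
      have := (Finset.card_le_card this).trans Finset.card_le_three
      have : ((Finset.univ.filter fun g => Meets s t g d).card : ℝ) ≤ 3 := by exact_mod_cast this
      rw [Finset.sum_const, nsmul_eq_mul]
      linarith)
    (fun U hU => by
      have c1 : U.card = 2 * (Finset.univ.filter fun a => (a, false) ∈ U ∧ (a, true) ∈ U).card +
          (Finset.univ.filter fun a => ¬ ((a, false) ∈ U ↔ (a, true) ∈ U)).card := by
        have h1 := sum_darts (· ∈ U)
        rw [Finset.filter_mem_eq_inter, Finset.univ_inter] at h1
        rw [h1, Finset.card_filter, Finset.card_filter, Finset.mul_sum, ← Finset.sum_add_distrib]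
        refine Finset.sum_congr rfl fun a _ => ?_
        by_cases h2 : (a, false) ∈ U <;> by_cases h3 : (a, true) ∈ U <;> simp [h2, h3]
      have c2 := Finset.card_filter_add_card_filter_not (s := U) (fun d => σ d ∈ U)
      have c3 : (Finset.univ.filter fun g => s g ∈ U ∧ t g ∈ U).card =
          (Finset.univ.filter fun a => (a, false) ∈ U ∧ (a, true) ∈ U).card +
          (U.filter fun d => σ d ∈ U).card := by
        rw [Finset.card_filter, Fintype.sum_sum_type, ← Finset.card_filter]
        congr 1
        rw [← Finset.card_filter]
        congr 1
        ext d
        simp [hs, ht]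
      have c4 : (Finset.univ.filter fun a => ¬ ((a, false) ∈ U ↔ (a, true) ∈ U)).card = 1 →
          (U.filter fun d => σ d ∉ U).card ≠ 0 := by
        intro h1 h0
        refine hclosedCut (U : Set (A × Bool)) (fun d hd => ?_) (by simpa using h1)
        by_contra hn
        exact Finset.notMem_empty d
          ((Finset.card_eq_zero.1 h0) ▸ Finset.mem_filter.2 ⟨hd, hn⟩)
      have c5 : 2 * (Finset.univ.filter fun g => s g ∈ U ∧ t g ∈ U).card + 3 ≤ 3 * U.card := by
        obtain ⟨m, hm⟩ := hU
        omega
      have c6 : 2 * ((Finset.univ.filter fun g => s g ∈ U ∧ t g ∈ U).card : ℝ) + 3 ≤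
          3 * U.card := by
        exact_mod_cast c5
      have c7 : ((Finset.univ.filter fun g => s g ∈ U ∧ t g ∈ U).card : ℝ) * (1 / 3) ≤
          ((U.card : ℝ) - 1) / 2 := by linarith
      rw [Finset.sum_const, nsmul_eq_mul]
      convert c7
      rfl) w
  have hZ : ∑ g, (w g : ℤ) ≤ 3 * ∑ g ∈ M, (w g : ℤ) := by
    rw [← Finset.sum_mul] at hMw
    have : (∑ g, (w g : ℝ)) ≤ 3 * ((∑ g ∈ M, w g : ℕ) : ℝ) := by linarith
    exact_mod_cast this
  set J := Finset.univ.filter fun a => Sum.inl a ∈ M with hJ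
  set R := Finset.univ.filter fun d => Sum.inr d ∈ M with hR
  have hMcard : M.card = J.card + R.card := by
    rw [Finset.card_filter, Finset.card_filter,
      ← Fintype.sum_sum_type (fun g => if g ∈ M then 1 else 0),
      ← Finset.card_filter, Finset.filter_mem_eq_inter, Finset.univ_inter]
  have hMsum : ∑ g ∈ M, (w g : ℤ) = K * M.card - ∑ a ∈ J, c a := by
    have h1 : ∑ g ∈ M, (w g : ℤ) = ∑ g, if g ∈ M then (w g : ℤ) else 0 := by
      rw [← Finset.sum_filter, Finset.filter_mem_eq_inter, Finset.univ_inter]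
    rw [h1, Fintype.sum_sum_type, ← Finset.sum_filter, ← Finset.sum_filter, ← hJ, ← hR]
    simp_rw [hwl]
    rw [Finset.sum_sub_distrib, hMcard]
    simp [hw]
    ring
  have hall : ∑ g, (w g : ℤ) = 3 * (K * Fintype.card A) - ∑ a, c a := by
    rw [Fintype.sum_sum_type]
    simp_rw [hwl]
    rw [Finset.sum_sub_distrib]
    simp [hw]
    ring
  have hcov := hM.card_covered hne Finset.univ (by simp)
  simp only [Finset.mem_univ, Finset.filter_true] at hcov
  have hDcard : (Finset.univ : Finset (A × Bool)).card = 2 * Fintype.card A := by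
    simp [mul_comm]
  have hle : M.card ≤ Fintype.card A := by
    have := Finset.card_filter_le (Finset.univ : Finset (A × Bool))
      (fun n => ∃ a ∈ M, Meets s t a n)
    omega
  rw [hall, hMsum] at hZ
  have hK0 : (0 : ℤ) ≤ ∑ a, |c a| := Finset.sum_nonneg fun a _ => abs_nonneg _
  have hJabs := neg_abs_le (∑ a ∈ J, c a)
  have hAabs := le_abs_self (∑ a, c a)
  have hJ' := habs J
  have hA' := habs Finset.univ
  have hMA : M.card = Fintype.card A := by
    by_contra hne
    have h1 : (M.card : ℤ) + 1 ≤ Fintype.card A := by exact_mod_cast (by omega)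
    have h2 := mul_le_mul_of_nonneg_left h1 (Int.natCast_nonneg K)
    rw [mul_add, mul_one] at h2
    omega
  refine ⟨J, fun n => ?_, by rw [hMA] at hZ; linarith⟩
  have hcovered : ∀ d, ∃ g ∈ M, Meets s t g d := by
    intro d
    have h1 : (Finset.univ.filter fun n => ∃ a ∈ M, Meets s t a n).card =
        (Finset.univ : Finset (A × Bool)).card := by omega
    have h2 := Finset.eq_of_subset_of_card_le (Finset.filter_subset _ _) h1.ge
    have h3 : d ∈ Finset.univ.filter fun n => ∃ a ∈ M, Meets s t a n := by
      rw [h2]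
      exact Finset.mem_univ d
    exact (Finset.mem_filter.1 h3).2
  have huniq : ∀ d, (if d.1 ∈ J then 1 else 0) + (if d ∈ R then 1 else 0) +
      (if σ.symm d ∈ R then 1 else 0) = 1 := by
    intro d
    obtain ⟨g, hg, hgd⟩ := hcovered d
    have hu : ∀ g' ∈ M, Meets s t g' d → g' = g := fun g' h h' => hM g' h g hg d h' hgd
    have i1 : Sum.inl d.1 ∈ M → Sum.inl d.1 = g := fun h => hu _ h ((hmeets _ _).2 (Or.inl rfl))
    have i2 : Sum.inr d ∈ M → Sum.inr d = g := fun h =>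
      hu _ h ((hmeets _ _).2 (Or.inr (Or.inl rfl)))
    have i3 : Sum.inr (σ.symm d) ∈ M → Sum.inr (σ.symm d) = g := fun h =>
      hu _ h ((hmeets _ _).2 (Or.inr (Or.inr rfl)))
    have i4 : σ.symm d ≠ d := fun h => hσne d (by conv_lhs => rw [← h, Equiv.apply_symm_apply])
    simp only [hJ, hR, Finset.mem_filter, Finset.mem_univ, true_and]
    rcases (hmeets d g).1 hgd with rfl | rfl | rfl <;> grind
  rw [sum_inc, sum_inc]
  simp only [Finset.mem_univ, and_true]
  have hsum : ∑ d ∈ Finset.univ.filter (fun d => e d = n), ((if d.1 ∈ J then 1 else 0) +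
      (if d ∈ R then 1 else 0) + (if σ.symm d ∈ R then 1 else 0)) =
      (Finset.univ.filter fun d => e d = n).card := by
    rw [Finset.card_eq_sum_ones]
    exact Finset.sum_congr rfl fun d _ => huniq d
  rw [Finset.sum_add_distrib, Finset.sum_add_distrib] at hsum
  have hshift : ∑ d ∈ Finset.univ.filter (fun d => e d = n), (if σ.symm d ∈ R then 1 else 0) =
      ∑ d ∈ Finset.univ.filter (fun d => e d = n), (if d ∈ R then 1 else 0) := by
    refine (Finset.sum_equiv σ (fun d => ?_) fun d _ => ?_).symm
    · simp [hσe]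
    · simp
  rw [hshift, ← Finset.card_filter, Finset.filter_filter] at hsum
  change (Finset.univ.filter fun d => e d = n ∧ d.1 ∈ J).card % 2 =
    (Finset.univ.filter fun d => e d = n).card % 2
  omega

/-- The join can be chosen to use exactly one edge at each of finitely many vertices of degree
three. -/
theorem exists_join_cost_le_of_cubic {N A : Type*} [Fintype A] (src tgt : A → N)
    (hcut : ∀ S : Set N, (Finset.univ.filter fun a => ¬ (src a ∈ S ↔ tgt a ∈ S)).card ≠ 1)
    (P : Finset N) (hP : ∀ n ∈ P, ∑ a, inc src tgt a n = 3) (c : A → ℤ) :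
    ∃ J : Finset A, (∀ n, (∑ a ∈ J, inc src tgt a n) % 2 = (∑ a, inc src tgt a n) % 2) ∧
      (∀ n ∈ P, ∑ a ∈ J, inc src tgt a n = 1) ∧ 3 * ∑ a ∈ J, c a ≤ ∑ a, c a := by
  obtain ⟨K, hK⟩ : ∃ K : ℤ, K = 1 + 4 * ∑ a, |c a| := ⟨_, rfl⟩
  obtain ⟨J, hJ, hc⟩ := exists_join_cost_le src tgt hcut
    fun a => c a + K * ((∑ n ∈ P, inc src tgt a n : ℕ) : ℤ)
  have hsum : ∀ Q : Finset A, ∑ a ∈ Q, (c a + K * ((∑ n ∈ P, inc src tgt a n : ℕ) : ℤ)) =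
      ∑ a ∈ Q, c a + K * ((∑ n ∈ P, ∑ a ∈ Q, inc src tgt a n : ℕ) : ℤ) := by
    intro Q
    rw [Finset.sum_add_distrib, ← Finset.mul_sum, Finset.sum_comm]
    push_cast
    rfl
  rw [hsum, hsum, Finset.sum_congr rfl hP, Finset.sum_const, smul_eq_mul] at hc
  have habs : ∀ Q : Finset A, |∑ a ∈ Q, c a| ≤ ∑ a, |c a| := fun Q =>
    (Finset.abs_sum_le_sum_abs _ _).trans
      (Finset.sum_le_sum_of_subset_of_nonneg (Finset.subset_univ Q) fun a _ _ => abs_nonneg _)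
  have h1 := abs_le.1 (habs J)
  have h2 := abs_le.1 (habs Finset.univ)
  have hodd : ∀ n ∈ P, 1 ≤ ∑ a ∈ J, inc src tgt a n := by
    intro n hn
    have := hJ n
    rw [hP n hn] at this
    omega
  have hlow : P.card ≤ ∑ n ∈ P, ∑ a ∈ J, inc src tgt a n := by
    simpa using Finset.card_nsmul_le_sum P _ 1 hodd
  have hone : ∑ n ∈ P, ∑ a ∈ J, inc src tgt a n = P.card := by
    by_contra hne
    have h3 : (P.card : ℤ) + 1 ≤ ((∑ n ∈ P, ∑ a ∈ J, inc src tgt a n : ℕ) : ℤ) := by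
      exact_mod_cast (by omega)
    have hK0 : 0 ≤ K := by omega
    have h4 := mul_le_mul_of_nonneg_left h3 hK0
    push_cast at hc h4
    nlinarith
  refine ⟨J, hJ, fun n hn => ?_, ?_⟩
  · by_contra hne
    have : ∑ n ∈ P, 1 < ∑ n ∈ P, ∑ a ∈ J, inc src tgt a n :=
      Finset.sum_lt_sum hodd ⟨n, hn, lt_of_le_of_ne (hodd n hn) (Ne.symm hne)⟩
    rw [hone] at this
    simp at this
  · rw [hone] at hc
    push_cast at hc
    linarith

/-- `g` has no excess at any vertex. -/
def IsConservative {N A R : Type*} [Fintype A] [AddCommMonoid R] (src tgt : A → N)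
    (g : A → R) : Prop :=
  ∀ n, ∑ a, (if src a = n then g a else 0) = ∑ a, if tgt a = n then g a else 0

/-- A circulation that is not integral can be changed on its fractional arcs only. -/
lemma exists_conservative_direction {N A : Type*} [Fintype N] [Fintype A] {src tgt : A → N}
    {g : A → ℝ} (hg : IsConservative src tgt g) (hfrac : ∃ a, (⌊g a⌋ : ℝ) ≠ g a) :
    ∃ d : A → ℝ, IsConservative src tgt d ∧ d ≠ 0 ∧ ∀ a, (⌊g a⌋ : ℝ) = g a → d a = 0 := by
  set F := Finset.univ.filter fun a => (⌊g a⌋ : ℝ) ≠ g a with hF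
  set T := Finset.univ.filter fun n => ∃ a ∈ F, Meets src tgt a n with hT
  have hends : ∀ n ∈ T, 2 ≤ ∑ a ∈ F, inc src tgt a n := by
    intro n hn
    obtain ⟨a, ha, han⟩ := (Finset.mem_filter.1 hn).2
    by_contra hlt
    rw [← Finset.add_sum_erase F _ ha] at hlt
    have h1 : 1 ≤ inc src tgt a n := by
      unfold inc
      rcases han with h | h <;> simp [h]
    have hother : ∀ b ∈ F, b ≠ a → src b ≠ n ∧ tgt b ≠ n := by
      intro b hb hba
      have h2 : inc src tgt b n ≤ ∑ b ∈ F.erase a, inc src tgt b n :=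
        Finset.single_le_sum (f := fun b => inc src tgt b n) (fun _ _ => Nat.zero_le _)
          (Finset.mem_erase.2 ⟨hba, hb⟩)
      have h3 : inc src tgt b n = 0 := by omega
      unfold inc at h3
      constructor <;> intro h <;> simp [h] at h3
    have hloop : ¬ (src a = n ∧ tgt a = n) := by
      rintro ⟨h, h'⟩
      simp only [inc, h, h', if_true] at hlt
      omega
    have hend : ∀ e : A → N, (∀ b ∈ F, b ≠ a → e b ≠ n) →
        ∃ z : ℤ, ∑ b, (if e b = n then g b else 0) = z + if e a = n then g a else 0 := by
      intro e he
      refine ⟨∑ b ∈ Finset.univ.erase a, if e b = n then ⌊g b⌋ else 0, ?_⟩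
      rw [← Finset.sum_erase_add _ _ (Finset.mem_univ a)]
      congr 1
      push_cast
      refine Finset.sum_congr rfl fun b hb => ?_
      split_ifs with h
      · by_contra hne
        exact he b (Finset.mem_filter.2 ⟨Finset.mem_univ _, fun h => hne h.symm⟩)
          (Finset.ne_of_mem_erase hb) h
      · rfl
    obtain ⟨z, hz⟩ := hend src fun b hb hba => (hother b hb hba).1
    obtain ⟨z', hz'⟩ := hend tgt fun b hb hba => (hother b hb hba).2
    have h4 := hg n
    rw [hz, hz'] at h4
    apply (Finset.mem_filter.1 ha).2
    rcases han with h | h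
    · rw [if_pos h, if_neg fun h' => hloop ⟨h, h'⟩] at h4
      have : g a = ((z' - z : ℤ) : ℝ) := by push_cast; linarith
      rw [this, Int.floor_intCast]
    · rw [if_pos h, if_neg fun h' => hloop ⟨h', h⟩] at h4
      have : g a = ((z - z' : ℤ) : ℝ) := by push_cast; linarith
      rw [this, Int.floor_intCast]
  have hTF : T.card ≤ F.card := by
    have h1 : T.card * 2 ≤ ∑ n ∈ T, ∑ a ∈ F, inc src tgt a n := by
      simpa using Finset.card_nsmul_le_sum T _ 2 hends
    have h2 : ∑ n ∈ T, ∑ a ∈ F, inc src tgt a n ≤ ∑ n, ∑ a ∈ F, inc src tgt a n :=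
      Finset.sum_le_sum_of_subset (Finset.subset_univ T)
    have h3 : ∑ n, ∑ a ∈ F, inc src tgt a n = F.card * 2 := by
      rw [Finset.sum_comm, Finset.sum_const_nat]
      intro a _
      simp [inc, Finset.sum_add_distrib]
    omega
  obtain ⟨a0, ha0⟩ := hfrac
  have ha0F : a0 ∈ F := Finset.mem_filter.2 ⟨Finset.mem_univ _, ha0⟩
  set n0 := src a0
  have hn0 : n0 ∈ T := Finset.mem_filter.2 ⟨Finset.mem_univ _, a0, ha0F, Or.inl rfl⟩
  let ext : (F → ℝ) →ₗ[ℝ] (A → ℝ) :=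
    { toFun := fun d a => if h : a ∈ F then d ⟨a, h⟩ else 0
      map_add' := fun d d' => by
        funext a
        simp only [Pi.add_apply]
        split_ifs <;> simp
      map_smul' := fun t d => by
        funext a
        simp only [Pi.smul_apply, RingHom.id_apply]
        split_ifs <;> simp }
  let net : (A → ℝ) →ₗ[ℝ] (N → ℝ) :=
    { toFun := fun d n => ∑ a, (if src a = n then d a else 0) - ∑ a, if tgt a = n then d a else 0
      map_add' := fun d d' => by
        funext n
        simp only [Pi.add_apply, ← Finset.sum_sub_distrib, ← Finset.sum_add_distrib]
        refine Finset.sum_congr rfl fun a _ => ?_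
        split_ifs <;> ring
      map_smul' := fun t d => by
        funext n
        simp only [Pi.smul_apply, RingHom.id_apply, smul_eq_mul, ← Finset.sum_sub_distrib,
          Finset.mul_sum]
        refine Finset.sum_congr rfl fun a _ => ?_
        split_ifs <;> ring }
  have hnet : ∀ d n, net d n =
      ∑ a, (if src a = n then d a else 0) - ∑ a, if tgt a = n then d a else 0 := fun _ _ => rfl
  let res : (N → ℝ) →ₗ[ℝ] (↥(T.erase n0) → ℝ) := LinearMap.funLeft ℝ ℝ Subtype.val
  have hker := LinearMap.ker_ne_bot_of_finrank_lt (f := res ∘ₗ net ∘ₗ ext) (by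
    rw [Module.finrank_fintype_fun_eq_card, Module.finrank_fintype_fun_eq_card,
      Fintype.card_coe, Fintype.card_coe]
    have := Finset.card_erase_lt_of_mem hn0
    omega)
  obtain ⟨d, hd, hd0⟩ := (Submodule.ne_bot_iff _).1 hker
  have hsupp : ∀ a, a ∉ F → ext d a = 0 := fun a ha => dif_neg ha
  have hz : ∀ n, n ≠ n0 → net (ext d) n = 0 := by
    intro n hn
    by_cases hnT : n ∈ T
    · exact congrFun (LinearMap.mem_ker.1 hd) ⟨n, Finset.mem_erase.2 ⟨hn, hnT⟩⟩
    · have h1 : ∀ a ∈ F, src a ≠ n ∧ tgt a ≠ n := by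
        intro a ha
        constructor <;> intro h <;> refine hnT (Finset.mem_filter.2 ⟨Finset.mem_univ _, a, ha, ?_⟩)
        · exact Or.inl h
        · exact Or.inr h
      have h2 : ∀ e : A → N, (∀ a ∈ F, e a ≠ n) → ∑ a, (if e a = n then ext d a else 0) = 0 := by
        intro e he
        refine Finset.sum_eq_zero fun a _ => ?_
        by_cases ha : a ∈ F
        · rw [if_neg (he a ha)]
        · rw [hsupp a ha, ite_self]
      rw [hnet, h2 src fun a ha => (h1 a ha).1, h2 tgt fun a ha => (h1 a ha).2, sub_zero]
  have htot : ∑ n, net (ext d) n = 0 := by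
    simp_rw [hnet]
    rw [Finset.sum_sub_distrib, Finset.sum_comm, Finset.sum_comm (s := Finset.univ (α := N))]
    simp
  rw [Finset.sum_eq_single n0 (fun n _ hn => hz n hn)
    (fun h => absurd (Finset.mem_univ _) h)] at htot
  refine ⟨ext d, fun n => ?_, fun h => hd0 ?_, fun a ha => hsupp a fun h =>
    (Finset.mem_filter.1 h).2 ha⟩
  · have : net (ext d) n = 0 := by
      by_cases hn : n = n0
      · rw [hn, htot]
      · exact hz n hn
    exact sub_eq_zero.1 this
  · funext ⟨a, ha⟩
    have := congrFun h a
    simpa [ext, ha] using this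

/-- **Integral rounding of circulations**: a real circulation can be rounded to an integral one,
each value going to one of the neighbouring integers, without increasing a given linear cost. -/
theorem exists_integral_circulation {N A : Type*} [Fintype N] [Fintype A] {src tgt : A → N}
    (c : A → ℝ) {g : A → ℝ} (hg : IsConservative src tgt g) :
    ∃ z : A → ℤ, IsConservative src tgt z ∧ (∀ a, ⌊g a⌋ ≤ z a ∧ z a ≤ ⌈g a⌉) ∧
      ∑ a, c a * z a ≤ ∑ a, c a * g a := by
  obtain ⟨k, hk⟩ : ∃ k, (Finset.univ.filter fun a => (⌊g a⌋ : ℝ) ≠ g a).card = k := ⟨_, rfl⟩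
  induction k using Nat.strong_induction_on generalizing g with
  | _ k ih =>
  by_cases hfrac : ∃ a, (⌊g a⌋ : ℝ) ≠ g a
  · obtain ⟨d, hd, hd0, hsupp, hcd⟩ : ∃ d : A → ℝ, IsConservative src tgt d ∧ d ≠ 0 ∧
        (∀ a, (⌊g a⌋ : ℝ) = g a → d a = 0) ∧ ∑ a, c a * d a ≤ 0 := by
      obtain ⟨d, hd, hd0, hsupp⟩ := exists_conservative_direction hg hfrac
      rcases le_total (∑ a, c a * d a) 0 with h | h
      · exact ⟨d, hd, hd0, hsupp, h⟩
      · refine ⟨-d, fun n => ?_, neg_ne_zero.2 hd0, fun a ha => by simp [hsupp a ha], by simpa⟩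
        have := hd n
        have h1 : ∀ e : A → N, ∑ a, (if e a = n then (-d) a else 0) =
            -∑ a, if e a = n then d a else 0 := by
          intro e
          rw [← Finset.sum_neg_distrib]
          refine Finset.sum_congr rfl fun a _ => ?_
          split_ifs <;> simp
        rw [h1, h1, this]
    obtain ⟨t, ht, hslack, i, hi, hi0⟩ := exists_ratio_step
      (Sum.elim (fun a => g a - ⌊g a⌋) fun a => ⌈g a⌉ - g a) (Sum.elim d fun a => -d a)
      (by
        rintro (a | a)
        · simp
        · simpa using Int.le_ceil (g a))
      (by
        rintro (a | a) h
        · exact hsupp a (by simp only [Sum.elim_inl] at h; linarith)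
        · simp only [Sum.elim_inr] at h ⊢
          rw [neg_eq_zero]
          refine hsupp a ?_
          have : g a = (⌈g a⌉ : ℝ) := by linarith
          rw [this, Int.floor_intCast])
      (by
        obtain ⟨a, ha⟩ := Function.ne_iff.1 hd0
        rcases lt_or_gt_of_ne ha with h | h
        · exact ⟨Sum.inl a, h⟩
        · exact ⟨Sum.inr a, by simpa using h⟩)
    have hlo : ∀ a, (⌊g a⌋ : ℝ) ≤ g a + t * d a := fun a => by
      have := hslack (Sum.inl a)
      simp only [Sum.elim_inl] at this
      linarith
    have hhi : ∀ a, g a + t * d a ≤ (⌈g a⌉ : ℝ) := fun a => by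
      have := hslack (Sum.inr a)
      simp only [Sum.elim_inr] at this
      linarith
    have hcons : IsConservative src tgt fun a => g a + t * d a := by
      intro n
      have h1 : ∀ e : A → N, ∑ a, (if e a = n then g a + t * d a else 0) =
          ∑ a, (if e a = n then g a else 0) + t * ∑ a, if e a = n then d a else 0 := by
        intro e
        rw [Finset.mul_sum, ← Finset.sum_add_distrib]
        refine Finset.sum_congr rfl fun a _ => ?_
        split_ifs <;> simp
      rw [h1, h1, hg n, hd n]
    have hlt : (Finset.univ.filter fun a => (⌊g a + t * d a⌋ : ℝ) ≠ g a + t * d a).card < k := by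
      rw [← hk]
      refine Finset.card_lt_card (Finset.ssubset_iff_of_subset ?_ |>.2 ?_)
      · intro a ha
        simp only [Finset.mem_filter, Finset.mem_univ, true_and] at ha ⊢
        intro h
        apply ha
        rw [hsupp a h, mul_zero, add_zero, h]
      · rcases i with a | a
        · simp only [Sum.elim_inl] at hi hi0
          refine ⟨a, by simpa using fun h => hi (by linarith), ?_⟩
          have : g a + t * d a = (⌊g a⌋ : ℝ) := by linarith
          simp [this]
        · simp only [Sum.elim_inr] at hi hi0
          refine ⟨a, ?_, ?_⟩
          · simp only [Finset.mem_filter, Finset.mem_univ, true_and]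
            intro h
            apply hi
            rw [← h, Int.ceil_intCast, sub_self]
          · have : g a + t * d a = (⌈g a⌉ : ℝ) := by linarith
            simp [this]
    obtain ⟨z, hz, hb, hle⟩ := ih _ hlt hcons rfl
    refine ⟨z, hz, fun a => ⟨?_, ?_⟩, hle.trans ?_⟩
    · exact (Int.le_floor.2 (hlo a)).trans (hb a).1
    · exact (hb a).2.trans (Int.ceil_le.2 (hhi a))
    · have : ∑ a, c a * (g a + t * d a) = ∑ a, c a * g a + t * ∑ a, c a * d a := by
        rw [Finset.mul_sum, ← Finset.sum_add_distrib]
        exact Finset.sum_congr rfl fun a _ => by ring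
      rw [this]
      nlinarith
  · push Not at hfrac
    refine ⟨fun a => ⌊g a⌋, fun n => ?_, fun a => ⟨le_rfl, Int.floor_le_ceil _⟩, ?_⟩
    · have := hg n
      have h1 : ∀ e : A → N, ((∑ a, if e a = n then ⌊g a⌋ else 0 : ℤ) : ℝ) =
          ∑ a, if e a = n then g a else 0 := by
        intro e
        push_cast
        exact Finset.sum_congr rfl fun a _ => by rw [hfrac a]
      exact_mod_cast (h1 src).trans (this.trans (h1 tgt).symm)
    · exact Finset.sum_le_sum fun a _ => by rw [hfrac a]

lemma inc_of_meets {N A : Type*} {src tgt : A → N} {a : A} {v u : N}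
    (h : (v = src a ∧ u = tgt a) ∨ (v = tgt a ∧ u = src a)) (n : N) :
    inc src tgt a n = (if n = v then 1 else 0) + if n = u then 1 else 0 := by
  rcases h with ⟨rfl, rfl⟩ | ⟨rfl, rfl⟩
  · simp [inc, eq_comm]
  · simp [inc, eq_comm, add_comm]

/-- **Euler's theorem**: a connected multigraph with even degrees whose edges are edges of `G`
gives a closed walk in `G` through all vertices that is no longer than the number of edges. -/
lemma exists_closed_walk_of_even {V A : Type*} [Fintype A] {G : SimpleGraph V} {src tgt : A → V}
    (hadj : ∀ a, G.Adj (src a) (tgt a)) (heven : ∀ n, Even (∑ a, inc src tgt a n)) [Nonempty V]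
    (hconn : ∀ S : Set V, S.Nonempty → (∀ a, (src a ∈ S ↔ tgt a ∈ S)) → S = Set.univ) :
    ∃ (v : V) (w : G.Walk v v), (∀ u : V, u ∈ w.support) ∧ w.length ≤ Fintype.card A := by
  let good : Finset A → Prop := fun E => ∃ (u v : V) (w : G.Walk u v), w.length = E.card ∧
    (∀ n, (∑ a ∈ E, inc src tgt a n) % 2 =
      ((if n = u then 1 else 0) + if n = v then 1 else 0) % 2) ∧
    ∀ a ∈ E, src a ∈ w.support ∧ tgt a ∈ w.support
  obtain ⟨E, hE, hmax⟩ := Finset.exists_max_image (Finset.univ.filter good) Finset.card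
    ⟨∅, Finset.mem_filter.2 ⟨Finset.mem_univ _, Classical.arbitrary V, Classical.arbitrary V,
      SimpleGraph.Walk.nil, rfl, fun n => by simp; split_ifs <;> rfl, by simp⟩⟩
  obtain ⟨u, v, w, hlen, hpar, hends⟩ := (Finset.mem_filter.1 hE).2
  have hextend : ∀ (x y : V) (p : G.Walk x y), p.length = E.card →
      (∀ n, (∑ a ∈ E, inc src tgt a n) % 2 =
        ((if n = x then 1 else 0) + if n = y then 1 else 0) % 2) →
      (∀ a ∈ E, src a ∈ p.support ∧ tgt a ∈ p.support) → ∀ a, Meets src tgt a y → a ∈ E := by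
    intro x y p hp hpar hsup a hay
    by_contra haE
    obtain ⟨z, hz, hyz⟩ : ∃ z, ((y = src a ∧ z = tgt a) ∨ (y = tgt a ∧ z = src a)) ∧
        G.Adj y z := by
      rcases hay with rfl | rfl
      · exact ⟨_, Or.inl ⟨rfl, rfl⟩, hadj a⟩
      · exact ⟨_, Or.inr ⟨rfl, rfl⟩, (hadj a).symm⟩
    have hgood : good (insert a E) := by
      refine ⟨x, z, p.concat hyz, ?_, fun n => ?_, fun b hb => ?_⟩
      · rw [SimpleGraph.Walk.length_concat, hp, Finset.card_insert_of_notMem haE]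
      · rw [Finset.sum_insert haE, inc_of_meets hz]
        have := hpar n
        omega
      · rw [SimpleGraph.Walk.support_concat]
        rcases Finset.mem_insert.1 hb with rfl | hb
        · rcases hz with ⟨h1, h2⟩ | ⟨h1, h2⟩
          · rw [← h1, ← h2]; simp
          · rw [← h1, ← h2]; simp
        · have := hsup b hb
          simp [this.1, this.2]
    have := hmax _ (Finset.mem_filter.2 ⟨Finset.mem_univ _, hgood⟩)
    rw [Finset.card_insert_of_notMem haE] at this
    omega
  have huv : u = v := by
    by_contra huv
    have h1 := hpar v
    rw [if_neg (Ne.symm huv), if_pos rfl] at h1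
    have h2 : ∑ a, inc src tgt a v = ∑ a ∈ E, inc src tgt a v := by
      refine (Finset.sum_subset (Finset.subset_univ E) fun a _ ha => ?_).symm
      have : ¬ Meets src tgt a v := fun h => ha (hextend u v w hlen hpar hends a h)
      unfold Meets at this
      push Not at this
      simp [inc, this.1, this.2]
    have h3 := Nat.even_iff.1 (heven v)
    omega
  subst huv
  have hclosed : ∀ a, ∀ n ∈ w.support, Meets src tgt a n → a ∈ E := by
    intro a n hn han
    refine hextend n n (w.rotate n hn) (by rw [SimpleGraph.Walk.length_rotate, hlen]) (fun m => ?_)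
      (fun b hb => ?_) a han
    · have := hpar m
      split_ifs at this ⊢ <;> omega
    · have := hends b hb
      simpa [SimpleGraph.Walk.mem_support_rotate_iff] using this
  refine ⟨u, w, fun x => ?_, hlen ▸ Finset.card_le_univ E⟩
  have := hconn {x | x ∈ w.support} ⟨u, w.start_mem_support⟩ fun a =>
    ⟨fun h => (hends a (hclosed a _ h (Or.inl rfl))).2,
      fun h => (hends a (hclosed a _ h (Or.inr rfl))).1⟩
  have hx : x ∈ {x | x ∈ w.support} := by
    rw [this]
    trivial
  exact hx

/-- Euler's theorem for edges with multiplicities. -/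
theorem exists_closed_walk_of_even_mult {V A : Type*} [Fintype A] {G : SimpleGraph V}
    {src tgt : A → V} {m : A → ℕ} (hadj : ∀ a, 0 < m a → G.Adj (src a) (tgt a))
    (heven : ∀ n, Even (∑ a, m a * inc src tgt a n)) [Nonempty V]
    (hconn : ∀ S : Set V, S.Nonempty → (∀ a, 0 < m a → (src a ∈ S ↔ tgt a ∈ S)) → S = Set.univ) :
    ∃ (v : V) (w : G.Walk v v), (∀ u : V, u ∈ w.support) ∧ w.length ≤ ∑ a, m a := by
  have h := exists_closed_walk_of_even (A := Σ a, Fin (m a)) (G := G) (src := fun i => src i.1)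
    (tgt := fun i => tgt i.1) (fun i => hadj i.1 (Fin.pos i.2))
    (fun n => by
      rw [Fintype.sum_sigma]
      convert heven n using 1
      refine Finset.sum_congr rfl fun a _ => ?_
      change ∑ _ : Fin (m a), inc src tgt a n = m a * inc src tgt a n
      rw [Finset.sum_const, Finset.card_univ, Fintype.card_fin, smul_eq_mul])
    (fun S hS hcl => hconn S hS fun a ha => hcl ⟨a, ⟨0, ha⟩⟩)
  simpa using h

/-- `u` lies below `w` in the forest with parent map `p`. -/
def Below {V : Type*} (p : V → V) (u w : V) : Prop := ∃ k : ℕ, p^[k] u = w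

lemma Below.refl {V : Type*} (p : V → V) (u : V) : Below p u u := ⟨0, rfl⟩

lemma Below.trans {V : Type*} {p : V → V} {u v w : V} (h : Below p u v) (h' : Below p v w) :
    Below p u w := by
  obtain ⟨k, rfl⟩ := h
  obtain ⟨l, rfl⟩ := h'
  exact ⟨l + k, Function.iterate_add_apply p l k u⟩

lemma Below.parent {V : Type*} (p : V → V) (u : V) : Below p u (p u) := ⟨1, rfl⟩

lemma below_iff {V : Type*} {p : V → V} {u w : V} : Below p u w ↔ u = w ∨ Below p (p u) w := by
  constructor
  · rintro ⟨_ | k, hk⟩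
    · exact Or.inl hk
    · exact Or.inr ⟨k, hk⟩
  · rintro (rfl | h)
    · exact Below.refl p u
    · exact (Below.parent p u).trans h

lemma Below.eq_of_fixed {V : Type*} {p : V → V} {r w : V} (hr : p r = r) (h : Below p r w) :
    w = r := by
  obtain ⟨k, rfl⟩ := h
  exact Function.iterate_fixed hr k

/-- If `p` agrees with `q` on a set as long as the target is not reached, then being below the
target for `q` implies it for `p`. -/
lemma Below.of_agree {V : Type*} {p q : V → V} {C : Set V} {w : V} (hq : ∀ v ∈ C, q v ∈ C)
    (hpq : ∀ v ∈ C, v ≠ w → Below q v w → p v = q v) {u : V} (hu : u ∈ C) (h : Below q u w) :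
    Below p u w := by
  obtain ⟨k, hk⟩ := h
  induction k generalizing u with
  | zero => exact ⟨0, hk⟩
  | succ k ih =>
    by_cases huw : u = w
    · exact huw ▸ Below.refl p u
    · rw [below_iff, hpq u hu huw ⟨_, hk⟩]
      exact Or.inr (ih (hq u hu) hk)

/-- A rooted spanning tree of `S` in the support of `c`, given by its parent map, for which all
pairs in the support are comparable, and such that the edge from a vertex to its parent has
maximum weight among the pairs joining the subtree of the vertex to the parent. -/
structure IsGreedyTree {V : Type*} (c : V → V → ℝ) (S : Finset V) (r : V) (p : V → V) :
    Prop where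
  root_mem : r ∈ S
  root : p r = r
  mem : ∀ v ∈ S, p v ∈ S
  below_root : ∀ v ∈ S, Below p v r
  pos : ∀ w ∈ S, w ≠ r → 0 < c w (p w)
  comparable : ∀ u ∈ S, ∀ v ∈ S, u ≠ v → 0 < c u v → Below p u v ∨ Below p v u
  greedy : ∀ w ∈ S, w ≠ r → ∀ u ∈ S, Below p u w → c u (p w) ≤ c w (p w)

/-- Greedy depth first search. -/
lemma exists_isGreedyTree {V : Type*} {c : V → V → ℝ} (hsymm : ∀ u v, c u v = c v u)
    (S : Finset V) (r : V) (hr : r ∈ S)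
    (hconn : ∀ T ⊆ S, r ∈ T → T ≠ S → ∃ a ∈ T, ∃ b ∈ S, b ∉ T ∧ 0 < c a b) :
    ∃ p, IsGreedyTree c S r p := by
  obtain ⟨k, hk⟩ : ∃ k, S.card = k := ⟨_, rfl⟩
  induction k using Nat.strong_induction_on generalizing S r with
  | _ k ih =>
  by_cases hS : S = {r}
  · refine ⟨id, hr, rfl, fun v hv => hv, fun v hv => ⟨0, by simpa [hS] using hv⟩,
      fun w hw hwr => absurd (by simpa [hS] using hw) hwr, fun u hu v hv huv => ?_,
      fun w hw hwr => absurd (by simpa [hS] using hw) hwr⟩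
    simp only [hS, Finset.mem_singleton] at hu hv
    exact absurd (hu.trans hv.symm) huv
  obtain ⟨a, ha, b, hbS, hb, hab⟩ := hconn {r} (by simpa using hr) (by simp) (Ne.symm hS)
  rw [Finset.mem_singleton] at ha hb
  subst ha
  obtain ⟨w, hw, hmax⟩ := Finset.exists_max_image (S.erase a) (c a)
    ⟨b, Finset.mem_erase.2 ⟨hb, hbS⟩⟩
  have haw : 0 < c a w := hab.trans_le (hmax b (Finset.mem_erase.2 ⟨hb, hbS⟩))
  obtain ⟨C, hC, hmin⟩ := Finset.exists_min_image
    ((S.erase a).powerset.filter fun C => w ∈ C ∧ ∀ u ∈ C, ∀ v ∈ S.erase a, 0 < c u v → v ∈ C)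
    Finset.card ⟨S.erase a, by simpa using ⟨Finset.mem_erase.1 hw, by tauto⟩⟩
  simp only [Finset.mem_filter, Finset.mem_powerset] at hC hmin
  obtain ⟨hCS, hwC, hcl⟩ := hC
  have haC : a ∉ C := fun h => (Finset.mem_erase.1 (hCS h)).1 rfl
  have hCS' : C ⊆ S := hCS.trans (Finset.erase_subset _ _)
  obtain ⟨p₁, h₁⟩ := ih C.card (hk ▸ Finset.card_lt_card
      ((Finset.ssubset_iff_of_subset hCS').2 ⟨a, hr, haC⟩)) C w hwC (by
    intro T hT hwT hTC
    by_contra hno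
    push Not at hno
    have hlt := Finset.card_lt_card (lt_of_le_of_ne hT hTC)
    refine absurd (hmin T ⟨hT.trans hCS, hwT, fun u hu v hv huv => ?_⟩) (by omega)
    by_contra hvT
    exact absurd huv (not_lt.2 (hno u hu v (hcl u (hT hu) v hv huv) hvT))) rfl
  obtain ⟨p₂, h₂⟩ := ih (S \ C).card (hk ▸ Finset.card_lt_card
      ((Finset.ssubset_iff_of_subset Finset.sdiff_subset).2 ⟨w, hCS' hwC, by simp [hwC]⟩))
      (S \ C) a (by simp [hr, haC]) (by
    intro T hT haT hTne
    obtain ⟨u, hu, v, hv, hvT, huv⟩ := hconn (T ∪ C) (Finset.union_subset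
      (hT.trans Finset.sdiff_subset) hCS') (Finset.mem_union_left _ haT) (fun h => hTne (by
        refine Finset.Subset.antisymm hT fun v hv => ?_
        rw [Finset.mem_sdiff, ← h] at hv
        exact (Finset.mem_union.1 hv.1).resolve_right hv.2))
    rw [Finset.mem_union, not_or] at hvT
    have hva : v ≠ a := by
      rintro rfl
      exact hvT.1 haT
    refine ⟨u, (Finset.mem_union.1 hu).resolve_right fun huC => ?_, v,
      Finset.mem_sdiff.2 ⟨hv, hvT.2⟩, hvT.1, huv⟩
    exact hvT.2 (hcl u huC v (Finset.mem_erase.2 ⟨hva, hv⟩) huv)) rfl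
  set p : V → V := fun v => if v ∈ C then (if v = w then a else p₁ v) else p₂ v with hp
  have hpw : p w = a := by simp [hp, hwC]
  have hp1 : ∀ v ∈ C, v ≠ w → p v = p₁ v := fun v hv hvw => by simp [hp, hv, hvw]
  have hp2 : ∀ v ∉ C, p v = p₂ v := fun v hv => by simp [hp, hv]
  have hpa : p a = a := by rw [hp2 a haC, h₂.root]
  have hwS : w ∈ S := hCS' hwC
  have hb1 : ∀ u ∈ C, ∀ v, Below p₁ u v → Below p u v := by
    intro u hu v h
    refine h.of_agree (C := (C : Set V)) h₁.mem (fun x hx hxv hbx => hp1 x hx ?_) hu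
    rintro rfl
    exact hxv (hbx.eq_of_fixed h₁.root).symm
  have hb2 : ∀ u ∈ S \ C, ∀ v, Below p₂ u v → Below p u v := fun u hu v h =>
    h.of_agree (C := ((S \ C : Finset V) : Set V)) h₂.mem
      (fun x hx _ _ => hp2 x (Finset.mem_sdiff.1 hx).2) hu
  have hb2' : ∀ u ∈ S \ C, ∀ v, Below p u v → v ∈ S \ C ∧ Below p₂ u v := by
    rintro u hu v ⟨k, hk⟩
    induction k generalizing u with
    | zero => exact hk ▸ ⟨hu, Below.refl p₂ u⟩
    | succ k ih =>
      have h3 := hp2 u (Finset.mem_sdiff.1 hu).2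
      rw [Function.iterate_succ_apply, h3] at hk
      have := ih (p₂ u) (h₂.mem u hu) hk
      exact ⟨this.1, below_iff.2 (Or.inr this.2)⟩
  have hb1' : ∀ u ∈ C, ∀ v, Below p u v → v = a ∨ v ∈ C ∧ Below p₁ u v := by
    rintro u hu v ⟨k, hk⟩
    induction k generalizing u with
    | zero => exact hk ▸ Or.inr ⟨hu, Below.refl p₁ u⟩
    | succ k ih =>
      rw [Function.iterate_succ_apply] at hk
      by_cases huw : u = w
      · rw [huw, hpw, Function.iterate_fixed hpa] at hk
        exact Or.inl hk.symm
      · rw [hp1 u hu huw] at hk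
        refine (ih (p₁ u) (h₁.mem u hu) hk).imp_right fun h => ⟨h.1, below_iff.2 (Or.inr h.2)⟩
  have hroot : ∀ v ∈ S, Below p v a := by
    intro v hv
    by_cases hvC : v ∈ C
    · exact (hb1 v hvC w (h₁.below_root v hvC)).trans ⟨1, hpw⟩
    · have := Finset.mem_sdiff.2 ⟨hv, hvC⟩
      exact hb2 v this a (h₂.below_root v this)
  have hcross : ∀ u ∈ C, ∀ v ∈ S, v ∉ C → 0 < c u v → v = a := by
    intro u hu v hv hvC huv
    by_contra hva
    exact hvC (hcl u hu v (Finset.mem_erase.2 ⟨hva, hv⟩) huv)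
  refine ⟨p, hr, hpa, fun v hv => ?_, hroot, fun v hv hva => ?_, fun u hu v hv huv hpos => ?_,
    fun v hv hva u hu huv => ?_⟩
  · by_cases hvC : v ∈ C
    · by_cases hvw : v = w
      · rw [hvw, hpw]; exact hr
      · rw [hp1 v hvC hvw]; exact hCS' (h₁.mem v hvC)
    · rw [hp2 v hvC]
      exact (Finset.mem_sdiff.1 (h₂.mem v (Finset.mem_sdiff.2 ⟨hv, hvC⟩))).1
  · by_cases hvC : v ∈ C
    · by_cases hvw : v = w
      · rw [hvw, hpw, hsymm]; exact haw
      · rw [hp1 v hvC hvw]; exact h₁.pos v hvC hvw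
    · rw [hp2 v hvC]
      exact h₂.pos v (Finset.mem_sdiff.2 ⟨hv, hvC⟩) hva
  · by_cases huC : u ∈ C <;> by_cases hvC : v ∈ C
    · exact (h₁.comparable u huC v hvC huv hpos).imp (hb1 u huC v) (hb1 v hvC u)
    · rw [hcross u huC v hv hvC hpos]
      exact Or.inl (hroot u hu)
    · rw [hcross v hvC u hu huC (hsymm u v ▸ hpos)]
      exact Or.inr (hroot v hv)
    · have hu' := Finset.mem_sdiff.2 ⟨hu, huC⟩
      have hv' := Finset.mem_sdiff.2 ⟨hv, hvC⟩
      exact (h₂.comparable u hu' v hv' huv hpos).imp (hb2 u hu' v) (hb2 v hv' u)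
  · by_cases hvC : v ∈ C
    · by_cases huC : u ∈ C
      · by_cases hvw : v = w
        · rw [hvw, hpw, hsymm u, hsymm w]
          exact hmax u (hCS huC)
        · rw [hp1 v hvC hvw]
          exact h₁.greedy v hvC hvw u huC ((hb1' u huC v huv).resolve_left hva).2
      · exact absurd hvC
          (Finset.mem_sdiff.1 (hb2' u (Finset.mem_sdiff.2 ⟨hu, huC⟩) v huv).1).2
    · rw [hp2 v hvC]
      have hv' := Finset.mem_sdiff.2 ⟨hv, hvC⟩
      by_cases huC : u ∈ C
      · rcases hb1' u huC v huv with h | h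
        · exact absurd h hva
        · exact absurd h.1 hvC
      · have hu' := Finset.mem_sdiff.2 ⟨hu, huC⟩
        exact h₂.greedy v hv' hva u hu' (hb2' u hu' v huv).2

/-- `p` is the parent map of a spanning tree rooted at `r`. -/
structure IsRootedTree {V : Type*} (r : V) (p : V → V) : Prop where
  root : p r = r
  below_root : ∀ v, Below p v r

lemma IsRootedTree.parent_ne {V : Type*} {r : V} {p : V → V} (h : IsRootedTree r p) {w : V}
    (hw : w ≠ r) : p w ≠ w :=
  fun h' => hw ((h.below_root w).eq_of_fixed h').symm

lemma IsRootedTree.antisymm {V : Type*} {r : V} {p : V → V} (h : IsRootedTree r p) {u w : V}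
    (h1 : Below p u w) (h2 : Below p w u) : u = w := by
  obtain ⟨k, rfl⟩ := h1
  obtain ⟨l, hl⟩ := h2
  obtain ⟨j, hj⟩ := h.below_root u
  rw [← Function.iterate_add_apply] at hl
  rcases Nat.eq_zero_or_pos k with rfl | hk
  · rfl
  have hper : ∀ m, p^[(l + k) * m] u = u := by
    intro m
    rw [Function.iterate_mul]
    exact Function.iterate_fixed hl m
  have hbig : ∀ i, j ≤ i → p^[i] u = r := by
    intro i hi
    obtain ⟨d, rfl⟩ := Nat.exists_eq_add_of_le' hi
    rw [Function.iterate_add_apply, hj]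
    exact Function.iterate_fixed h.root d
  have hu : u = r := by
    rw [← hper j]
    exact hbig _ (Nat.le_mul_of_pos_left j (by omega))
  rw [hu, Function.iterate_fixed h.root]

lemma Below.total {V : Type*} {p : V → V} {u v w : V} (h1 : Below p u v) (h2 : Below p u w) :
    Below p v w ∨ Below p w v := by
  obtain ⟨k, rfl⟩ := h1
  obtain ⟨l, rfl⟩ := h2
  rcases le_total k l with h | h
  · obtain ⟨d, rfl⟩ := Nat.exists_eq_add_of_le' h
    exact Or.inl ⟨d, (Function.iterate_add_apply p d k u).symm⟩
  · obtain ⟨d, rfl⟩ := Nat.exists_eq_add_of_le' h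
    exact Or.inr ⟨d, (Function.iterate_add_apply p d l u).symm⟩

lemma Below.of_ne {V : Type*} {p : V → V} {u w : V} (h : Below p u w) (hne : u ≠ w) :
    Below p (p u) w := (below_iff.1 h).resolve_left hne

lemma IsRootedTree.not_parent_below {V : Type*} {r : V} {p : V → V} (h : IsRootedTree r p)
    {w : V} (hw : w ≠ r) : ¬ Below p (p w) w :=
  fun h' => h.parent_ne hw (h.antisymm h' (Below.parent p w))

lemma IsRootedTree.eq_root {V : Type*} {r : V} {p : V → V} (h : IsRootedTree r p) {w : V}
    (hw : Below p r w) : w = r := hw.eq_of_fixed h.root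

/-- Subtrees of distinct children of a vertex are disjoint. -/
lemma IsRootedTree.eq_of_siblings {V : Type*} {r : V} {p : V → V} (h : IsRootedTree r p)
    {u w w' : V} (hw : w ≠ r) (hw' : w' ≠ r) (hp : p w = p w') (h1 : Below p u w)
    (h2 : Below p u w') : w = w' := by
  by_contra hne
  rcases h1.total h2 with h3 | h3
  · exact h.not_parent_below hw' (hp ▸ h3.of_ne hne)
  · exact h.not_parent_below hw (hp ▸ h3.of_ne (Ne.symm hne))

/-- The child of a proper ancestor `v` of `u` whose subtree contains `u`. -/
lemma IsRootedTree.exists_child {V : Type*} {r : V} {p : V → V} (h : IsRootedTree r p) {u v : V}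
    (huv : Below p u v) (hne : u ≠ v) : ∃ c, c ≠ r ∧ p c = v ∧ Below p u c := by
  obtain ⟨k, hk⟩ := huv
  induction k generalizing u with
  | zero => exact absurd hk hne
  | succ k ih =>
    by_cases hpu : p u = v
    · refine ⟨u, fun hur => hne ?_, hpu, Below.refl p u⟩
      rw [← hpu, hur, h.root]
    · obtain ⟨c, hc, hcv, hb⟩ := ih hpu hk
      exact ⟨c, hc, hcv, (Below.parent p u).trans hb⟩

/-- The vertices below `w`. -/
noncomputable def subtree {V : Type*} [Fintype V] (p : V → V) (w : V) : Finset V :=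
  Finset.univ.filter fun u => Below p u w

lemma mem_subtree {V : Type*} [Fintype V] {p : V → V} {u w : V} :
    u ∈ subtree p w ↔ Below p u w := by simp [subtree]

/-- The children of `v`. -/
noncomputable def children {V : Type*} [Fintype V] (r : V) (p : V → V) (v : V) : Finset V :=
  Finset.univ.filter fun w => w ≠ r ∧ p w = v

lemma mem_children {V : Type*} [Fintype V] {r : V} {p : V → V} {v w : V} :
    w ∈ children r p v ↔ w ≠ r ∧ p w = v := by simp [children]

lemma sum_children {V R : Type*} [Fintype V] [AddCommMonoid R] (r : V) (p : V → V) (f : V → R) :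
    ∑ v, ∑ w ∈ children r p v, f w = ∑ w ∈ Finset.univ.erase r, f w := by
  rw [← Finset.sum_fiberwise (s := Finset.univ.erase r) (g := p)]
  refine Finset.sum_congr rfl fun v _ => Finset.sum_congr ?_ fun _ _ => rfl
  ext w
  simp [mem_children]

lemma IsRootedTree.pairwiseDisjoint {V : Type*} [Fintype V] {r : V} {p : V → V}
    (h : IsRootedTree r p) (v : V) (W : Finset V) (hW : W ⊆ children r p v) :
    (W : Set V).PairwiseDisjoint (subtree p) := by
  intro w hw w' hw' hne
  have h1 := mem_children.1 (hW hw)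
  have h2 := mem_children.1 (hW hw')
  refine Finset.disjoint_left.2 fun u hu hu' => hne ?_
  exact h.eq_of_siblings h1.1 h2.1 (h1.2.trans h2.2.symm) (mem_subtree.1 hu) (mem_subtree.1 hu')

/-- A subtree consists of its root and the subtrees of the children of its root. -/
lemma IsRootedTree.sum_subtree {V R : Type*} [Fintype V] [AddCommMonoid R] {r : V} {p : V → V}
    (h : IsRootedTree r p) (v : V) (f : V → R) :
    ∑ u ∈ subtree p v, f u = f v + ∑ w ∈ children r p v, ∑ u ∈ subtree p w, f u := by
  rw [← Finset.sum_biUnion (h.pairwiseDisjoint v _ subset_rfl), ← Finset.sum_insert]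
  · refine Finset.sum_congr ?_ fun _ _ => rfl
    ext u
    simp only [mem_subtree, Finset.mem_insert, Finset.mem_biUnion, mem_children]
    constructor
    · intro hu
      by_cases huv : u = v
      · exact Or.inl huv
      · obtain ⟨c, hc, hcv, hb⟩ := h.exists_child hu huv
        exact Or.inr ⟨c, ⟨hc, hcv⟩, hb⟩
    · rintro (rfl | ⟨c, ⟨-, rfl⟩, hb⟩)
      · exact Below.refl p u
      · exact hb.trans (Below.parent p c)
  · simp only [Finset.mem_biUnion, mem_subtree, mem_children, not_exists, not_and, and_imp]
    rintro c hc rfl hb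
    exact h.not_parent_below hc hb

/-- Below a vertex with excess `ε`, the losses at the children are paid for by the excess. -/
lemma sum_loss_le {V : Type*} (W : Finset V) (q a : V → ℝ) (ε : ℝ) (hq : ∀ w ∈ W, 0 ≤ q w)
    (ha : ∀ w ∈ W, 0 ≤ a w) (hqa : ∀ w ∈ W, 2 ≤ q w + a w) (hdeg : ∑ w ∈ W, q w ≤ 2 + ε)
    (hsub : ∀ T ⊆ W, ∑ w ∈ T, (q w - a w) ≤ ε) :
    ∑ w ∈ W, (5 / 6 * max (q w - 2) 0 + max (1 - a w) 0) ≤ 5 / 6 * ε := by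
  by_cases hA : ∀ w ∈ W, 2 ≤ q w → a w < 1
  · have h1 : ∑ w ∈ W, (5 / 6 * max (q w - 2) 0 + max (1 - a w) 0) ≤
        ∑ w ∈ W.filter (fun w => a w < 1), 5 / 6 * (q w - a w) := by
      rw [Finset.sum_filter]
      refine Finset.sum_le_sum fun w hw => ?_
      have := hqa w hw
      have := ha w hw
      split_ifs with h
      · rcases le_total (q w) 2 with h2 | h2
        · rw [max_eq_right (by linarith), max_eq_left (by linarith)]
          linarith
        · rw [max_eq_left (by linarith), max_eq_left (by linarith)]
          linarith
      · have h2 : q w < 2 := by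
          by_contra h2
          exact h (hA w hw (not_lt.1 h2))
        rw [max_eq_right (by linarith), max_eq_right (by linarith)]
        norm_num
    rw [← Finset.mul_sum] at h1
    have := hsub _ (Finset.filter_subset (fun w => a w < 1) W)
    linarith
  · push Not at hA
    obtain ⟨w₀, hw₀, h2, h1⟩ := hA
    rw [← Finset.add_sum_erase _ _ hw₀, max_eq_left (by linarith : 0 ≤ q w₀ - 2),
      max_eq_right (by linarith : 1 - a w₀ ≤ 0)]
    rw [← Finset.add_sum_erase _ _ hw₀] at hdeg
    have h3 : ∑ w ∈ W.erase w₀, (5 / 6 * max (q w - 2) 0 + max (1 - a w) 0) ≤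
        ∑ w ∈ W.erase w₀, 5 / 6 * q w := by
      refine Finset.sum_le_sum fun w hw => ?_
      have := hqa w (Finset.mem_of_mem_erase hw)
      have := ha w (Finset.mem_of_mem_erase hw)
      have := hq w (Finset.mem_of_mem_erase hw)
      rcases max_cases (q w - 2) 0 with h | h <;> rcases max_cases (1 - a w) 0 with h' | h' <;>
        linarith
    rw [← Finset.mul_sum] at h3
    linarith

/-- The version of `sum_loss_le` for the root. -/
lemma sum_loss_le_root {V : Type*} (W : Finset V) (q a : V → ℝ) (ε : ℝ) (hε : 0 ≤ ε)
    (hq : ∀ w ∈ W, 0 ≤ q w) (ha : ∀ w ∈ W, 0 ≤ a w) (hqa : ∀ w ∈ W, 2 ≤ q w + a w)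
    (hdeg : ∑ w ∈ W, q w ≤ 2 + ε) :
    ∑ w ∈ W, (5 / 6 * max (q w - 2) 0 + max (1 - a w) 0) ≤ 5 / 6 * ε + 1 := by
  by_cases hA : ∃ w ∈ W, 0 < 5 / 6 * max (q w - 2) 0 + max (1 - a w) 0
  · obtain ⟨w₀, hw₀, hpos⟩ := hA
    rw [← Finset.add_sum_erase _ _ hw₀]
    rw [← Finset.add_sum_erase _ _ hw₀] at hdeg
    have h3 : ∑ w ∈ W.erase w₀, (5 / 6 * max (q w - 2) 0 + max (1 - a w) 0) ≤
        ∑ w ∈ W.erase w₀, 5 / 6 * q w := by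
      refine Finset.sum_le_sum fun w hw => ?_
      have := hqa w (Finset.mem_of_mem_erase hw)
      have := ha w (Finset.mem_of_mem_erase hw)
      have := hq w (Finset.mem_of_mem_erase hw)
      rcases max_cases (q w - 2) 0 with h | h <;> rcases max_cases (1 - a w) 0 with h' | h' <;>
        linarith
    rw [← Finset.mul_sum] at h3
    have h4 : 5 / 6 * max (q w₀ - 2) 0 + max (1 - a w₀) 0 ≤ 5 / 6 * (q w₀ - 2) + 1 := by
      have := hqa w₀ hw₀
      have := ha w₀ hw₀
      rcases max_cases (q w₀ - 2) 0 with h | h <;> rcases max_cases (1 - a w₀) 0 with h' | h' <;>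
        linarith
    linarith
  · push Not at hA
    have := Finset.sum_nonpos hA
    linarith

/-- `(u, b)` joins `u` to a proper ancestor other than its parent. -/
def IsBack {V : Type*} (p : V → V) (u b : V) : Prop := Below p u b ∧ u ≠ b ∧ p u ≠ b

/-- The flow from the subtree of `w` to the parent of `w`. -/
noncomputable def flowTo {V R : Type*} [Fintype V] [AddCommMonoid R] (p : V → V) (y : V → V → R)
    (w : V) : R :=
  ∑ u ∈ subtree p w, y u (p w)

/-- The flow from the subtree of `w` to the vertices outside it other than the parent of `w`. -/
noncomputable def flowPast {V R : Type*} [Fintype V] [AddCommMonoid R] (p : V → V)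
    (y : V → V → R) (w : V) : R :=
  ∑ u ∈ subtree p w, ∑ b ∈ Finset.univ.filter (fun b => b ∉ subtree p w ∧ b ≠ p w), y u b

/-- The weights of the back edges, truncated at one. -/
noncomputable def backWeight {V : Type*} (p : V → V) (x : Sym2 V → ℝ) (u b : V) : ℝ :=
  if IsBack p u b then min (x s(u, b)) 1 else 0

lemma IsRootedTree.isBack {V : Type*} {r : V} {p : V → V} (h : IsRootedTree r p) {u w : V}
    (hw : w ≠ r) (hu : Below p u w) (hne : u ≠ w) : IsBack p u (p w) := by
  refine ⟨hu.trans (Below.parent p w), ?_, ?_⟩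
  · rintro rfl
    exact h.not_parent_below hw hu
  · intro hp
    have hur : u ≠ r := by
      rintro rfl
      exact hw (h.eq_root hu)
    exact hne (h.eq_of_siblings hur hw hp (Below.refl p u) hu)

lemma isBack_of_past {V : Type*} {p : V → V} {u w b : V} (hu : Below p u w) (hb : ¬ Below p b w)
    (hbw : b ≠ p w) (hub : Below p u b ∨ Below p b u) : IsBack p u b := by
  have hub' : Below p u b := hub.resolve_right fun h => hb (h.trans hu)
  refine ⟨hub', fun h => hb (h ▸ hu), fun h => ?_⟩
  by_cases huw : u = w
  · exact hbw (by rw [← h, huw])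
  · exact hb (h ▸ hu.of_ne huw)

lemma IsGreedyTree.isRootedTree {V : Type*} [Fintype V] {c : V → V → ℝ} {r : V} {p : V → V}
    (h : IsGreedyTree c Finset.univ r p) : IsRootedTree r p :=
  ⟨h.root, fun v => h.below_root v (Finset.mem_univ v)⟩

/-- Back edges past `w` cover `w` at least as well as their LP weight indicates. -/
lemma IsGreedyTree.one_sub_flowPast_le {V : Type*} [Fintype V] {x : Sym2 V → ℝ} {r : V}
    {p : V → V} (h : IsGreedyTree (fun u v => x s(u, v)) Finset.univ r p) (h0 : ∀ e, 0 ≤ x e)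
    (w : V) :
    max (1 - flowPast p (backWeight p x) w) 0 ≤
      max (1 - flowPast p (fun u v => x s(u, v)) w) 0 := by
  have hy : ∀ u ∈ subtree p w, ∀ b ∈ Finset.univ.filter
      (fun b => b ∉ subtree p w ∧ b ≠ p w), backWeight p x u b = min (x s(u, b)) 1 := by
    intro u hu b hb
    simp only [Finset.mem_filter, Finset.mem_univ, true_and, mem_subtree] at hu hb
    unfold backWeight
    split_ifs with hback
    · rfl
    · rcases (h0 s(u, b)).lt_or_eq with hpos | hz
      · exact absurd (isBack_of_past hu hb.1 hb.2 (h.comparable u (Finset.mem_univ u) b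
          (Finset.mem_univ b) (fun h' => hb.1 (h' ▸ hu)) hpos)) hback
      · simp [← hz]
  have hnn : ∀ u ∈ subtree p w, ∀ b ∈ Finset.univ.filter
      (fun b => b ∉ subtree p w ∧ b ≠ p w), 0 ≤ backWeight p x u b := by
    intro u hu b hb
    rw [hy u hu b hb]
    exact le_min (h0 _) zero_le_one
  by_cases hbig : ∃ u ∈ subtree p w, ∃ b ∈ Finset.univ.filter
      (fun b => b ∉ subtree p w ∧ b ≠ p w), 1 ≤ x s(u, b)
  · obtain ⟨u, hu, b, hb, h1⟩ := hbig
    have : 1 ≤ flowPast p (backWeight p x) w := by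
      calc (1 : ℝ) = backWeight p x u b := by rw [hy u hu b hb, min_eq_right h1]
        _ ≤ ∑ b ∈ Finset.univ.filter (fun b => b ∉ subtree p w ∧ b ≠ p w), backWeight p x u b :=
          Finset.single_le_sum (hnn u hu) hb
        _ ≤ _ := Finset.single_le_sum (f := fun u => ∑ b ∈ Finset.univ.filter
          (fun b => b ∉ subtree p w ∧ b ≠ p w), backWeight p x u b)
          (fun u hu => Finset.sum_nonneg (hnn u hu)) hu
    rw [max_eq_right (by linarith)]
    exact le_max_right _ _
  · push Not at hbig
    have : flowPast p (backWeight p x) w = flowPast p (fun u v => x s(u, v)) w :=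
      Finset.sum_congr rfl fun u hu => Finset.sum_congr rfl fun b hb => by
        rw [hy u hu b hb, min_eq_left (hbig u hu b hb).le]
    rw [this]

/-- The number of back edges from the subtree of `w` to the parent of `w`. -/
noncomputable def backCount {V : Type*} [Fintype V] (p : V → V) (x : Sym2 V → ℝ) (w : V) : ℕ :=
  (((subtree p w).erase w).filter fun u => 0 < x s(u, p w)).card

lemma IsGreedyTree.flowTo_sub_one_le {V : Type*} [Fintype V] {x : Sym2 V → ℝ} {r : V}
    {p : V → V} (h : IsGreedyTree (fun u v => x s(u, v)) Finset.univ r p) (h0 : ∀ e, 0 ≤ x e)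
    {w : V} (hw : w ≠ r) :
    max (flowTo p (backWeight p x) w - 1) 0 ≤ backCount p x w / 6 +
      5 / 6 * max (flowTo p (fun u v => x s(u, v)) w - 2) 0 := by
  have hww : w ∈ subtree p w := mem_subtree.2 (Below.refl p w)
  have hz : flowTo p (backWeight p x) w =
      ∑ u ∈ ((subtree p w).erase w).filter fun u => 0 < x s(u, p w), min (x s(u, p w)) 1 := by
    rw [Finset.sum_filter]
    unfold flowTo
    rw [← Finset.add_sum_erase _ _ hww]
    have : backWeight p x w (p w) = 0 := if_neg fun h' => h'.2.2 rfl
    rw [this, zero_add]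
    refine Finset.sum_congr rfl fun u hu => ?_
    rw [Finset.mem_erase, mem_subtree] at hu
    rw [backWeight, if_pos (h.isRootedTree.isBack hw hu.2 hu.1)]
    split_ifs with h1
    · rfl
    · rw [le_antisymm (not_lt.1 h1) (h0 _)]
      simp
  have hzk : flowTo p (backWeight p x) w ≤ backCount p x w := by
    rw [hz]
    refine (Finset.sum_le_card_nsmul _ _ 1 fun u _ => min_le_right _ _).trans ?_
    simp [backCount]
  have hzt : flowTo p (backWeight p x) w ≤ backCount p x w * x s(w, p w) := by
    rw [hz]
    refine (Finset.sum_le_card_nsmul _ _ (x s(w, p w)) fun u hu => ?_).trans ?_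
    · simp only [Finset.mem_filter, Finset.mem_erase, mem_subtree] at hu
      exact (min_le_left _ _).trans
        (h.greedy w (Finset.mem_univ w) hw u (Finset.mem_univ u) hu.1.2)
    · simp [backCount]
  have hzq : flowTo p (backWeight p x) w + x s(w, p w) ≤
      flowTo p (fun u v => x s(u, v)) w := by
    rw [hz]
    unfold flowTo
    rw [← Finset.add_sum_erase _ _ hww, add_comm]
    gcongr
    rw [Finset.sum_filter]
    refine Finset.sum_le_sum fun u _ => ?_
    split_ifs
    · exact min_le_left _ _
    · exact h0 _
  refine posPart_sub_one_le _ _ _ hzk ?_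
  nlinarith [(Nat.cast_nonneg (backCount p x w) : (0 : ℝ) ≤ _)]

lemma IsGreedyTree.sum_backCount_add_le {V : Type*} [Fintype V] {x : Sym2 V → ℝ} {r : V}
    {p : V → V} (h : IsGreedyTree (fun u v => x s(u, v)) Finset.univ r p) :
    ∑ w ∈ Finset.univ.erase r, backCount p x w + (Fintype.card V - 1) ≤
      (Finset.univ.filter fun e => x e ≠ 0).card := by
  have ht := h.isRootedTree
  have h1 : ∑ w ∈ Finset.univ.erase r, backCount p x w + (Fintype.card V - 1) =
      ((Finset.univ.erase r).sigma fun w =>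
        (subtree p w).filter fun u => 0 < x s(u, p w)).card := by
    rw [Finset.card_sigma, ← Finset.card_univ, ← Finset.card_erase_of_mem (Finset.mem_univ r),
      Finset.card_eq_sum_ones, ← Finset.sum_add_distrib]
    refine Finset.sum_congr rfl fun w hw => ?_
    have hw' : w ∈ (subtree p w).filter fun u => 0 < x s(u, p w) := by
      simp only [Finset.mem_filter, mem_subtree]
      exact ⟨Below.refl p w, h.pos w (Finset.mem_univ w) (Finset.ne_of_mem_erase hw)⟩
    rw [← Finset.card_erase_add_one hw', ← Finset.filter_erase]
    rfl
  rw [h1]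
  refine Finset.card_le_card_of_injOn (fun a => s(a.2, p a.1)) ?_ ?_
  · rintro ⟨w, u⟩ ha
    simp only [Finset.coe_sigma, Set.mem_sigma_iff, Finset.mem_coe, Finset.mem_filter] at ha
    simp [ha.2.2.ne']
  · rintro ⟨w, u⟩ ha ⟨w', u'⟩ ha' heq
    simp only [Finset.mem_coe, Finset.mem_sigma, Finset.mem_filter, Finset.mem_erase,
      Finset.mem_univ, and_true, mem_subtree] at ha ha'
    rcases Sym2.eq_iff.1 heq with ⟨h1, h2⟩ | ⟨h1, h2⟩
    · dsimp only at h1 h2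
      subst h1
      rw [ht.eq_of_siblings ha.1 ha'.1 h2 ha.2.1 ha'.2.1]
    · dsimp only at h1 h2
      refine absurd ?_ (ht.not_parent_below ha.1)
      rw [h2]
      exact (ha'.2.1.trans (Below.parent p w')).trans (h1 ▸ ha.2.1)

lemma pairCut_eq {V : Type*} [Fintype V] (x : Sym2 V → ℝ) (S : Finset V) :
    pairCut x S = ∑ a ∈ S, ∑ b ∈ Sᶜ, x s(a, b) := by
  unfold pairCut
  rw [← Finset.sum_filter_add_sum_filter_not Finset.univ (· ∈ S),
    Finset.sum_eq_zero (s := Finset.univ.filter (· ∉ S))]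
  · rw [add_zero, Finset.filter_mem_eq_inter, Finset.univ_inter]
    refine Finset.sum_congr rfl fun a ha => ?_
    simp only [ha, true_and]
    rw [← Finset.sum_filter]
    refine Finset.sum_congr ?_ fun _ _ => rfl
    ext
    simp
  · intro a ha
    exact Finset.sum_eq_zero fun b _ => if_neg fun h => (Finset.mem_filter.1 ha).2 h.1

lemma IsRootedTree.two_le_flow {V : Type*} [Fintype V] {x : Sym2 V → ℝ} {r : V} {p : V → V}
    (h : IsRootedTree r p) (hcut : ∀ S : Finset V, S.Nonempty → S ≠ Finset.univ → 2 ≤ pairCut x S)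
    {w : V} (hw : w ≠ r) :
    2 ≤ flowTo p (fun u v => x s(u, v)) w + flowPast p (fun u v => x s(u, v)) w := by
  have hpw : p w ∉ subtree p w := fun h' => h.not_parent_below hw (mem_subtree.1 h')
  refine (hcut (subtree p w) ⟨w, mem_subtree.2 (Below.refl p w)⟩ fun h' => ?_).trans_eq ?_
  · exact hpw (h' ▸ Finset.mem_univ _)
  · rw [pairCut_eq]
    unfold flowTo flowPast
    rw [← Finset.sum_add_distrib]
    refine Finset.sum_congr rfl fun u _ => ?_
    rw [← Finset.add_sum_erase _ _ (Finset.mem_compl.2 hpw)]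
    congr 1
    refine Finset.sum_congr ?_ fun _ _ => rfl
    ext b
    simp [and_comm]

lemma IsRootedTree.sum_flowTo_eq {V : Type*} [Fintype V] {r : V} {p : V → V}
    (h : IsRootedTree r p) (x : Sym2 V → ℝ) (v : V) (W : Finset V) (hW : W ⊆ children r p v) :
    ∑ w ∈ W, flowTo p (fun u v => x s(u, v)) w = ∑ u ∈ W.biUnion (subtree p), x s(v, u) := by
  rw [Finset.sum_biUnion (h.pairwiseDisjoint v W hW)]
  refine Finset.sum_congr rfl fun w hw => Finset.sum_congr rfl fun u _ => ?_
  rw [(mem_children.1 (hW hw)).2, Sym2.eq_swap]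

lemma IsRootedTree.sum_flow_sub_le {V : Type*} [Fintype V] {x : Sym2 V → ℝ} {r : V} {p : V → V}
    (h : IsRootedTree r p) (h0 : ∀ e, 0 ≤ x e)
    (hcut : ∀ S : Finset V, S.Nonempty → S ≠ Finset.univ → 2 ≤ pairCut x S)
    {v : V} (hv : v ≠ r) (W : Finset V) (hW : W ⊆ children r p v) :
    ∑ w ∈ W, (flowTo p (fun u v => x s(u, v)) w - flowPast p (fun u v => x s(u, v)) w) ≤
      ∑ u, x s(v, u) - 2 := by
  have hvU : v ∉ W.biUnion (subtree p) := by
    simp only [Finset.mem_biUnion, mem_subtree, not_exists, not_and]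
    intro w hw hb
    have := mem_children.1 (hW hw)
    exact h.not_parent_below this.1 (this.2.symm ▸ hb)
  have hr : r ∉ insert v (W.biUnion (subtree p)) := by
    simp only [Finset.mem_insert, Finset.mem_biUnion, mem_subtree, not_or, not_exists, not_and]
    exact ⟨hv.symm, fun w hw hb => (mem_children.1 (hW hw)).1 (h.eq_root hb)⟩
  have hc := hcut (insert v (W.biUnion (subtree p))) (Finset.insert_nonempty _ _)
    fun h' => hr (h' ▸ Finset.mem_univ r)
  rw [pairCut_eq, Finset.sum_insert hvU, Finset.sum_biUnion (h.pairwiseDisjoint v W hW)] at hc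
  rw [Finset.sum_sub_distrib, h.sum_flowTo_eq x v W hW]
  have h1 : ∑ b ∈ (insert v (W.biUnion (subtree p)))ᶜ, x s(v, b) +
      ∑ u ∈ W.biUnion (subtree p), x s(v, u) ≤ ∑ u, x s(v, u) := by
    rw [← Finset.sum_union]
    · exact Finset.sum_le_sum_of_subset_of_nonneg (Finset.subset_univ _) fun _ _ _ => h0 _
    · refine Finset.disjoint_left.2 fun b hb hb' => ?_
      exact Finset.mem_compl.1 hb (Finset.mem_insert_of_mem hb')
  have h2 : ∑ w ∈ W, ∑ u ∈ subtree p w, ∑ b ∈ (insert v (W.biUnion (subtree p)))ᶜ, x s(u, b) ≤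
      ∑ w ∈ W, flowPast p (fun u v => x s(u, v)) w := by
    refine Finset.sum_le_sum fun w hw => Finset.sum_le_sum fun u _ => ?_
    refine Finset.sum_le_sum_of_subset_of_nonneg (fun b hb => ?_) fun _ _ _ => h0 _
    simp only [Finset.mem_compl, Finset.mem_insert, Finset.mem_biUnion, not_or, not_exists,
      not_and] at hb
    simp only [Finset.mem_filter, Finset.mem_univ, true_and]
    exact ⟨hb.2 w hw, fun h' => hb.1 (h'.trans (mem_children.1 (hW hw)).2)⟩
  linarith

/-- The fractional cost of covering the tree. -/
theorem IsGreedyTree.fractional_loss_le {V : Type*} [Fintype V] {x : Sym2 V → ℝ} {r : V}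
    {p : V → V} (h : IsGreedyTree (fun u v => x s(u, v)) Finset.univ r p) (h0 : ∀ e, 0 ≤ x e)
    (hcut : ∀ S : Finset V, S.Nonempty → S ≠ Finset.univ → 2 ≤ pairCut x S)
    (hsupp : (Finset.univ.filter fun e => x e ≠ 0).card ≤ 2 * (Fintype.card V - 1))
    (hV : 2 ≤ Fintype.card V) :
    ∑ w ∈ Finset.univ.erase r, (max (flowTo p (backWeight p x) w - 1) 0 +
        max (1 - flowPast p (backWeight p x) w) 0) ≤
      (Fintype.card V - 1 : ℝ) / 6 +
        5 / 6 * (∑ v, ∑ u, x s(v, u) - 2 * Fintype.card V) + 1 := by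
  have ht := h.isRootedTree
  set q := flowTo p (fun u v => x s(u, v)) with hqd
  set a := flowPast p (fun u v => x s(u, v)) with had
  have hq : ∀ w, 0 ≤ q w := fun w => Finset.sum_nonneg fun _ _ => h0 _
  have ha : ∀ w, 0 ≤ a w := fun w =>
    Finset.sum_nonneg fun _ _ => Finset.sum_nonneg fun _ _ => h0 _
  have h1 : ∀ w ∈ Finset.univ.erase r, max (flowTo p (backWeight p x) w - 1) 0 +
      max (1 - flowPast p (backWeight p x) w) 0 ≤
      (backCount p x w : ℝ) / 6 + (5 / 6 * max (q w - 2) 0 + max (1 - a w) 0) := by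
    intro w hw
    have := h.flowTo_sub_one_le h0 (Finset.ne_of_mem_erase hw)
    have := h.one_sub_flowPast_le h0 w
    linarith
  have h2 : ∀ v, ∑ w ∈ children r p v, (5 / 6 * max (q w - 2) 0 + max (1 - a w) 0) ≤
      5 / 6 * (∑ u, x s(v, u) - 2) + if v = r then 1 else 0 := by
    intro v
    have hdeg : ∑ w ∈ children r p v, q w ≤ 2 + (∑ u, x s(v, u) - 2) := by
      rw [ht.sum_flowTo_eq x v _ subset_rfl]
      have := Finset.sum_le_sum_of_subset_of_nonneg
        (Finset.subset_univ ((children r p v).biUnion (subtree p)))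
        (f := fun u => x s(v, u)) fun _ _ _ => h0 _
      linarith
    have hqa : ∀ w ∈ children r p v, 2 ≤ q w + a w := fun w hw =>
      ht.two_le_flow hcut (mem_children.1 hw).1
    split_ifs with hv
    · refine sum_loss_le_root _ q a _ ?_ (fun w _ => hq w) (fun w _ => ha w) hqa hdeg
      have hc := hcut {v} (Finset.singleton_nonempty v) fun h' => by
        have := congrArg Finset.card h'
        rw [Finset.card_singleton, Finset.card_univ] at this
        omega
      rw [pairCut_eq, Finset.sum_singleton] at hc
      have := Finset.sum_le_sum_of_subset_of_nonneg (Finset.subset_univ ({v}ᶜ : Finset V))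
        (f := fun u => x s(v, u)) fun _ _ _ => h0 _
      linarith
    · rw [add_zero]
      exact sum_loss_le _ q a _ (fun w _ => hq w) (fun w _ => ha w) hqa hdeg
        fun T hT => ht.sum_flow_sub_le h0 hcut hv T hT
  have h3 : (∑ w ∈ Finset.univ.erase r, (backCount p x w : ℝ)) ≤ Fintype.card V - 1 := by
    have h4 : ∑ w ∈ Finset.univ.erase r, backCount p x w ≤ Fintype.card V - 1 := by
      have := h.sum_backCount_add_le.trans hsupp
      omega
    have h5 : ((∑ w ∈ Finset.univ.erase r, backCount p x w : ℕ) : ℝ) ≤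
        ((Fintype.card V - 1 : ℕ) : ℝ) := by exact_mod_cast h4
    rwa [Nat.cast_sum, Nat.cast_sub (by omega), Nat.cast_one] at h5
  refine (Finset.sum_le_sum h1).trans ?_
  rw [Finset.sum_add_distrib, ← Finset.sum_div]
  have h6 := Finset.sum_le_sum fun v (_ : v ∈ Finset.univ) => h2 v
  rw [Finset.sum_add_distrib, ← Finset.mul_sum, Finset.sum_sub_distrib,
    Finset.sum_ite_eq' Finset.univ r, if_pos (Finset.mem_univ r), Finset.sum_const,
    Finset.card_univ, nsmul_eq_mul, sum_children] at h6
  linarith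

/-- The child of `v` whose subtree contains `u`. -/
noncomputable def branch {V : Type*} (r : V) (p : V → V) (u v : V) : V :=
  if h : ∃ c, c ≠ r ∧ p c = v ∧ Below p u c then h.choose else r

lemma IsRootedTree.branch_eq {V : Type*} {r : V} {p : V → V} (h : IsRootedTree r p) {u c : V}
    (hc : c ≠ r) (hb : Below p u c) : branch r p u (p c) = c := by
  have hex : ∃ c', c' ≠ r ∧ p c' = p c ∧ Below p u c' := ⟨c, hc, rfl, hb⟩
  rw [branch, dif_pos hex]
  exact h.eq_of_siblings hex.choose_spec.1 hc hex.choose_spec.2.1 hex.choose_spec.2.2 hb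

lemma IsRootedTree.branch_spec {V : Type*} {r : V} {p : V → V} (h : IsRootedTree r p) {u v : V}
    (hb : IsBack p u v) :
    branch r p u v ≠ r ∧ p (branch r p u v) = v ∧ Below p u (branch r p u v) := by
  have hex := h.exists_child hb.1 hb.2.1
  rw [branch, dif_pos hex]
  exact hex.choose_spec

lemma IsRootedTree.sum_branch {V R : Type*} [Fintype V] [AddCommMonoid R] {r : V} {p : V → V}
    (h : IsRootedTree r p) {y : V → V → R} (hy : ∀ u v, ¬ IsBack p u v → y u v = 0) (c : V) :
    ∑ u, ∑ v, (if branch r p u v = c then y u v else 0) =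
      if c = r then 0 else flowTo p y c := by
  split_ifs with hc
  · refine Finset.sum_eq_zero fun u _ => Finset.sum_eq_zero fun v _ => ?_
    split_ifs with hb
    · refine hy u v fun h' => ?_
      exact (h.branch_spec h').1 (hb.trans hc)
    · rfl
  · unfold flowTo
    rw [subtree, Finset.sum_filter]
    refine Finset.sum_congr rfl fun u _ => ?_
    rw [Finset.sum_eq_single (p c)]
    · split_ifs with h1 h2 h2
      · rfl
      · refine hy _ _ fun h' => h2 ?_
        rw [← h1]
        exact (h.branch_spec h').2.2
      · exact absurd (h.branch_eq hc h2) h1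
      · rfl
    · intro v _ hv
      split_ifs with h1
      · refine hy u v fun h' => hv ?_
        rw [← h1]
        exact (h.branch_spec h').2.1.symm
      · rfl
    · simp

/-- Conservation of the flow of back edges at a vertex. -/
lemma IsRootedTree.sum_flowPast_add {V R : Type*} [Fintype V] [AddCommMonoid R] {r : V}
    {p : V → V} (h : IsRootedTree r p) {y : V → V → R}
    (hy : ∀ u v, ¬ IsBack p u v → y u v = 0) (w : V) :
    ∑ c ∈ children r p w, flowPast p y c + ∑ b, y w b =
      if w = r then 0 else flowTo p y w + flowPast p y w := by
  have h1 : ∑ u ∈ subtree p w, ∑ b ∈ (subtree p w)ᶜ, y u b =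
      if w = r then 0 else flowTo p y w + flowPast p y w := by
    split_ifs with hw
    · refine Finset.sum_eq_zero fun u _ => Finset.sum_eq_zero fun b hb => ?_
      refine absurd (mem_subtree.2 ?_) (Finset.mem_compl.1 hb)
      rw [hw]
      exact h.below_root b
    · unfold flowTo flowPast
      rw [← Finset.sum_add_distrib]
      refine Finset.sum_congr rfl fun u _ => ?_
      have hpw : p w ∉ subtree p w := fun h' => h.not_parent_below hw (mem_subtree.1 h')
      rw [← Finset.add_sum_erase _ _ (Finset.mem_compl.2 hpw)]
      congr 1
      refine Finset.sum_congr ?_ fun _ _ => rfl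
      ext b
      simp [and_comm]
  rw [← h1, h.sum_subtree, add_comm]
  congr 1
  · refine (Finset.sum_subset (Finset.subset_univ _) fun b _ hb => hy w b fun h' => ?_).symm
    rw [Finset.mem_compl, not_not, mem_subtree] at hb
    exact h'.2.1 (h.antisymm h'.1 hb)
  · refine Finset.sum_congr rfl fun c hc => Finset.sum_congr rfl fun u hu => ?_
    rw [mem_children] at hc
    rw [mem_subtree] at hu
    refine (Finset.sum_subset (fun b hb => ?_) fun b hb hb' => hy u b fun h' => ?_).symm
    · rw [Finset.mem_compl, mem_subtree] at hb
      simp only [Finset.mem_filter, Finset.mem_univ, true_and, mem_subtree]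
      refine ⟨fun h' => hb (h'.trans (hc.2 ▸ Below.parent p c)), fun h' => hb ?_⟩
      rw [h', hc.2]
      exact Below.refl p w
    · simp only [Finset.mem_filter, Finset.mem_univ, true_and, mem_subtree] at hb
      rw [Finset.mem_compl, not_not, mem_subtree] at hb'
      rcases hu.total h'.1 with h2 | h2
      · have h3 : Below p w b := by
          rw [← hc.2]
          exact h2.of_ne fun h4 => hb.1 (h4 ▸ Below.refl p c)
        exact hb.2 ((h.antisymm hb' h3).trans hc.2.symm)
      · exact hb.1 h2

/-- The flow past a vertex is determined by the conservation laws. -/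
lemma IsRootedTree.eq_flowPast {V R : Type*} [Fintype V] [AddCommGroup R] {r : V} {p : V → V}
    (h : IsRootedTree r p) {y : V → V → R} (hy : ∀ u v, ¬ IsBack p u v → y u v = 0) {t : V → R}
    (ht : ∀ w, w ≠ r → ∑ c ∈ children r p w, t c + ∑ b, y w b = flowTo p y w + t w) {w : V}
    (hw : w ≠ r) : t w = flowPast p y w := by
  obtain ⟨k, hk⟩ : ∃ k, (subtree p w).card = k := ⟨_, rfl⟩
  induction k using Nat.strong_induction_on generalizing w with
  | _ k ih =>
    have h1 := ht w hw
    have h2 := h.sum_flowPast_add hy w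
    rw [if_neg hw] at h2
    have h3 : ∑ c ∈ children r p w, t c = ∑ c ∈ children r p w, flowPast p y c := by
      refine Finset.sum_congr rfl fun c hc => ?_
      rw [mem_children] at hc
      refine ih _ ?_ hc.1 rfl
      rw [← hk]
      refine Finset.card_lt_card (Finset.ssubset_iff_subset_ne.2 ⟨fun u hu => ?_, fun h' => ?_⟩)
      · rw [mem_subtree] at hu ⊢
        exact hu.trans (hc.2 ▸ Below.parent p c)
      · refine h.not_parent_below hc.1 (mem_subtree.1 ?_)
        rw [h', hc.2]
        exact mem_subtree.2 (Below.refl p w)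
    rw [h3, h2] at h1
    exact (add_left_cancel h1).symm

lemma flowPast_root {V R : Type*} [Fintype V] [AddCommMonoid R] {r : V} {p : V → V}
    (h : IsRootedTree r p) (y : V → V → R) : flowPast p y r = 0 := by
  refine Finset.sum_eq_zero fun u _ => Finset.sum_eq_zero fun b hb => ?_
  exact absurd (mem_subtree.2 (h.below_root b)) (Finset.mem_filter.1 hb).2.1

/-- Source of an arc of the network in which the back edges flow up the branches of the tree. -/
def netSrc {V : Type*} (p : V → V) : (V × V) ⊕ V ⊕ V → V ⊕ V
  | .inl a => .inl a.1
  | .inr (.inl c) => .inr c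
  | .inr (.inr c) => .inl (p c)

/-- Target of an arc of the network in which the back edges flow up the branches of the tree. -/
noncomputable def netTgt {V : Type*} (r : V) (p : V → V) : (V × V) ⊕ V ⊕ V → V ⊕ V
  | .inl a => .inr (branch r p a.1 a.2)
  | .inr (.inl c) => .inl c
  | .inr (.inr c) => .inl c

lemma isConservative_net_iff {V R : Type*} [Fintype V] [AddCommMonoid R] {r : V} {p : V → V}
    (h : IsRootedTree r p) {g : (V × V) ⊕ V ⊕ V → R} (hr : g (.inr (.inr r)) = 0)
    (hy : ∀ u v, ¬ IsBack p u v → g (.inl (u, v)) = 0) :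
    IsConservative (netSrc p) (netTgt r p) g ↔
      (∀ w, ∑ c ∈ children r p w, g (.inr (.inr c)) + ∑ b, g (.inl (w, b)) =
        g (.inr (.inl w)) + g (.inr (.inr w))) ∧
      ∀ c, g (.inr (.inl c)) = if c = r then 0 else flowTo p (fun u v => g (.inl (u, v))) c := by
  have hchild : ∀ w, ∑ c ∈ children r p w, g (.inr (.inr c)) =
      ∑ c, if p c = w then g (.inr (.inr c)) else 0 := by
    intro w
    rw [children, Finset.sum_filter]
    refine Finset.sum_congr rfl fun c _ => ?_
    by_cases hc : c = r
    · simp [hc, hr]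
    · simp [hc]
  have hb := h.sum_branch (y := fun u v => g (.inl (u, v))) hy
  have hrow : ∀ w, ∑ a : V × V, (if a.1 = w then g (.inl a) else 0) = ∑ b, g (.inl (w, b)) := by
    intro w
    rw [Fintype.sum_prod_type, Finset.sum_eq_single w]
    · simp
    · intro u _ hu
      simp [hu]
    · simp
  constructor
  · intro hg
    constructor
    · intro w
      have := hg (.inl w)
      simp only [Fintype.sum_sum_type, netSrc, netTgt, Sum.inl.injEq, reduceCtorEq, if_false,
        Finset.sum_const_zero, zero_add, hrow, Finset.sum_ite_eq', Finset.mem_univ, if_true] at this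
      rw [hchild, ← this, add_comm]
    · intro c
      have := hg (.inr c)
      simp only [Fintype.sum_sum_type, netSrc, netTgt, Sum.inr.injEq, reduceCtorEq, if_false,
        Finset.sum_const_zero, zero_add, add_zero, Finset.sum_ite_eq', Finset.mem_univ,
        if_true, Fintype.sum_prod_type] at this
      rw [this, hb]
  · rintro ⟨h1, h2⟩ (w | c)
    · simp only [Fintype.sum_sum_type, netSrc, netTgt, Sum.inl.injEq, reduceCtorEq, if_false,
        Finset.sum_const_zero, zero_add, hrow, Finset.sum_ite_eq', Finset.mem_univ, if_true]
      rw [← h1, hchild, add_comm]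
    · simp only [Fintype.sum_sum_type, netSrc, netTgt, Sum.inr.injEq, reduceCtorEq, if_false,
        Finset.sum_const_zero, zero_add, add_zero, Finset.sum_ite_eq', Finset.mem_univ,
        if_true, Fintype.sum_prod_type]
      rw [h2, hb]

/-- Fractional back edges can be rounded without increasing the loss. -/
theorem IsRootedTree.exists_integral_back {V : Type*} [Fintype V] {r : V} {p : V → V}
    (h : IsRootedTree r p) {y : V → V → ℝ} (hy : ∀ u v, ¬ IsBack p u v → y u v = 0)
    (hy0 : ∀ u v, 0 ≤ y u v) (hy1 : ∀ u v, y u v ≤ 1) :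
    ∃ Y : V → V → ℤ, (∀ u v, Y u v = 0 ∨ Y u v = 1) ∧ (∀ u v, y u v = 0 → Y u v = 0) ∧
      ((∑ w ∈ Finset.univ.erase r, (max (flowTo p Y w - 1) 0 + max (1 - flowPast p Y w) 0) : ℤ)
        : ℝ) ≤
      ∑ w ∈ Finset.univ.erase r, (max (flowTo p y w - 1) 0 + max (1 - flowPast p y w) 0) := by
  let g : (V × V) ⊕ V ⊕ V → ℝ := fun
    | .inl a => y a.1 a.2
    | .inr (.inl c) => if c = r then 0 else flowTo p y c
    | .inr (.inr c) => flowPast p y c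
  have hg : IsConservative (netSrc p) (netTgt r p) g := by
    rw [isConservative_net_iff h (flowPast_root h y) hy]
    refine ⟨fun w => ?_, fun c => rfl⟩
    refine (h.sum_flowPast_add hy w).trans ?_
    change _ = (if w = r then 0 else flowTo p y w) + flowPast p y w
    split_ifs with hw
    · rw [hw, flowPast_root h, add_zero]
    · rfl
  let c : (V × V) ⊕ V ⊕ V → ℝ := fun
    | .inl _ => 0
    | .inr (.inl w) => if 1 ≤ flowTo p y w then 1 else 0
    | .inr (.inr w) => if flowPast p y w < 1 then -1 else 0
  obtain ⟨f, hf, hfg, hcost⟩ := exists_integral_circulation c hg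
  have hzero : ∀ a, g a = 0 → f a = 0 := by
    intro a ha
    have := hfg a
    rw [ha, Int.floor_zero, Int.ceil_zero] at this
    omega
  have hY : ∀ u v, ¬ IsBack p u v → f (.inl (u, v)) = 0 := fun u v huv => hzero _ (hy u v huv)
  have hfr : f (.inr (.inr r)) = 0 := hzero _ (flowPast_root h y)
  rw [isConservative_net_iff h hfr hY] at hf
  have hto : ∀ w, w ≠ r → f (.inr (.inl w)) = flowTo p (fun u v => f (.inl (u, v))) w := by
    intro w hw
    rw [hf.2, if_neg hw]
  have hpast : ∀ w, w ≠ r → f (.inr (.inr w)) = flowPast p (fun u v => f (.inl (u, v))) w := by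
    intro w hw
    refine h.eq_flowPast hY (t := fun w => f (.inr (.inr w))) (fun w hw => ?_) hw
    rw [← hto w hw]
    exact hf.1 w
  refine ⟨fun u v => f (.inl (u, v)), fun u v => ?_, fun u v huv => hzero _ huv, ?_⟩
  · obtain ⟨h1, h2⟩ := hfg (.inl (u, v))
    have h3 : 0 ≤ ⌊g (.inl (u, v))⌋ := Int.floor_nonneg.2 (hy0 u v)
    have h4 : ⌈g (.inl (u, v))⌉ ≤ 1 := Int.ceil_le.2 (by exact_mod_cast hy1 u v)
    beta_reduce
    omega
  · have hsplit : ∀ k : (V × V) ⊕ V ⊕ V → ℝ, k (.inr (.inl r)) = 0 → k (.inr (.inr r)) = 0 →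
        ∑ a, c a * k a = ∑ w ∈ Finset.univ.erase r,
          (c (.inr (.inl w)) * k (.inr (.inl w)) + c (.inr (.inr w)) * k (.inr (.inr w))) := by
      intro k h1 h2
      rw [Fintype.sum_sum_type, Fintype.sum_sum_type, ← Finset.sum_add_distrib,
        ← Finset.add_sum_erase _ _ (Finset.mem_univ r), h1, h2]
      simp [c]
    rw [hsplit (fun a => (f a : ℝ)) (by simp [hf.2]) (by simp [hfr]),
      hsplit g (if_pos rfl) (flowPast_root h y)] at hcost
    have hlin : ∀ w ∈ Finset.univ.erase r,
        ((max (flowTo p (fun u v => f (.inl (u, v))) w - 1) 0 +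
          max (1 - flowPast p (fun u v => f (.inl (u, v))) w) 0 : ℤ) : ℝ) -
        (max (flowTo p y w - 1) 0 + max (1 - flowPast p y w) 0) =
        (c (.inr (.inl w)) * f (.inr (.inl w)) + c (.inr (.inr w)) * f (.inr (.inr w))) -
        (c (.inr (.inl w)) * g (.inr (.inl w)) + c (.inr (.inr w)) * g (.inr (.inr w))) := by
      intro w hw
      have hwr := Finset.ne_of_mem_erase hw
      rw [← hto w hwr, ← hpast w hwr]
      have hgz : g (.inr (.inl w)) = flowTo p y w := if_neg hwr
      have hgt : g (.inr (.inr w)) = flowPast p y w := rfl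
      obtain ⟨h1, h2⟩ := hfg (.inr (.inl w))
      obtain ⟨h3, h4⟩ := hfg (.inr (.inr w))
      rw [hgz] at h1 h2 ⊢
      rw [hgt] at h3 h4 ⊢
      push_cast
      have e1 : max ((f (.inr (.inl w)) : ℝ) - 1) 0 - max (flowTo p y w - 1) 0 =
          c (.inr (.inl w)) * f (.inr (.inl w)) - c (.inr (.inl w)) * flowTo p y w := by
        by_cases hz : 1 ≤ flowTo p y w
        · have hc : c (.inr (.inl w)) = 1 := if_pos hz
          have : (1 : ℤ) ≤ ⌊flowTo p y w⌋ := Int.le_floor.2 (by exact_mod_cast hz)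
          have : (1 : ℝ) ≤ f (.inr (.inl w)) := by exact_mod_cast this.trans h1
          rw [hc, max_eq_left (by linarith), max_eq_left (by linarith)]
          ring
        · have hc : c (.inr (.inl w)) = 0 := if_neg hz
          have : ⌈flowTo p y w⌉ ≤ 1 := Int.ceil_le.2 (by push_cast; linarith)
          have : (f (.inr (.inl w)) : ℝ) ≤ 1 := by exact_mod_cast h2.trans this
          rw [hc, max_eq_right (by linarith), max_eq_right (by linarith)]
          ring
      have e2 : max (1 - (f (.inr (.inr w)) : ℝ)) 0 - max (1 - flowPast p y w) 0 =
          c (.inr (.inr w)) * f (.inr (.inr w)) - c (.inr (.inr w)) * flowPast p y w := by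
        by_cases hz : flowPast p y w < 1
        · have hc : c (.inr (.inr w)) = -1 := if_pos hz
          have : ⌈flowPast p y w⌉ ≤ 1 := Int.ceil_le.2 (by push_cast; linarith)
          have : (f (.inr (.inr w)) : ℝ) ≤ 1 := by exact_mod_cast h4.trans this
          rw [hc, max_eq_left (by linarith), max_eq_left (by linarith)]
          ring
        · have hc : c (.inr (.inr w)) = 0 := if_neg hz
          have : (1 : ℤ) ≤ ⌊flowPast p y w⌋ := Int.le_floor.2 (by push_cast; linarith)
          have : (1 : ℝ) ≤ f (.inr (.inr w)) := by exact_mod_cast this.trans h3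
          rw [hc, max_eq_right (by linarith), max_eq_right (by linarith)]
          ring
      linarith
    have hsum := Finset.sum_congr rfl hlin
    rw [Finset.sum_sub_distrib, Finset.sum_sub_distrib] at hsum
    push_cast at hsum ⊢
    linarith

lemma isConservative_iff {N A R : Type*} [Fintype A] [AddCommMonoid R] [DecidableEq N]
    {src tgt : A → N} {g : A → R} : IsConservative src tgt g ↔
      ∀ n, ∑ a, (if src a = n then g a else 0) = ∑ a, if tgt a = n then g a else 0 := by
  refine forall_congr' fun n => ?_
  congr!

/-- In a graph carrying a positive circulation, no cut consists of a single edge. -/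
lemma IsConservative.card_cut_ne_one {N A : Type*} [Fintype N] [Fintype A] {src tgt : A → N}
    {f : A → ℤ} (hf : IsConservative src tgt f) (hpos : ∀ a, src a ≠ tgt a → 0 < f a) (S : Set N) :
    (Finset.univ.filter fun a => ¬ (src a ∈ S ↔ tgt a ∈ S)).card ≠ 1 := by
  intro hcard
  obtain ⟨a₀, ha₀⟩ := Finset.card_eq_one.1 hcard
  have hmem : ∀ a, ¬ (src a ∈ S ↔ tgt a ∈ S) ↔ a = a₀ := by
    intro a
    simpa using Finset.ext_iff.1 ha₀ a
  have h1 := Finset.sum_congr (rfl : Finset.univ.filter (· ∈ S) = _) fun n _ => hf n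
  rw [Finset.sum_comm, Finset.sum_comm (s := Finset.univ.filter (· ∈ S))] at h1
  simp only [Finset.sum_ite_eq, Finset.mem_filter, Finset.mem_univ, true_and] at h1
  rw [← sub_eq_zero, ← Finset.sum_sub_distrib, Finset.sum_eq_single a₀] at h1
  · have h2 := (hmem a₀).2 rfl
    have h3 := hpos a₀ fun h => h2 (by rw [h])
    by_cases hs : src a₀ ∈ S <;> by_cases ht : tgt a₀ ∈ S <;> simp [hs, ht] at h1 h2 <;> omega
  · intro a _ ha
    have h2 : src a ∈ S ↔ tgt a ∈ S := by
      by_contra h'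
      exact ha ((hmem a).1 h')
    simp [h2]
  · simp

/-- The tree edge above `w` is paired if there are back edges ending at the parent of `w` and
back edges ending further up that cover it. -/
def IsPaired {V : Type*} [Fintype V] (r : V) (p : V → V) (Y : V → V → ℤ) (w : V) : Prop :=
  w ≠ r ∧ 1 ≤ flowTo p Y w ∧ 1 ≤ flowPast p Y w

/-- The number of back edges covering the tree edge above `w`. -/
noncomputable def coverage {V : Type*} [Fintype V] (r : V) (p : V → V) (Y : V → V → ℤ) (w : V) :
    ℤ :=
  if w = r then 0 else flowTo p Y w + flowPast p Y w

/-- A set of back edges, with a selected one for every paired tree edge. -/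
structure IsBackSet {V : Type*} [Fintype V] (r : V) (p : V → V) (Y : V → V → ℤ) (sel : V → V) :
    Prop where
  tree : IsRootedTree r p
  zero_or_one : ∀ u v, Y u v = 0 ∨ Y u v = 1
  isBack : ∀ u v, ¬ IsBack p u v → Y u v = 0
  sel_below : ∀ w, IsPaired r p Y w → Below p (sel w) w
  sel_eq_one : ∀ w, IsPaired r p Y w → Y (sel w) (p w) = 1

/-- The upper end of the tree edge above `w` in the gadget graph, where the lower part of each
parent of a paired edge is split off. -/
noncomputable def gadgetTop {V : Type*} [Fintype V] (r : V) (p : V → V) (Y : V → V → ℤ) (w : V) :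
    V ⊕ V :=
  if IsPaired r p Y w then .inr w else .inl (p w)

/-- Sources of the edges of the gadget graph: covered tree edges, links and back edges.
All other indices are represented by loops. -/
noncomputable def gadgetSrc {V : Type*} [Fintype V] (r : V) (p : V → V) (Y : V → V → ℤ) :
    V ⊕ V ⊕ V × V → V ⊕ V
  | .inl w => if 0 < coverage r p Y w then gadgetTop r p Y w else .inl w
  | .inr (.inl w) => .inl (p w)
  | .inr (.inr a) => .inl a.1

/-- Targets of the edges of the gadget graph. -/
noncomputable def gadgetTgt {V : Type*} [Fintype V] (r : V) (p : V → V) (Y : V → V → ℤ)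
    (sel : V → V) : V ⊕ V ⊕ V × V → V ⊕ V
  | .inl w => .inl w
  | .inr (.inl w) => gadgetTop r p Y w
  | .inr (.inr a) =>
    if Y a.1 a.2 = 1 then
      if IsPaired r p Y (branch r p a.1 a.2) ∧ sel (branch r p a.1 a.2) = a.1 then
        .inr (branch r p a.1 a.2)
      else .inl a.2
    else .inl a.1

lemma IsPaired.two_le_coverage {V : Type*} [Fintype V] {r : V} {p : V → V} {Y : V → V → ℤ} {w : V}
    (h : IsPaired r p Y w) : 2 ≤ coverage r p Y w := by
  obtain ⟨h1, h2, h3⟩ := h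
  rw [coverage, if_neg h1]
  omega

lemma gadgetTop_eq_inr {V : Type*} [Fintype V] {r : V} {p : V → V} {Y : V → V → ℤ} {w c : V} :
    gadgetTop r p Y w = .inr c ↔ IsPaired r p Y c ∧ w = c := by
  unfold gadgetTop
  split_ifs with h
  · simp only [Sum.inr.injEq]
    exact ⟨fun h' => ⟨h' ▸ h, h'⟩, fun h' => h'.2⟩
  · simp only [false_iff, not_and]
    rintro h1 rfl
    exact h h1

lemma gadgetTop_eq_inl {V : Type*} [Fintype V] {r : V} {p : V → V} {Y : V → V → ℤ} {w v : V} :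
    gadgetTop r p Y w = .inl v ↔ ¬ IsPaired r p Y w ∧ p w = v := by
  unfold gadgetTop
  split_ifs with h <;> simp [h]

lemma gadgetSrc_inl_eq_inr {V : Type*} [Fintype V] {r : V} {p : V → V} {Y : V → V → ℤ} {w c : V} :
    gadgetSrc r p Y (.inl w) = .inr c ↔ IsPaired r p Y c ∧ w = c := by
  unfold gadgetSrc
  dsimp only
  split_ifs with h
  · exact gadgetTop_eq_inr
  · simp only [false_iff, not_and]
    rintro h1 rfl
    have := h1.two_le_coverage
    omega

namespace IsBackSet

variable {V : Type*} [Fintype V] {r : V} {p : V → V} {Y : V → V → ℤ} {sel : V → V}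

lemma nonneg (h : IsBackSet r p Y sel) (u v : V) : 0 ≤ Y u v := by
  rcases h.zero_or_one u v with h | h <;> omega

lemma flowTo_nonneg (h : IsBackSet r p Y sel) (w : V) : 0 ≤ flowTo p Y w :=
  Finset.sum_nonneg fun _ _ => h.nonneg _ _

lemma flowPast_nonneg (h : IsBackSet r p Y sel) (w : V) : 0 ≤ flowPast p Y w :=
  Finset.sum_nonneg fun _ _ => Finset.sum_nonneg fun _ _ => h.nonneg _ _

lemma branch_sel (h : IsBackSet r p Y sel) {w : V} (hw : IsPaired r p Y w) :
    branch r p (sel w) (p w) = w := h.tree.branch_eq hw.1 (h.sel_below w hw)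

lemma parent_branch (h : IsBackSet r p Y sel) {u v : V} (huv : Y u v = 1) :
    p (branch r p u v) = v := by
  have : IsBack p u v := by
    by_contra h'
    rw [h.isBack u v h'] at huv
    omega
  exact (h.tree.branch_spec this).2.1

lemma gadgetTgt_eq_inr (h : IsBackSet r p Y sel) {a : V × V} {c : V} :
    gadgetTgt r p Y sel (.inr (.inr a)) = .inr c ↔ IsPaired r p Y c ∧ a = (sel c, p c) := by
  obtain ⟨u, v⟩ := a
  unfold gadgetTgt
  dsimp only
  constructor
  · split_ifs with h1 h2
    · rw [Sum.inr.injEq]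
      rintro rfl
      exact ⟨h2.1, by rw [h2.2, h.parent_branch h1]⟩
    · simp
    · simp
  · rintro ⟨h1, h2⟩
    obtain ⟨rfl, rfl⟩ := Prod.mk.injEq _ _ _ _ ▸ h2
    rw [h.branch_sel h1, if_pos (h.sel_eq_one c h1), if_pos ⟨h1, rfl⟩]

/-- The number of gadget edges of each kind at a split off node. -/
lemma sum_inc_inr (h : IsBackSet r p Y sel) {c : V} (hc : IsPaired r p Y c) :
    ∑ a, inc (gadgetSrc r p Y) (gadgetTgt r p Y sel) a (.inr c) = 3 := by
  have h1 : ∀ w : V, inc (gadgetSrc r p Y) (gadgetTgt r p Y sel) (.inl w) (.inr c) =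
      if w = c then 1 else 0 := by
    intro w
    simp [inc, gadgetSrc_inl_eq_inr, hc, gadgetTgt]
  have h2 : ∀ w : V, inc (gadgetSrc r p Y) (gadgetTgt r p Y sel) (.inr (.inl w)) (.inr c) =
      if w = c then 1 else 0 := by
    intro w
    simp [inc, gadgetTop_eq_inr, hc, gadgetTgt, gadgetSrc]
  have h3 : ∀ a : V × V, inc (gadgetSrc r p Y) (gadgetTgt r p Y sel) (.inr (.inr a)) (.inr c) =
      if a = (sel c, p c) then 1 else 0 := by
    intro w
    simp [inc, h.gadgetTgt_eq_inr, hc, gadgetSrc]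
  rw [Fintype.sum_sum_type, Fintype.sum_sum_type]
  simp only [h1, h2, h3, Finset.sum_ite_eq', Finset.mem_univ, if_true]
  rfl

/-- The flow along tree paths closing up the back edges. -/
noncomputable def gadgetFlow (r : V) (p : V → V) (Y : V → V → ℤ) : V ⊕ V ⊕ V × V → ℤ
  | .inl w => coverage r p Y w
  | .inr (.inl w) => if IsPaired r p Y w then coverage r p Y w - 1 else 0
  | .inr (.inr a) => Y a.1 a.2

lemma coverage_nonneg (h : IsBackSet r p Y sel) (w : V) : 0 ≤ coverage r p Y w := by
  unfold coverage
  have := h.flowTo_nonneg w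
  have := h.flowPast_nonneg w
  split_ifs <;> omega

lemma sum_into (h : IsBackSet r p Y sel) (w : V) :
    ∑ a : V × V, (if gadgetTgt r p Y sel (.inr (.inr a)) = .inl w then Y a.1 a.2 else 0) =
      ∑ c ∈ children r p w, (flowTo p Y c - if IsPaired r p Y c then 1 else 0) := by
  have h1 : ∀ u v, (if gadgetTgt r p Y sel (.inr (.inr (u, v))) = .inl w then Y u v else 0) =
      if v = w then (if IsPaired r p Y (branch r p u w) ∧ sel (branch r p u w) = u then 0
        else Y u w) else 0 := by
    intro u v
    unfold gadgetTgt
    dsimp only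
    rcases h.zero_or_one u v with h0 | h0
    · by_cases hv : v = w
      · subst hv
        simp [h0]
      · simp [h0, hv]
    · by_cases hv : v = w
      · subst hv
        by_cases hs : IsPaired r p Y (branch r p u v) ∧ sel (branch r p u v) = u <;>
          simp [h0, hs]
      · by_cases hs : IsPaired r p Y (branch r p u v) ∧ sel (branch r p u v) = u <;>
          simp [h0, hs, hv]
  rw [Fintype.sum_prod_type]
  simp only [h1, Finset.sum_ite_eq', Finset.mem_univ, if_true]
  have h2 : ∀ u, u ∉ subtree p w → (if IsPaired r p Y (branch r p u w) ∧
      sel (branch r p u w) = u then 0 else Y u w) = 0 := by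
    intro u hu
    rw [h.isBack u w fun h' => hu (mem_subtree.2 h'.1), ite_self]
  rw [← Finset.sum_subset (Finset.subset_univ (subtree p w)) fun u _ => h2 u,
    h.tree.sum_subtree, h.isBack w w fun h' => h'.2.1 rfl, ite_self, zero_add]
  refine Finset.sum_congr rfl fun c hc => ?_
  obtain ⟨hcr, hcw⟩ := mem_children.1 hc
  subst hcw
  unfold flowTo
  rw [eq_sub_iff_add_eq]
  split_ifs with hpair
  · have hs := mem_subtree.2 (h.sel_below c hpair)
    rw [← Finset.add_sum_erase _ _ hs, ← Finset.add_sum_erase _ (fun u => Y u (p c)) hs,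
      h.branch_sel hpair, if_pos ⟨hpair, rfl⟩, h.sel_eq_one c hpair, zero_add, add_comm]
    congr 1
    refine Finset.sum_congr rfl fun u hu => if_neg fun h' => ?_
    rw [Finset.mem_erase, mem_subtree] at hu
    rw [h.tree.branch_eq hcr hu.2] at h'
    exact hu.1 h'.2.symm
  · rw [add_zero]
    refine Finset.sum_congr rfl fun u hu => if_neg fun h' => hpair ?_
    rw [h.tree.branch_eq hcr (mem_subtree.1 hu)] at h'
    exact h'.1

lemma isConservative_gadgetFlow (h : IsBackSet r p Y sel) :
    IsConservative (gadgetSrc r p Y) (gadgetTgt r p Y sel) (gadgetFlow r p Y) := by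
  rw [isConservative_iff]
  rintro (w | c)
  · have e1 : ∀ c, (if gadgetSrc r p Y (.inl c) = .inl w then gadgetFlow r p Y (.inl c) else 0) +
        (if gadgetSrc r p Y (.inr (.inl c)) = .inl w then gadgetFlow r p Y (.inr (.inl c))
          else 0) =
        if c ∈ children r p w then coverage r p Y c - if IsPaired r p Y c then 1 else 0 else 0 := by
      intro c
      simp only [gadgetSrc, gadgetFlow, Sum.inl.injEq, mem_children]
      by_cases hp : IsPaired r p Y c
      · have := hp.two_le_coverage
        have hpos : 0 < coverage r p Y c := by omega
        simp [hpos, gadgetTop_eq_inl, hp, hp.1]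
      · by_cases h0 : 0 < coverage r p Y c
        · have hcr : c ≠ r := by
            rintro rfl
            simp [coverage] at h0
          simp [h0, gadgetTop_eq_inl, hp, hcr]
        · have := le_antisymm (not_lt.1 h0) (h.coverage_nonneg c)
          simp [this, hp]
    have e2 : ∀ c, (if gadgetTgt r p Y sel (.inr (.inl c)) = .inl w then
        gadgetFlow r p Y (.inr (.inl c)) else 0) = 0 := by
      intro c
      simp only [gadgetTgt, gadgetFlow, gadgetTop_eq_inl]
      split_ifs <;> simp_all
    have e3 : ∑ a : V × V, (if gadgetSrc r p Y (.inr (.inr a)) = .inl w then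
        gadgetFlow r p Y (.inr (.inr a)) else 0) = ∑ b, Y w b := by
      rw [Fintype.sum_prod_type, Finset.sum_eq_single w]
      · simp [gadgetSrc, gadgetFlow]
      · intro u _ hu
        simp [gadgetSrc, hu]
      · simp
    have e4 : ∑ c : V, (if gadgetTgt r p Y sel (.inl c) = .inl w then
        gadgetFlow r p Y (.inl c) else 0) = coverage r p Y w := by
      simp [gadgetTgt, gadgetFlow]
    have e5 : ∑ c ∈ children r p w, (coverage r p Y c - if IsPaired r p Y c then 1 else 0) =
        ∑ c ∈ children r p w, flowPast p Y c +
        ∑ c ∈ children r p w, (flowTo p Y c - if IsPaired r p Y c then 1 else 0) := by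
      rw [← Finset.sum_add_distrib]
      refine Finset.sum_congr rfl fun c hc => ?_
      rw [coverage, if_neg (mem_children.1 hc).1]
      ring
    rw [Fintype.sum_sum_type, Fintype.sum_sum_type, Fintype.sum_sum_type, Fintype.sum_sum_type,
      ← add_assoc, ← Finset.sum_add_distrib]
    simp only [e1, e2, e3, e4]
    rw [Finset.sum_ite_mem, Finset.univ_inter, Finset.sum_const_zero, zero_add]
    refine Eq.trans ?_ (congrArg (coverage r p Y w + ·) (h.sum_into w).symm)
    have := h.tree.sum_flowPast_add h.isBack w
    change _ = coverage r p Y w at this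
    rw [e5, ← this]
    ring
  · rw [Fintype.sum_sum_type, Fintype.sum_sum_type, Fintype.sum_sum_type, Fintype.sum_sum_type]
    simp only [gadgetSrc_inl_eq_inr, h.gadgetTgt_eq_inr]
    simp only [gadgetSrc, gadgetTgt, gadgetTop_eq_inr, reduceCtorEq, if_false,
      Finset.sum_const_zero, add_zero, zero_add]
    by_cases hc : IsPaired r p Y c
    · simp [hc, gadgetFlow, h.sel_eq_one c hc]
    · simp [hc]

lemma card_gadget_cut_ne_one (h : IsBackSet r p Y sel) (S : Set (V ⊕ V)) :
    (Finset.univ.filter fun a => ¬ (gadgetSrc r p Y a ∈ S ↔ gadgetTgt r p Y sel a ∈ S)).card ≠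
      1 := by
  refine h.isConservative_gadgetFlow.card_cut_ne_one ?_ S
  rintro (w | w | ⟨u, v⟩) ha
  · simp only [gadgetSrc, gadgetTgt] at ha
    by_contra h0
    exact ha (if_neg h0)
  · simp only [gadgetSrc, gadgetTgt, gadgetTop] at ha
    by_cases hp : IsPaired r p Y w
    · have := hp.two_le_coverage
      simp only [gadgetFlow, if_pos hp]
      omega
    · simp [hp] at ha
  · simp only [gadgetSrc, gadgetTgt] at ha
    rcases h.zero_or_one u v with h0 | h0
    · simp [h0] at ha
    · simp [gadgetFlow, h0]

end IsBackSet

lemma sum_fiber_inc {N M A : Type*} [Fintype N] (src tgt : A → N) (μ : N → M) (a : A) (v : M) :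
    ∑ n ∈ Finset.univ.filter (fun n => μ n = v), inc src tgt a n =
      inc (fun a => μ (src a)) (fun a => μ (tgt a)) a v := by
  simp [inc, Finset.sum_add_distrib]

/-- Multiplicities of the tree edges and the back edges in the tour obtained from a join `J` of
the gadget graph. -/
noncomputable def tourMult {V : Type*} [Fintype V] (r : V) (p : V → V) (Y : V → V → ℤ)
    (J : Finset (V ⊕ V ⊕ V × V)) : V ⊕ V × V → ℕ
  | .inl w => if w = r then 0 else if IsPaired r p Y w then (if .inl w ∈ J then 0 else 1)
      else if 0 < coverage r p Y w then (if .inl w ∈ J then 2 else 1) else 2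
  | .inr a => if Y a.1 a.2 = 1 then (if .inr (.inr a) ∈ J then 0 else 1) else 0

/-- The change of the length of the tour caused by an edge of the join. -/
noncomputable def gadgetCost {V : Type*} [Fintype V] (r : V) (p : V → V) (Y : V → V → ℤ) :
    V ⊕ V ⊕ V × V → ℤ
  | .inl w => if w = r then 0 else if IsPaired r p Y w then -1
      else if 0 < coverage r p Y w then 1 else 0
  | .inr (.inl _) => 0
  | .inr (.inr a) => - Y a.1 a.2

namespace IsBackSet

variable {V : Type*} [Fintype V] {r : V} {p : V → V} {Y : V → V → ℤ} {sel : V → V}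

lemma even_tourMult (h : IsBackSet r p Y sel) {J : Finset (V ⊕ V ⊕ V × V)}
    (hJ : ∀ n, (∑ a ∈ J, inc (gadgetSrc r p Y) (gadgetTgt r p Y sel) a n) % 2 =
      (∑ a, inc (gadgetSrc r p Y) (gadgetTgt r p Y sel) a n) % 2) (v : V) :
    Even (∑ a, tourMult r p Y J a * inc (Sum.elim id Prod.fst) (Sum.elim p Prod.snd) a v) := by
  have htop : ∀ w, Sum.elim id p (gadgetTop r p Y w) = p w := by
    intro w
    unfold gadgetTop
    split_ifs <;> rfl
  have hsrc : ∀ w, Sum.elim id p (gadgetSrc r p Y (.inl w)) =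
      if 0 < coverage r p Y w then p w else w := by
    intro w
    simp only [gadgetSrc]
    split_ifs
    · exact htop w
    · rfl
  have htgt : ∀ u v, Sum.elim id p (gadgetTgt r p Y sel (.inr (.inr (u, v)))) =
      if Y u v = 1 then v else u := by
    intro u v
    simp only [gadgetTgt]
    split_ifs with h1 h2
    · exact h.parent_branch h1
    · rfl
    · rfl
  have h1 : Even (∑ a, (if a ∈ J then 2 else 1) * inc (fun a => Sum.elim id p (gadgetSrc r p Y a))
      (fun a => Sum.elim id p (gadgetTgt r p Y sel a)) a v) := by
    simp only [← sum_fiber_inc, Finset.mul_sum]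
    rw [Finset.sum_comm]
    refine Finset.even_sum _ fun n _ => ?_
    have h2 : ∑ a, (if a ∈ J then 2 else 1) * inc (gadgetSrc r p Y) (gadgetTgt r p Y sel) a n =
        ∑ a ∈ J, inc (gadgetSrc r p Y) (gadgetTgt r p Y sel) a n +
          ∑ a, inc (gadgetSrc r p Y) (gadgetTgt r p Y sel) a n := by
      rw [← Finset.univ_inter J, ← Finset.sum_ite_mem, Finset.univ_inter,
        ← Finset.sum_add_distrib]
      refine Finset.sum_congr rfl fun a _ => ?_
      split_ifs <;> ring
    rw [h2, Nat.even_iff, Nat.add_mod, hJ n, ← Nat.add_mod]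
    omega
  obtain ⟨e, he⟩ : ∃ e : V → ℕ, (∀ (src tgt : V ⊕ V × V → V) a,
      inc src tgt a v = e (src a) + e (tgt a)) ∧ ∀ (src tgt : V ⊕ V ⊕ V × V → V) a,
      inc src tgt a v = e (src a) + e (tgt a) :=
    ⟨fun u => if u = v then 1 else 0, fun _ _ _ => rfl, fun _ _ _ => rfl⟩
  simp only [he.1, he.2] at h1 ⊢
  have h2 : ∀ w, (tourMult r p Y J (.inl w) *
      (e (Sum.elim id Prod.fst (.inl w : V ⊕ V × V)) +
        e (Sum.elim p Prod.snd (.inl w : V ⊕ V × V)))) % 2 =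
      ((if .inl w ∈ J then 2 else 1) * (e (Sum.elim id p (gadgetSrc r p Y (.inl w))) +
        e (Sum.elim id p (gadgetTgt r p Y sel (.inl w))))) % 2 := by
    intro w
    rw [hsrc]
    change (_ * (e w + e (p w))) % 2 = (_ * (_ + e w)) % 2
    simp only [tourMult]
    by_cases hr : w = r
    · have : coverage r p Y w = 0 := by simp [coverage, hr]
      rw [if_pos hr, this]
      split_ifs <;> simp only [lt_irrefl] at * <;> omega
    · by_cases hp : IsPaired r p Y w
      · have := hp.two_le_coverage
        have hc : 0 < coverage r p Y w := by omega
        rw [if_neg hr, if_pos hp, if_pos hc]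
        split_ifs <;> omega
      · rw [if_neg hr, if_neg hp]
        split_ifs <;> omega
  have h3 : ∀ w, ((if .inr (.inl w) ∈ J then 2 else 1) *
      (e (Sum.elim id p (gadgetSrc r p Y (.inr (.inl w)))) +
        e (Sum.elim id p (gadgetTgt r p Y sel (.inr (.inl w)))))) % 2 = 0 := by
    intro w
    simp only [gadgetSrc, gadgetTgt, htop, Sum.elim_inl, id]
    split_ifs <;> omega
  have h4 : ∀ a : V × V, (tourMult r p Y J (.inr a) *
      (e (Sum.elim id Prod.fst (.inr a)) + e (Sum.elim p Prod.snd (.inr a)))) % 2 =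
      ((if .inr (.inr a) ∈ J then 2 else 1) *
        (e (Sum.elim id p (gadgetSrc r p Y (.inr (.inr a)))) +
        e (Sum.elim id p (gadgetTgt r p Y sel (.inr (.inr a)))))) % 2 := by
    rintro ⟨u, u'⟩
    simp only [htgt, tourMult]
    simp only [gadgetSrc, Sum.elim_inl, Sum.elim_inr, id]
    split_ifs <;> omega
  rw [Nat.even_iff, Finset.sum_nat_mod] at h1 ⊢
  rw [Fintype.sum_sum_type] at h1 ⊢
  rw [Fintype.sum_sum_type] at h1
  simpa only [h2, h3, h4, Finset.sum_const_zero, zero_add] using h1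

lemma tourMult_connected (h : IsBackSet r p Y sel) {J : Finset (V ⊕ V ⊕ V × V)}
    (hJ : ∀ c, IsPaired r p Y c →
      ∑ a ∈ J, inc (gadgetSrc r p Y) (gadgetTgt r p Y sel) a (.inr c) = 1)
    (S : Set V) (hne : S.Nonempty)
    (hS : ∀ a, 0 < tourMult r p Y J a →
      ((Sum.elim id Prod.fst a : V) ∈ S ↔ (Sum.elim p Prod.snd a : V) ∈ S)) :
    S = Set.univ := by
  have key : ∀ k w, (subtree p w).card = k → w ≠ r → (w ∈ S ↔ p w ∈ S) := by
    intro k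
    induction k using Nat.strong_induction_on with
    | _ k ih =>
    intro w hk hw
    by_cases hm : 0 < tourMult r p Y J (.inl w)
    · exact hS (.inl w) hm
    simp only [tourMult, if_neg hw] at hm
    by_cases hp : IsPaired r p Y w
    · have hwJ : Sum.inl w ∈ J := by
        by_contra h'
        simp [hp, h'] at hm
      have hsJ : Sum.inr (Sum.inr (sel w, p w)) ∉ J := by
        intro h'
        have h1 := hJ w hp
        have h2 : 1 ≤ inc (gadgetSrc r p Y) (gadgetTgt r p Y sel) (.inl w) (.inr w) := by
          simp [inc, gadgetSrc_inl_eq_inr, hp]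
        have h3 : 1 ≤ inc (gadgetSrc r p Y) (gadgetTgt r p Y sel)
            (.inr (.inr (sel w, p w))) (.inr w) := by
          simp [inc, h.gadgetTgt_eq_inr, hp]
        rw [← Finset.add_sum_erase _ _ hwJ, ← Finset.add_sum_erase _ _
          (Finset.mem_erase.2 ⟨by simp, h'⟩)] at h1
        omega
      have h1 : sel w ∈ S ↔ p w ∈ S := by
        refine hS (.inr (sel w, p w)) ?_
        simp [tourMult, h.sel_eq_one w hp, hsJ]
      rw [← h1]
      have h2 : ∀ j u, p^[j] u = w → (u ∈ S ↔ w ∈ S) := by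
        intro j
        induction j with
        | zero =>
          rintro u rfl
          rfl
        | succ j ihj =>
          intro u hu
          by_cases huw : u = w
          · rw [huw]
          rw [← ihj (p u) hu]
          have hbelow : Below p u w := ⟨_, hu⟩
          refine ih _ ?_ u rfl fun hur => huw ?_
          · rw [← hk]
            refine Finset.card_lt_card (Finset.ssubset_iff_subset_ne.2
              ⟨fun x hx => ?_, fun h' => huw ?_⟩)
            · rw [mem_subtree] at hx ⊢
              exact hx.trans hbelow
            · refine h.tree.antisymm hbelow (mem_subtree.1 ?_)
              rw [h']
              exact mem_subtree.2 (Below.refl p w)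
          · rw [hur]
            exact (h.tree.eq_root (hur ▸ hbelow)).symm
      obtain ⟨j, hj⟩ := h.sel_below w hp
      exact (h2 j _ hj).symm
    · exfalso
      apply hm
      rw [if_neg hp]
      split_ifs <;> norm_num
  have hroot : ∀ j u, p^[j] u = r → (u ∈ S ↔ r ∈ S) := by
    intro j
    induction j with
    | zero =>
      rintro u rfl
      rfl
    | succ j ihj =>
      intro u hu
      by_cases hur : u = r
      · rw [hur]
      · rw [← ihj (p u) hu]
        exact key _ u rfl hur
  have hall : ∀ u, u ∈ S ↔ r ∈ S := fun u => by
    obtain ⟨j, hj⟩ := h.tree.below_root u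
    exact hroot j u hj
  obtain ⟨s, hs⟩ := hne
  exact Set.eq_univ_of_forall fun u => (hall u).2 ((hall s).1 hs)

lemma sum_eq_sum_flowTo (h : IsBackSet r p Y sel) :
    ∑ a : V × V, Y a.1 a.2 = ∑ w ∈ Finset.univ.erase r, flowTo p Y w := by
  have h1 : ∑ w, ∑ u, ∑ v, (if branch r p u v = w then Y u v else 0) =
      ∑ w, if w = r then 0 else flowTo p Y w :=
    Finset.sum_congr rfl fun w _ => h.tree.sum_branch h.isBack w
  rw [Finset.sum_comm, ← Finset.add_sum_erase _ (fun w => if w = r then 0 else flowTo p Y w)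
    (Finset.mem_univ r), if_pos rfl, zero_add] at h1
  rw [Fintype.sum_prod_type]
  refine Eq.trans (Finset.sum_congr rfl fun u _ => ?_) (h1.trans ?_)
  · rw [Finset.sum_comm]
    simp
  · exact Finset.sum_congr rfl fun w hw => if_neg (Finset.ne_of_mem_erase hw)

lemma sum_tourMult_le (h : IsBackSet r p Y sel) {J : Finset (V ⊕ V ⊕ V × V)}
    (hJ : 3 * ∑ a ∈ J, gadgetCost r p Y a ≤ ∑ a, gadgetCost r p Y a) :
    3 * ((∑ a, tourMult r p Y J a : ℕ) : ℤ) ≤ 4 * ((Fintype.card V : ℤ) - 1) +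
      2 * ∑ w ∈ Finset.univ.erase r, (max (flowTo p Y w - 1) 0 + max (1 - flowPast p Y w) 0) := by
  have e1 : ∀ w, (tourMult r p Y J (.inl w) : ℤ) =
      (if w = r then 0 else if IsPaired r p Y w then 1 else if 0 < coverage r p Y w then 1 else 2) +
        if .inl w ∈ J then gadgetCost r p Y (.inl w) else 0 := by
    intro w
    simp only [tourMult, gadgetCost]
    split_ifs <;> norm_num
  have e2 : ∀ a, (tourMult r p Y J (.inr a) : ℤ) =
      Y a.1 a.2 + if .inr (.inr a) ∈ J then gadgetCost r p Y (.inr (.inr a)) else 0 := by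
    intro a
    simp only [tourMult, gadgetCost]
    rcases h.zero_or_one a.1 a.2 with h0 | h0 <;> simp only [h0] <;> split_ifs <;> simp_all
  have e3 : ∑ a ∈ J, gadgetCost r p Y a =
      ∑ w, (if .inl w ∈ J then gadgetCost r p Y (.inl w) else 0) +
        ∑ a, if .inr (.inr a) ∈ J then gadgetCost r p Y (.inr (.inr a)) else 0 := by
    rw [← Finset.univ_inter J, ← Finset.sum_ite_mem, Finset.univ_inter, Fintype.sum_sum_type,
      Fintype.sum_sum_type]
    simp [gadgetCost]
  have e4 : ∑ a, gadgetCost r p Y a =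
      ∑ w, gadgetCost r p Y (.inl w) - ∑ a : V × V, Y a.1 a.2 := by
    rw [Fintype.sum_sum_type, Fintype.sum_sum_type]
    simp [gadgetCost, sub_eq_add_neg]
  have e5 : ∀ w ∈ Finset.univ.erase r,
      3 * (if w = r then 0 else if IsPaired r p Y w then 1
        else if 0 < coverage r p Y w then 1 else 2) + gadgetCost r p Y (.inl w) +
        2 * flowTo p Y w ≤
      4 + 2 * (max (flowTo p Y w - 1) 0 + max (1 - flowPast p Y w) 0) := by
    intro w hw
    have hwr := Finset.ne_of_mem_erase hw
    have := h.flowTo_nonneg w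
    have := h.flowPast_nonneg w
    simp only [gadgetCost, IsPaired, coverage, hwr, ne_eq, not_false_eq_true, true_and, if_false]
    split_ifs <;> omega
  have e6 := Finset.sum_le_sum e5
  have e7 : ∑ w ∈ Finset.univ.erase r, (4 : ℤ) = 4 * ((Fintype.card V : ℤ) - 1) := by
    rw [Finset.sum_const, Finset.card_erase_of_mem (Finset.mem_univ r), Finset.card_univ,
      nsmul_eq_mul, Nat.cast_sub (Fintype.card_pos_iff.2 ⟨r⟩)]
    push_cast
    ring
  have e8 : ∀ f : V → ℤ, f r = 0 → ∑ w, f w = ∑ w ∈ Finset.univ.erase r, f w := by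
    intro f hf
    rw [← Finset.add_sum_erase _ _ (Finset.mem_univ r), hf, zero_add]
  rw [Fintype.sum_sum_type]
  push_cast
  simp only [e1, e2, Finset.sum_add_distrib]
  rw [Finset.sum_add_distrib, Finset.sum_add_distrib, Finset.sum_add_distrib, ← Finset.mul_sum,
    ← Finset.mul_sum, ← Finset.mul_sum, e7, ← h.sum_eq_sum_flowTo, ← e8 _ (if_pos rfl),
    ← e8 (fun w => gadgetCost r p Y (.inl w)) (if_pos rfl)] at e6
  rw [Finset.sum_add_distrib] at e6
  linarith

end IsBackSet

/-- A rooted spanning tree together with a set of back edges yields a short tour. -/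
theorem IsRootedTree.exists_closed_walk {V : Type*} [Fintype V] {G : SimpleGraph V} {r : V}
    {p : V → V} (h : IsRootedTree r p) (hadj : ∀ w, w ≠ r → G.Adj w (p w)) {Y : V → V → ℤ}
    (h01 : ∀ u v, Y u v = 0 ∨ Y u v = 1) (hback : ∀ u v, ¬ IsBack p u v → Y u v = 0)
    (hY : ∀ u v, Y u v = 1 → G.Adj u v) :
    ∃ (v : V) (w : G.Walk v v), (∀ u, u ∈ w.support) ∧
      3 * (w.length : ℤ) ≤ 4 * ((Fintype.card V : ℤ) - 1) +
      2 * ∑ w ∈ Finset.univ.erase r, (max (flowTo p Y w - 1) 0 + max (1 - flowPast p Y w) 0) := by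
  have hsel : ∀ w, ∃ u, IsPaired r p Y w → Below p u w ∧ Y u (p w) = 1 := by
    intro w
    by_cases hw : IsPaired r p Y w
    · have hpos : 0 < flowTo p Y w := by
        have := hw.2.1
        omega
      obtain ⟨u, hu, hupos⟩ := Finset.exists_lt_of_sum_lt
        (lt_of_eq_of_lt (Finset.sum_const_zero (s := subtree p w)) hpos)
      refine ⟨u, fun _ => ⟨mem_subtree.1 hu, (h01 _ _).resolve_left hupos.ne'⟩⟩
    · exact ⟨w, fun h' => absurd h' hw⟩
  choose sel hsel using hsel
  have hB : IsBackSet r p Y sel :=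
    ⟨h, h01, hback, fun w hw => (hsel w hw).1, fun w hw => (hsel w hw).2⟩
  obtain ⟨J, hJ, hJP, hJc⟩ := exists_join_cost_le_of_cubic (gadgetSrc r p Y) (gadgetTgt r p Y sel)
    hB.card_gadget_cut_ne_one ((Finset.univ.filter (IsPaired r p Y)).image Sum.inr)
    (fun n hn => by
      obtain ⟨c, hc, rfl⟩ := Finset.mem_image.1 hn
      exact hB.sum_inc_inr (Finset.mem_filter.1 hc).2) (gadgetCost r p Y)
  have : Nonempty V := ⟨r⟩
  obtain ⟨v, w, hw, hlen⟩ := exists_closed_walk_of_even_mult (G := G)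
    (src := Sum.elim id Prod.fst) (tgt := Sum.elim p Prod.snd) (m := tourMult r p Y J)
    (by
      rintro (w | ⟨u, v⟩) hm
      · refine hadj w fun hw => ?_
        simp [tourMult, hw] at hm
      · refine hY u v ?_
        by_contra h'
        simp [tourMult, h'] at hm)
    (hB.even_tourMult hJ)
    (hB.tourMult_connected fun c hc => hJP _ (Finset.mem_image.2
      ⟨c, Finset.mem_filter.2 ⟨Finset.mem_univ c, hc⟩, rfl⟩))
  refine ⟨v, w, hw, le_trans ?_ (hB.sum_tourMult_le hJc)⟩
  have : (w.length : ℤ) ≤ ((∑ a, tourMult r p Y J a : ℕ) : ℤ) := by exact_mod_cast hlen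
  linarith

section HeldKarp

variable {V : Type*} [Fintype V] {G : SimpleGraph V}

/-- The extension by zero of a function on the edges of `G` to all pairs. -/
noncomputable def edgeExtension (G : SimpleGraph V) (x : Sym2 V → ℝ) (e : Sym2 V) : ℝ :=
  if e ∈ G.edgeSet then x e else 0

lemma sum_edgeExtension (x : Sym2 V → ℝ) : ∑ e, edgeExtension G x e = lpValue G x := by
  simp only [edgeExtension, lpValue, Finset.sum_filter]

lemma pairCut_edgeExtension (x : Sym2 V → ℝ) (S : Finset V) :
    pairCut (edgeExtension G x) S = cutValue G x S := by
  unfold pairCut cutValue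
  rw [← Fintype.sum_prod_type' (f := fun a b => if a ∈ S ∧ b ∉ S then
    edgeExtension G x s(a, b) else 0), ← Finset.sum_filter]
  have : ∀ q ∈ Finset.univ.filter (fun q : V × V => q.1 ∈ S ∧ q.2 ∉ S),
      edgeExtension G x s(q.1, q.2) =
        if s(q.1, q.2) ∈ G.edgeSet then x s(q.1, q.2) else 0 := fun _ _ => rfl
  rw [Finset.sum_congr rfl this, ← Finset.sum_filter, Finset.filter_filter]
  refine Finset.sum_bij (fun q _ => s(q.1, q.2)) ?_ ?_ ?_ ?_
  · rintro ⟨a, b⟩ hq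
    simp only [Finset.mem_filter, Finset.mem_univ, true_and] at hq ⊢
    exact ⟨hq.2, a, b, rfl, hq.1.1, hq.1.2⟩
  · rintro ⟨a, b⟩ hq ⟨a', b'⟩ hq' heq
    simp only [Finset.mem_filter, Finset.mem_univ, true_and] at hq hq'
    rcases Sym2.eq_iff.1 heq with ⟨h1, h2⟩ | ⟨h1, h2⟩
    · exact Prod.ext h1 h2
    · simp only at h1 h2
      exact absurd hq.1.1 (h1 ▸ hq'.1.2)
  · intro e he
    simp only [Finset.mem_filter, Finset.mem_univ, true_and] at he
    obtain ⟨he, a, b, rfl, ha, hb⟩ := he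
    exact ⟨(a, b), by simpa using ⟨⟨ha, hb⟩, he⟩, rfl⟩
  · intro q _
    rfl

lemma sum_sum_eq_two_mul_sum {y : Sym2 V → ℝ} (hdiag : ∀ v, y s(v, v) = 0) :
    ∑ v, ∑ u, y s(v, u) = 2 * ∑ e, y e := by
  rw [← Fintype.sum_prod_type' (f := fun v u => y s(v, u)),
    ← Finset.sum_fiberwise (g := fun q : V × V => s(q.1, q.2)), Finset.mul_sum]
  refine Finset.sum_congr rfl fun e _ => ?_
  induction e with | _ a b =>
  by_cases hab : a = b
  · subst hab
    rw [hdiag, mul_zero]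
    refine Finset.sum_eq_zero fun q hq => ?_
    rw [(Finset.mem_filter.1 hq).2, hdiag]
  · have : Finset.univ.filter (fun q : V × V => s(q.1, q.2) = s(a, b)) = {(a, b), (b, a)} := by
      ext ⟨c, d⟩
      simp
    rw [this, Finset.sum_pair (by simp [hab]), Sym2.eq_swap]
    ring

lemma IsHeldKarp.exists_closed_walk {x : Sym2 V → ℝ} (hx : IsHeldKarp G x)
    (hV : 2 ≤ Fintype.card V) :
    ∃ (v : V) (w : G.Walk v v), (∀ u, u ∈ w.support) ∧
      (w.length : ℝ) ≤ (10 / 9) * lpValue G x + (Fintype.card V : ℝ) / 3 := by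
  have : Nonempty V := Fintype.card_pos_iff.1 (by omega)
  obtain ⟨y, hy0, hysupp, hycut, hysum, hycard⟩ := exists_sparse (edgeExtension G x)
    (fun e => by
      unfold edgeExtension
      split_ifs with he
      exacts [hx.1 e he, le_rfl])
    (fun S hS hS' => by
      rw [pairCut_edgeExtension]
      exact hx.2 S hS (by simpa using hS'))
  rw [sum_edgeExtension] at hysum
  have hadj : ∀ u v, y s(u, v) ≠ 0 → G.Adj u v := by
    intro u v huv
    by_contra h
    exact huv (hysupp _ (if_neg h))
  obtain ⟨r⟩ := this
  obtain ⟨p, hp⟩ := exists_isGreedyTree (c := fun u v => y s(u, v)) (S := Finset.univ) (r := r)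
    (fun u v => by rw [Sym2.eq_swap]) (Finset.mem_univ r) (fun T _ hr hT => by
      have hcut := hycut T ⟨r, hr⟩ hT
      rw [pairCut_eq] at hcut
      by_contra! hle
      have : ∑ a ∈ T, ∑ b ∈ Tᶜ, y s(a, b) ≤ 0 :=
        Finset.sum_nonpos fun a ha => Finset.sum_nonpos fun b hb =>
          hle a ha b (Finset.mem_univ b) (Finset.mem_compl.1 hb)
      linarith)
  have hloss := hp.fractional_loss_le hy0 hycut hycard hV
  rw [sum_sum_eq_two_mul_sum fun v => by_contra fun h => G.irrefl (hadj v v h)] at hloss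
  obtain ⟨Y, hY01, hY0, hYle⟩ := hp.isRootedTree.exists_integral_back (y := backWeight p y)
    (fun u v h => if_neg h)
    (fun u v => by
      unfold backWeight
      split_ifs
      exacts [le_min (hy0 _) zero_le_one, le_rfl])
    (fun u v => by
      unfold backWeight
      split_ifs
      exacts [min_le_right _ _, zero_le_one])
  obtain ⟨v, w, hw, hlen⟩ := hp.isRootedTree.exists_closed_walk (G := G) (Y := Y)
    (fun w hw => hadj _ _ (hp.pos w (Finset.mem_univ w) hw).ne') hY01
    (fun u v h => hY0 u v (if_neg h))
    (fun u v h => hadj u v fun h0 => by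
      have : Y u v = 0 := hY0 u v (by simp [backWeight, h0])
      omega)
  refine ⟨v, w, hw, ?_⟩
  have hlen' := (Int.cast_le (R := ℝ)).2 hlen
  rw [Int.cast_add, Int.cast_mul 2] at hlen'
  push_cast at hlen' hYle
  linarith

end HeldKarp

theorem twoConnected_spanning_closed_walk {V : Type*} [Fintype V] (G : SimpleGraph V)
    (h2c : IsTwoVertexConnected G) (hfeas : ∃ x : Sym2 V → ℝ, IsHeldKarp G x) :
    ∃ (v : V) (w : G.Walk v v), (∀ u : V, u ∈ w.support) ∧
      (w.length : ℝ) ≤ (10 / 9) * optLP G + (Fintype.card V : ℝ) / 3 := by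
  have hV : 2 ≤ Fintype.card V := by
    have := h2c.1
    omega
  have hex : ∃ k, ∃ (v : V) (w : G.Walk v v), (∀ u : V, u ∈ w.support) ∧ w.length = k := by
    obtain ⟨x, hx⟩ := hfeas
    obtain ⟨v, w, hw, -⟩ := hx.exists_closed_walk hV
    exact ⟨_, v, w, hw, rfl⟩
  obtain ⟨v, w, hw, hlen⟩ := Nat.find_spec hex
  refine ⟨v, w, hw, ?_⟩
  have hle : ((w.length : ℝ) - (Fintype.card V : ℝ) / 3) * (9 / 10) ≤ optLP G := by
    refine le_csInf ?_ ?_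
    · obtain ⟨x, hx⟩ := hfeas
      exact ⟨_, x, hx, rfl⟩
    · rintro _ ⟨x, hx, rfl⟩
      obtain ⟨v', w', hw', hlen'⟩ := hx.exists_closed_walk hV
      have : w.length ≤ w'.length := hlen ▸ Nat.find_min' hex ⟨v', w', hw', rfl⟩
      have : (w.length : ℝ) ≤ w'.length := by exact_mod_cast this
      linarith
  linarith
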